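/- Let S be a compact, orientable, two-dimensional embedded C^∞ submanifold of ℝ³ without boundary. There exist constants c > 0 and h₀ > 0, depending only on S and γ₀, such that for every admissible quasi-uniform triangulation T_h with h ≤ h₀, the solution u of −Δ_S u + u = f and the lifted discrete solution U_h satisfy the H¹-error estimate ( ∫_S |u − U_h|² + |∇_S(u − U_h)|² )^{1/2} ≤ c h ( ∫_S f² )^{1/2}. -/

import Mathlib

open MeasureTheory Metric
open scoped RealInnerProductSpace ENNReal NNReal

noncomputable section

/-- Ambient Euclidean space `ℝ³`. -/
abbrev E3 : Type := EuclideanSpace ℝ (Fin 3)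

/-- The tangential gradient of `w : E3 → ℝ` along the set `A` at `x`, with values projected
onto the subspace `P`: the orthogonal projection onto `P` of the Riesz representative of the
derivative of `w` within `A` at `x`. -/
def tGrad (A : Set E3) (P : Submodule ℝ E3) (w : E3 → ℝ) (x : E3) : E3 :=
  (Submodule.orthogonalProjectionOnto P ((InnerProductSpace.toDual ℝ E3).symm (fderivWithin ℝ w A x)) : E3)

/-- A compact, orientable, two-dimensional embedded `C^∞` submanifold of `ℝ³` without boundary,
described by a global smooth unit normal field `n` and local smooth regular defining functions. -/
structure SmoothSurface where
  S : Set E3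
  n : E3 → E3
  compact : IsCompact S
  nonempty : S.Nonempty
  localLevel : ∀ x ∈ S, ∃ U : Set E3, ∃ F : E3 → ℝ, IsOpen U ∧ x ∈ U ∧
    ContDiff ℝ (⊤ : ℕ∞) F ∧ S ∩ U = {y ∈ U | F y = 0} ∧
    (∀ y ∈ U, gradient F y ≠ 0) ∧
    (∀ y, y ∈ S ∩ U → ∃ t : ℝ, gradient F y = t • n y)
  n_unit : ∀ x ∈ S, ‖n x‖ = 1
  n_smooth : ∃ U : Set E3, IsOpen U ∧ S ⊆ U ∧ ContDiffOn ℝ (⊤ : ℕ∞) n U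

namespace SmoothSurface

variable (Srf : SmoothSurface)

/-- The tangent plane of `S` at `x`, as the orthogonal complement of the normal. -/
def tangent (x : E3) : Submodule ℝ E3 := (ℝ ∙ Srf.n x)ᗮ

/-- The tangential gradient `∇_S w` on the surface. -/
def grad (w : E3 → ℝ) (x : E3) : E3 := tGrad Srf.S (Srf.tangent x) w x

/-- The bilinear form `a(v,w) = ∫_S (⟨∇_S v, ∇_S w⟩ + v w)` (w.r.t. 2-dimensional
Hausdorff measure on `S`). -/
def aForm (v w : E3 → ℝ) : ℝ :=
  ∫ x in Srf.S, (⟪Srf.grad v x, Srf.grad w x⟫ + v x * w x) ∂μH[2]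

end SmoothSurface

/-- The (closed, flat) triangle with vertices `t.1, t.2.1, t.2.2`. -/
def triOf (t : E3 × E3 × E3) : Set E3 := convexHull ℝ {t.1, t.2.1, t.2.2}

/-- The vertex set of a triangle. -/
def vertsOf (t : E3 × E3 × E3) : Set E3 := {t.1, t.2.1, t.2.2}

/-- The plane spanned by a triangle. -/
def planeOf (t : E3 × E3 × E3) : Set E3 := (affineSpan ℝ (vertsOf t) : Set E3)

/-- The direction (2-dimensional linear subspace) of the plane of a triangle. -/
def dirOf (t : E3 × E3 × E3) : Submodule ℝ E3 := (affineSpan ℝ (vertsOf t)).direction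

/-- The triangle-wise tangential gradient `∇_{S_h} w` on the triangle `t`. -/
def gradTri (t : E3 × E3 × E3) (w : E3 → ℝ) (x : E3) : E3 := tGrad (triOf t) (dirOf t) w x

/-- An admissible quasi-uniform triangulation `T_h` of the surface `Srf` with mesh parameter `h`
and quasi-uniformity constant `γ₀`, together with the nearest-point projection `a` defined on
a tubular neighbourhood `N` of the surface. -/
structure Triangulation (Srf : SmoothSurface) (γ₀ h : ℝ) where
  T : Finset (E3 × E3 × E3)
  a : E3 → E3
  N : Set E3
  T_nonempty : T.Nonempty
  indep : ∀ t ∈ T, AffineIndependent ℝ ![t.1, t.2.1, t.2.2]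
  verts_on : ∀ t ∈ T, vertsOf t ⊆ Srf.S
  meet : ∀ t ∈ T, ∀ t' ∈ T, t ≠ t' →
    triOf t ∩ triOf t' = ∅ ∨
    (∃ v, v ∈ vertsOf t ∩ vertsOf t' ∧ triOf t ∩ triOf t' = {v}) ∨
    (∃ v w, v ≠ w ∧ v ∈ vertsOf t ∩ vertsOf t' ∧ w ∈ vertsOf t ∩ vertsOf t' ∧
      triOf t ∩ triOf t' = segment ℝ v w)
  diam_le : ∀ t ∈ T, Metric.diam (triOf t) ≤ h
  disk : ∀ t ∈ T, ∃ y ∈ triOf t, closedBall y (γ₀ * h) ∩ planeOf t ⊆ triOf t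
  N_open : IsOpen N
  S_sub : Srf.S ⊆ N
  Sh_sub : (⋃ t ∈ T, triOf t) ⊆ N
  a_smooth : ContDiffOn ℝ (⊤ : ℕ∞) a N
  a_mem : ∀ x ∈ N, a x ∈ Srf.S
  a_nearest : ∀ x ∈ N, ∀ y ∈ Srf.S, dist x (a x) ≤ dist x y
  a_unique : ∀ x ∈ N, ∀ y ∈ Srf.S, dist x y = dist x (a x) → y = a x
  a_bij : Set.BijOn a (⋃ t ∈ T, triOf t) Srf.S

namespace Triangulation

variable {Srf : SmoothSurface} {γ₀ h : ℝ} (Tr : Triangulation Srf γ₀ h)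

/-- The polyhedral surface `S_h`, the union of the triangles. -/
def Sh : Set E3 := ⋃ t ∈ Tr.T, triOf t

/-- Membership in the finite element space `V_h` of continuous, piecewise affine functions
on `S_h` (as functions `E3 → ℝ`; only the values on `S_h` are relevant). -/
def IsVh (v : E3 → ℝ) : Prop :=
  ContinuousOn v Tr.Sh ∧
  ∀ t ∈ Tr.T, ∃ (L : E3 →ₗ[ℝ] ℝ) (c : ℝ), ∀ x ∈ triOf t, v x = L x + c


/-- The discrete bilinear form
`a_h(v,w) = ∫_{S_h} (⟨∇_{S_h} v, ∇_{S_h} w⟩ + v w)`, computed triangle by triangle. -/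
def ahForm (v w : E3 → ℝ) : ℝ :=
  ∑ t ∈ Tr.T, ∫ x in triOf t,
    (⟪gradTri t v x, gradTri t w x⟫ + v x * w x) ∂μH[2]

/-- The lift of a function on `S_h` to a function on `S` via the inverse of `a|_{S_h}`. -/
def liftS (w : E3 → ℝ) : E3 → ℝ := fun y => w (Function.invFunOn Tr.a Tr.Sh y)

/-- The lift of `f : S → ℝ` to `S_h` is `f ∘ a`. -/
def liftSh (f : E3 → ℝ) : E3 → ℝ := fun x => f (Tr.a x)

end Triangulation

/-- `f` is smooth in a neighbourhood of the set `A`. -/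
def SmoothNear (f : E3 → ℝ) (A : Set E3) : Prop :=
  ∃ V : Set E3, IsOpen V ∧ A ⊆ V ∧ ContDiffOn ℝ (⊤ : ℕ∞) f V

/-- `u` is the (weak, hence smooth) solution of `-Δ_S u + u = f` on the surface `Srf`. -/
def IsSolution (Srf : SmoothSurface) (f u : E3 → ℝ) : Prop :=
  SmoothNear u Srf.S ∧
  ∀ φ : E3 → ℝ, ContDiff ℝ (⊤ : ℕ∞) φ → Srf.aForm u φ = ∫ x in Srf.S, f x * φ x ∂μH[2]

/-- `uh` is the discrete Galerkin solution in `V_h` with data the lift `f ∘ a` of `f`. -/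
def Triangulation.IsDiscreteSolution {Srf : SmoothSurface} {γ₀ h : ℝ}
    (Tr : Triangulation Srf γ₀ h) (f uh : E3 → ℝ) : Prop :=
  Tr.IsVh uh ∧
  ∀ φh : E3 → ℝ, Tr.IsVh φh →
    Tr.ahForm uh φh = ∫ x in Tr.Sh, f (Tr.a x) * φh x ∂μH[2]

/-- Orthogonal projection onto the affine tangent plane of `S` at `z₀`. -/
def SmoothSurface.P0 (Srf : SmoothSurface) (z₀ : E3) (x : E3) : E3 :=
  z₀ + (Submodule.orthogonalProjectionOnto (Srf.tangent z₀) (x - z₀) : E3)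

/-- `r(x) = ‖P₀(x) − z₀‖`, the distance of the tangential projection of `x` to `z₀`. -/
def SmoothSurface.rfn (Srf : SmoothSurface) (z₀ : E3) (x : E3) : ℝ :=
  ‖Srf.P0 z₀ x - z₀‖

/-- The affine tangent plane `z₀ + T_{z₀}S`. -/
def SmoothSurface.tplane (Srf : SmoothSurface) (z₀ : E3) : Set E3 :=
  {x : E3 | x - z₀ ∈ Srf.tangent z₀}

/-- The disk `D = B₁₀₀(z₀)` in the affine tangent plane at `z₀`. -/
def SmoothSurface.disk100 (Srf : SmoothSurface) (z₀ : E3) : Set E3 :=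
  Srf.tplane z₀ ∩ closedBall z₀ 100

/-- `r₁ > 0` is a graph radius for `S`: uniformly in `z₀ ∈ S`, the piece `B_{2r₁}(z₀) ∩ S`
is a graph over the tangent plane at `z₀`, in particular `P₀` is injective on it. -/
def SmoothSurface.IsGraphRadius (Srf : SmoothSurface) (r₁ : ℝ) : Prop :=
  0 < r₁ ∧ r₁ ≤ 1 ∧ ∀ z₀ ∈ Srf.S, Set.InjOn (Srf.P0 z₀) (Srf.S ∩ closedBall z₀ (2 * r₁))

/-- `ζ` is an admissible smooth cutoff at `z₀`: supported in the ball of radius `3r₁/2`,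
equal to `1` on the ball of radius `r₁`, with `C²`-bounds at most `Cζ` (uniform in `z₀`). -/
def IsCutoff (z₀ : E3) (r₁ Cζ : ℝ) (ζ : E3 → ℝ) : Prop :=
  ContDiff ℝ (⊤ : ℕ∞) ζ ∧ tsupport ζ ⊆ closedBall z₀ (3 / 2 * r₁) ∧
  (∀ x ∈ closedBall z₀ r₁, ζ x = 1) ∧
  ∀ x : E3, |ζ x| + ‖fderiv ℝ ζ x‖ + ‖fderiv ℝ (fderiv ℝ ζ) x‖ ≤ Cζ

/-- `v` is the Neumann Green's function with pole `z₀` of `−Δ + 1` on the disk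
`D = B₁₀₀(z₀)` in the tangent plane at `z₀`: it is smooth away from the pole, satisfies
`∫_D (⟨∇v, ∇φ⟩ + v φ) = φ(z₀)` for every smooth test function, and differs from
`(1/2π) log‖· − z₀‖` by an `H²(D)`-function with norm at most `CG`. -/
def SmoothSurface.IsGreen (Srf : SmoothSurface) (z₀ : E3) (CG : ℝ) (v : E3 → ℝ) : Prop :=
  ContDiffOn ℝ (⊤ : ℕ∞) v (Srf.disk100 z₀ \ {z₀}) ∧
  (∀ φ : E3 → ℝ, ContDiff ℝ (⊤ : ℕ∞) φ →
    ∫ x in Srf.disk100 z₀,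
      (⟪tGrad (Srf.disk100 z₀) (Srf.tangent z₀) v x,
        tGrad (Srf.disk100 z₀) (Srf.tangent z₀) φ x⟫ + v x * φ x) ∂μH[2] = φ z₀) ∧
  (∫ x in Srf.disk100 z₀,
      ((v x - (1 / (2 * Real.pi)) * Real.log ‖x - z₀‖) ^ 2 +
        ‖fderivWithin ℝ (fun y => v y - (1 / (2 * Real.pi)) * Real.log ‖y - z₀‖)
            (Srf.disk100 z₀) x‖ ^ 2 +
        ‖fderivWithin ℝ
            (fun y => fderivWithin ℝ
              (fun y' => v y' - (1 / (2 * Real.pi)) * Real.log ‖y' - z₀‖)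
              (Srf.disk100 z₀) y)
            (Srf.disk100 z₀) x‖ ^ 2) ∂μH[2]) ≤ CG

/-- The approximate Green's function `g̃(x) = ζ(x) v(P₀(x))` on `S`. -/
def approxGreen (Srf : SmoothSurface) (z₀ : E3) (ζ v : E3 → ℝ) : E3 → ℝ :=
  fun x => ζ x * v (Srf.P0 z₀ x)

/-- The cut-off lifted logarithm `l̃(x) = ζ(x) log r(x)` on `S`. -/
def cutLog (Srf : SmoothSurface) (z₀ : E3) (ζ : E3 → ℝ) : E3 → ℝ :=
  fun x => ζ x * Real.log (Srf.rfn z₀ x)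

/-- `lh` is the discrete (Galerkin) projection of the function `w` on `S`:
`a_h(lh, v_h) = a(w, V_h)` for all `v_h ∈ V_h`, where `V_h` is the lift of `v_h` to `S`. -/
def Triangulation.IsDiscreteProjection {Srf : SmoothSurface} {γ₀ h : ℝ}
    (Tr : Triangulation Srf γ₀ h) (w lh : E3 → ℝ) : Prop :=
  Tr.IsVh lh ∧ ∀ vh : E3 → ℝ, Tr.IsVh vh → Tr.ahForm lh vh = Srf.aForm w (Tr.liftS vh)



/-- The Euclidean plane. -/
abbrev H2 : Type := EuclideanSpace ℝ (Fin 2)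

instance h2_haar : (μH[2] : Measure H2).IsAddHaarMeasure := by
  have := isAddHaarMeasure_hausdorffMeasure (E := H2)
  have h : ((Module.finrank ℝ H2 : ℕ) : ℝ) = 2 := by simp
  rwa [h] at this

lemma haus_image_le {α X Y : Type*} [EMetricSpace X] [EMetricSpace Y] [MeasurableSpace X]
    [BorelSpace X] [MeasurableSpace Y] [BorelSpace Y] (G : α → X) (L : α → Y) (A : Set α) (K : ℝ≥0)
    (hd : ∀ x ∈ A, ∀ x' ∈ A, edist (G x) (G x') ≤ K * edist (L x) (L x')) :
    μH[2] (G '' A) ≤ (K : ℝ≥0∞) ^ 2 * μH[2] (L '' A) := by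
  rcases A.eq_empty_or_nonempty with rfl | hne
  · simp
  obtain ⟨x0, hx0⟩ := hne
  have : Nonempty α := ⟨x0⟩
  have hL : LipschitzOnWith K (fun y => G (Function.invFunOn L A y)) (L '' A) := by
    rintro _ ⟨x, hx, rfl⟩ _ ⟨x', hx', rfl⟩
    have h1 : ∃ a ∈ A, L a = L x := ⟨x, hx, rfl⟩
    have h2 : ∃ a ∈ A, L a = L x' := ⟨x', hx', rfl⟩
    have := hd _ (Function.invFunOn_mem h1) _ (Function.invFunOn_mem h2)
    rwa [Function.invFunOn_eq h1, Function.invFunOn_eq h2] at this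
  have h := hL.hausdorffMeasure_image_le (d := 2) (by norm_num)
  have hs : (fun y => G (Function.invFunOn L A y)) '' (L '' A) = G '' A := by
    ext z
    constructor
    · rintro ⟨_, ⟨x, hx, rfl⟩, rfl⟩
      exact ⟨_, Function.invFunOn_mem ⟨x, hx, rfl⟩, rfl⟩
    · rintro ⟨x, hx, rfl⟩
      refine ⟨L x, ⟨x, hx, rfl⟩, ?_⟩
      have h1 : ∃ a ∈ A, L a = L x := ⟨x, hx, rfl⟩
      have := hd _ (Function.invFunOn_mem h1) _ hx
      rw [Function.invFunOn_eq h1] at this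
      simp only [edist_self, mul_zero, nonpos_iff_eq_zero] at this
      exact edist_eq_zero.1 this
  rw [hs] at h
  refine h.trans (le_of_eq ?_)
  norm_num



/-- A smooth nearest point projection on an open neighbourhood. -/
structure PJ (Srf : SmoothSurface) where
  a : E3 → E3
  N : Set E3
  N_open : IsOpen N
  S_sub : Srf.S ⊆ N
  a_smooth : ContDiffOn ℝ (⊤ : ℕ∞) a N
  a_mem : ∀ x ∈ N, a x ∈ Srf.S
  a_nearest : ∀ x ∈ N, ∀ y ∈ Srf.S, dist x (a x) ≤ dist x y
  a_unique : ∀ x ∈ N, ∀ y ∈ Srf.S, dist x y = dist x (a x) → y = a x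

/-- The projection of a triangulation. -/
def Triangulation.toPJ {Srf : SmoothSurface} {γ₀ h : ℝ} (Tr : Triangulation Srf γ₀ h) : PJ Srf :=
  ⟨Tr.a, Tr.N, Tr.N_open, Tr.S_sub, Tr.a_smooth, Tr.a_mem, Tr.a_nearest, Tr.a_unique⟩

namespace PJ
variable {Srf : SmoothSurface} (Q : PJ Srf)

lemma agree (Q' : PJ Srf) {x : E3} (hx : x ∈ Q.N) (hx' : x ∈ Q'.N) : Q'.a x = Q.a x :=
  Q.a_unique x hx _ (Q'.a_mem x hx')
    (le_antisymm (Q'.a_nearest x hx' _ (Q.a_mem x hx)) (Q.a_nearest x hx _ (Q'.a_mem x hx')))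

lemma fix {y : E3} (hy : y ∈ Srf.S) : Q.a y = y :=
  (Q.a_unique y (Q.S_sub hy) y hy (by
    have := Q.a_nearest y (Q.S_sub hy) y hy
    rw [dist_self] at this ⊢
    exact (le_antisymm this dist_nonneg).symm)).symm

lemma nh {x : E3} (hx : x ∈ Q.N) : Q.N ∈ nhds x := Q.N_open.mem_nhds hx

lemma cda {x : E3} (hx : x ∈ Q.N) : ContDiffAt ℝ (⊤ : ℕ∞) Q.a x :=
  Q.a_smooth.contDiffAt (Q.nh hx)

lemma diff {x : E3} (hx : x ∈ Q.N) : DifferentiableAt ℝ Q.a x :=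
  (Q.cda hx).differentiableAt (by simp)

lemma idem {x : E3} (hx : x ∈ Q.N) : Q.a (Q.a x) = Q.a x := Q.fix (Q.a_mem x hx)

lemma memN {x : E3} (hx : x ∈ Q.N) : Q.a x ∈ Q.N := Q.S_sub (Q.a_mem x hx)

lemma deriv_comp {x : E3} (hx : x ∈ Q.N) (v : E3) :
    fderiv ℝ Q.a (Q.a x) (fderiv ℝ Q.a x v) = fderiv ℝ Q.a x v := by
  have h1 : (fun z => Q.a (Q.a z)) =ᶠ[nhds x] Q.a := by
    filter_upwards [Q.nh hx] with z hz using Q.idem hz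
  have h2 := ((Q.diff (Q.memN hx)).hasFDerivAt.comp x (Q.diff hx).hasFDerivAt)
  have h3 := h2.unique ((Q.diff hx).hasFDerivAt.congr_of_eventuallyEq h1)
  exact congrArg (fun L : E3 →L[ℝ] E3 => L v) h3

lemma limit_bound {y : E3} (hy : y ∈ Srf.S) (v : E3) (c : ℝ)
    (h : ∀ᶠ t in nhdsWithin (0:ℝ) (Set.Ioi 0), ‖(y + t • v) - Q.a (y + t • v)‖ ≤ t * c) :
    ‖v - fderiv ℝ Q.a y v‖ ≤ c := by
  have h1 : HasFDerivAt (fun x => x - Q.a x) (ContinuousLinearMap.id ℝ E3 - fderiv ℝ Q.a y) y :=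
    (hasFDerivAt_id y).sub (Q.diff (Q.S_sub hy)).hasFDerivAt
  have h2 : HasDerivAt (fun t : ℝ => (y + t • v) - Q.a (y + t • v)) (v - fderiv ℝ Q.a y v) 0 := by
    have h3 : HasDerivAt (fun t : ℝ => y + t • v) v 0 := by
      simpa using ((hasDerivAt_id (0:ℝ)).smul_const v).const_add y
    have h4 : HasFDerivAt (fun x => x - Q.a x) (ContinuousLinearMap.id ℝ E3 - fderiv ℝ Q.a y) ((fun t : ℝ => y + t • v) 0) := by
      simpa using h1
    exact h4.comp_hasDerivAt (0:ℝ) h3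
  have h5 := h2.tendsto_slope_zero_right.norm
  refine le_of_tendsto h5 ?_
  filter_upwards [h, self_mem_nhdsWithin] with t ht ht0
  have ht0 : 0 < t := ht0
  simp only [zero_add, zero_smul, add_zero, Q.fix hy, sub_self, sub_zero]
  rw [norm_smul, norm_inv, Real.norm_of_nonneg ht0.le, inv_mul_le_iff₀ ht0]
  exact ht

lemma contr {y : E3} (hy : y ∈ Srf.S) (v : E3) : ‖v - fderiv ℝ Q.a y v‖ ≤ ‖v‖ := by
  apply Q.limit_bound hy
  have hc : Filter.Tendsto (fun t : ℝ => y + t • v) (nhdsWithin 0 (Set.Ioi 0)) (nhds y) := by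
    have : Continuous (fun t : ℝ => y + t • v) := by fun_prop
    have := this.tendsto 0
    simp only [zero_smul, add_zero] at this
    exact this.mono_left nhdsWithin_le_nhds
  filter_upwards [hc.eventually (Q.nh (Q.S_sub hy)), self_mem_nhdsWithin] with t ht ht0
  have := Q.a_nearest _ ht y hy
  rw [dist_eq_norm, dist_eq_norm] at this
  refine this.trans ?_
  rw [add_sub_cancel_left, norm_smul, Real.norm_of_nonneg (le_of_lt ht0)]

/-- Local defining function data. -/
lemma level {y : E3} (hy : y ∈ Srf.S) : ∃ (U : Set E3) (F : E3 → ℝ) (t : ℝ), IsOpen U ∧ y ∈ U ∧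
    ContDiff ℝ (⊤ : ℕ∞) F ∧ Srf.S ∩ U = {y ∈ U | F y = 0} ∧ t ≠ 0 ∧
    ∀ v, fderiv ℝ F y v = t * ⟪Srf.n y, v⟫ := by
  obtain ⟨U, F, hU, hyU, hF, hS, hg, ht⟩ := Srf.localLevel y hy
  obtain ⟨t, ht⟩ := ht y ⟨hy, hyU⟩
  refine ⟨U, F, t, hU, hyU, hF, hS, ?_, ?_⟩
  · rintro rfl
    exact hg y hyU (by simpa using ht)
  · intro v
    have : ⟪gradient F y, v⟫ = fderiv ℝ F y v := by
      simp [gradient]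
    rw [← this, ht, inner_smul_left]; simp

lemma inner_zero {y : E3} (hy : y ∈ Srf.S) (v : E3) : ⟪Srf.n y, fderiv ℝ Q.a y v⟫ = 0 := by
  obtain ⟨U, F, t, hU, hyU, hF, hS, ht, hD⟩ := level hy
  have hac : ContinuousAt Q.a y := (Q.diff (Q.S_sub hy)).continuousAt
  have h1 : (fun z => F (Q.a z)) =ᶠ[nhds y] fun _ => 0 := by
    have : ∀ᶠ z in nhds y, Q.a z ∈ U := hac.eventually (hU.mem_nhds (by rwa [Q.fix hy]))
    filter_upwards [Q.nh (Q.S_sub hy), this] with z hz hz'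
    have : Q.a z ∈ Srf.S ∩ U := ⟨Q.a_mem z hz, hz'⟩
    rw [hS] at this
    exact this.2
  have hFd : HasFDerivAt F (fderiv ℝ F y) (Q.a y) := by
    rw [Q.fix hy]
    exact (hF.differentiable (by simp) y).hasFDerivAt
  have h2 := hFd.comp y (Q.diff (Q.S_sub hy)).hasFDerivAt
  have h3 := h2.unique ((hasFDerivAt_const (0:ℝ) y).congr_of_eventuallyEq h1)
  have h4 := congrArg (fun L : E3 →L[ℝ] ℝ => L v) h3
  simp only [ContinuousLinearMap.comp_apply, zero_apply, hD] at h4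
  exact (mul_eq_zero.1 h4).resolve_left ht

lemma tan {y : E3} (hy : y ∈ Srf.S) (v : E3) (hv : ⟪Srf.n y, v⟫ = 0) : fderiv ℝ Q.a y v = v := by
  obtain ⟨U, F, t, hU, hyU, hF, hS, ht, hD⟩ := level hy
  have hn := Srf.n_unit y hy
  set n := Srf.n y with hn_def
  have key : ∀ ε > 0, ‖v - fderiv ℝ Q.a y v‖ ≤ ε := by
    intro ε hε
    apply Q.limit_bound hy
    set g : E3 := (ε * t) • n with hg
    -- derivative of F along the two lines
    have hline : ∀ z : E3, HasDerivAt (fun s : ℝ => F (y + s • z)) (fderiv ℝ F y z) 0 := by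
      intro z
      have h3 : HasDerivAt (fun s : ℝ => y + s • z) z 0 := by
        simpa using ((hasDerivAt_id (0:ℝ)).smul_const z).const_add y
      have h4 : HasFDerivAt F (fderiv ℝ F y) ((fun s : ℝ => y + s • z) 0) := by
        simpa using (hF.differentiable (by simp) y).hasFDerivAt
      exact h4.comp_hasDerivAt (0:ℝ) h3
    have hFy : F y = 0 := by
      have : y ∈ Srf.S ∩ U := ⟨hy, hyU⟩
      rw [hS] at this; exact this.2
    have hsl : ∀ z : E3, Filter.Tendsto (fun s : ℝ => s⁻¹ * F (y + s • z)) (nhdsWithin 0 (Set.Ioi 0))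
        (nhds (fderiv ℝ F y z)) := by
      intro z
      have := (hline z).tendsto_slope_zero_right
      simpa [hFy] using this
    set m : E3 := (ε / 2 * (t / |t|)) • n with hm
    have htt : t * (t / |t|) = |t| := by
      rw [mul_div_assoc', div_eq_iff (abs_pos.2 ht).ne', abs_mul_abs_self]
    have hDm : fderiv ℝ F y m = ε / 2 * |t| := by
      rw [hD, hm, inner_smul_right, real_inner_self_eq_norm_sq, hn]; linear_combination (ε / 2) * htt
    have hmn : ‖m‖ = ε / 2 := by
      rw [hm, norm_smul, hn, mul_one, Real.norm_eq_abs, abs_mul, abs_div t, abs_abs,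
        div_self (abs_pos.2 ht).ne', mul_one, abs_of_pos (by positivity)]
    have hDv : fderiv ℝ F y v = 0 := by rw [hD, hv, mul_zero]
    have hp := (hsl (v + m)).eventually (lt_mem_nhds (a := 0) (by
      rw [map_add, hDv, hDm]; have := abs_pos.2 ht; positivity))
    have hq := (hsl (v - m)).eventually_lt_const (u := 0) (by
      rw [map_sub, hDv, hDm]; have := mul_pos (half_pos hε) (abs_pos.2 ht); linarith)
    obtain ⟨r, hr, hrU⟩ := Metric.isOpen_iff.1 hU y hyU
    have hsm : ∀ᶠ s in nhdsWithin (0:ℝ) (Set.Ioi 0), s * (‖v‖ + ε) < r := by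
      have : Filter.Tendsto (fun s : ℝ => s * (‖v‖ + ε)) (nhdsWithin 0 (Set.Ioi 0)) (nhds 0) := by
        have : Continuous (fun s : ℝ => s * (‖v‖ + ε)) := by fun_prop
        have := this.tendsto 0
        simp only [zero_mul] at this
        exact this.mono_left nhdsWithin_le_nhds
      exact this.eventually (gt_mem_nhds hr)
    have hc : Filter.Tendsto (fun t : ℝ => y + t • v) (nhdsWithin 0 (Set.Ioi 0)) (nhds y) := by
      have : Continuous (fun t : ℝ => y + t • v) := by fun_prop
      have := this.tendsto 0
      simp only [zero_smul, add_zero] at this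
      exact this.mono_left nhdsWithin_le_nhds
    filter_upwards [hp, hq, hsm, hc.eventually (Q.nh (Q.S_sub hy)), self_mem_nhdsWithin] with s h1 h2 h3 h4 hs
    have hs : 0 < s := hs
    have h1' : 0 < F (y + s • (v + m)) := by
      by_contra hcon
      have := mul_nonpos_of_nonneg_of_nonpos (inv_nonneg.2 hs.le) (not_lt.1 hcon)
      linarith
    have h2' : F (y + s • (v - m)) < 0 := by
      by_contra hcon
      have := mul_nonneg (inv_nonneg.2 hs.le) (not_lt.1 hcon)
      linarith
    have hcont : ContinuousOn (fun r : ℝ => F (y + s • (v + r • m))) (Set.Icc (-1) 1) := by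
      have := hF.continuous
      fun_prop
    have hivt := intermediate_value_Icc (by norm_num : (-1:ℝ) ≤ 1) hcont
    obtain ⟨q, hq1, hq2⟩ := hivt (show (0:ℝ) ∈ _ from ⟨by
      simp only [neg_smul, one_smul, ← sub_eq_add_neg]; exact h2'.le, by simp only [one_smul]; exact h1'.le⟩)
    have hqm : ‖q • m‖ ≤ ε := by
      rw [norm_smul, hmn, Real.norm_eq_abs]
      have := abs_le.2 hq1
      nlinarith
    have hzU : y + s • (v + q • m) ∈ U := by
      apply hrU
      rw [mem_ball, dist_eq_norm, add_sub_cancel_left, norm_smul, Real.norm_of_nonneg hs.le]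
      refine lt_of_le_of_lt ?_ h3
      gcongr
      exact (norm_add_le _ _).trans (by gcongr)
    have hzS : y + s • (v + q • m) ∈ Srf.S := by
      have : y + s • (v + q • m) ∈ Srf.S ∩ U := by rw [hS]; exact ⟨hzU, hq2⟩
      exact this.1
    have := Q.a_nearest _ h4 _ hzS
    rw [dist_eq_norm, dist_eq_norm] at this
    refine this.trans ?_
    have : y + s • v - (y + s • (v + q • m)) = - (s • (q • m)) := by
      rw [smul_add]; abel
    rw [this, norm_neg, norm_smul, Real.norm_of_nonneg hs.le]
    gcongr
  have h0 : ‖v - fderiv ℝ Q.a y v‖ ≤ 0 := le_of_forall_pos_le_add (by simpa using key)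
  rw [norm_le_zero_iff, sub_eq_zero] at h0
  exact h0.symm

lemma deriv_n {y : E3} (hy : y ∈ Srf.S) : fderiv ℝ Q.a y (Srf.n y) = 0 := by
  have h1 := Q.contr hy (Srf.n y)
  have h2 := Q.inner_zero hy (Srf.n y)
  have h3 : ‖Srf.n y - fderiv ℝ Q.a y (Srf.n y)‖ ^ 2 ≤ ‖Srf.n y‖ ^ 2 := by gcongr
  rw [norm_sub_sq_real, h2] at h3
  have : ‖fderiv ℝ Q.a y (Srf.n y)‖ ^ 2 = 0 := le_antisymm (by linarith) (by positivity)
  simpa using this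

lemma deriv_S {y : E3} (hy : y ∈ Srf.S) (v : E3) :
    fderiv ℝ Q.a y v = v - ⟪Srf.n y, v⟫ • Srf.n y := by
  have h1 : ⟪Srf.n y, v - ⟪Srf.n y, v⟫ • Srf.n y⟫ = 0 := by
    rw [inner_sub_right, inner_smul_right, real_inner_self_eq_norm_sq, Srf.n_unit y hy]; ring
  have h2 := Q.tan hy _ h1
  rw [map_sub, map_smul, Q.deriv_n hy, smul_zero, sub_zero] at h2
  exact h2

lemma normal {x : E3} (hx : x ∈ Q.N) :
    x - Q.a x = ⟪Srf.n (Q.a x), x - Q.a x⟫ • Srf.n (Q.a x) := by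
  set p := Q.a x with hp
  have hpS : p ∈ Srf.S := Q.a_mem x hx
  set z := x - p with hz
  set τ := z - ⟪Srf.n p, z⟫ • Srf.n p with hτ
  have hτn : ⟪Srf.n p, τ⟫ = 0 := by
    rw [hτ, inner_sub_right, inner_smul_right, real_inner_self_eq_norm_sq, Srf.n_unit p hpS]; ring
  have hτz : ⟪z, τ⟫ = ‖τ‖ ^ 2 := by
    rw [← real_inner_self_eq_norm_sq]
    have : ⟪z, τ⟫ = ⟪τ + ⟪Srf.n p, z⟫ • Srf.n p, τ⟫ := by rw [hτ]; congr 1; abel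
    rw [this, inner_add_left, inner_smul_left, hτn]; simp
  have h3 : HasDerivAt (fun s : ℝ => p + s • τ) τ 0 := by
    simpa using ((hasDerivAt_id (0:ℝ)).smul_const τ).const_add p
  have h4 : HasFDerivAt Q.a (fderiv ℝ Q.a p) ((fun s : ℝ => p + s • τ) 0) := by
    simpa using (Q.diff (Q.S_sub hpS)).hasFDerivAt
  have h5 : HasDerivAt (fun s : ℝ => Q.a (p + s • τ)) τ 0 := by
    have := h4.comp_hasDerivAt (0:ℝ) h3
    rwa [Q.tan hpS τ hτn] at this
  have h6 : HasDerivAt (fun s : ℝ => ‖x - Q.a (p + s • τ)‖ ^ 2) (2 * ⟪z, -τ⟫) 0 := by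
    have := (h5.const_sub x).norm_sq
    simpa [Q.fix hpS, hz] using this
  have hmin : IsLocalMin (fun s : ℝ => ‖x - Q.a (p + s • τ)‖ ^ 2) 0 := by
    have hc : Filter.Tendsto (fun t : ℝ => p + t • τ) (nhds 0) (nhds p) := by
      have : Continuous (fun t : ℝ => p + t • τ) := by fun_prop
      have := this.tendsto 0
      simpa using this
    filter_upwards [hc.eventually (Q.nh (Q.S_sub hpS))] with s hs
    have := Q.a_nearest x hx _ (Q.a_mem _ hs)
    rw [dist_eq_norm, dist_eq_norm] at this
    simp only [zero_smul, add_zero, Q.fix hpS]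
    gcongr
  have h7 := hmin.hasDerivAt_eq_zero h6
  rw [inner_neg_right, hτz] at h7
  have : ‖τ‖ = 0 := by
    have : ‖τ‖ ^ 2 = 0 := by linarith
    simpa using this
  rw [norm_eq_zero, hτ, sub_eq_zero] at this
  exact this

end PJ

/-- A projection with uniform bounds on a tube. -/
structure Tub (Srf : SmoothSurface) extends PJ Srf where
  δ : ℝ
  C : ℝ
  δ_pos : 0 < δ
  δ_le : δ ≤ 1
  C_one : 1 ≤ C
  mem : ∀ y ∈ Srf.S, ∀ x, ‖x - y‖ ≤ 3 * δ → x ∈ N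
  da_le : ∀ y ∈ Srf.S, ∀ x, ‖x - y‖ ≤ 3 * δ → ‖fderiv ℝ a x‖ ≤ C
  dda_le : ∀ y ∈ Srf.S, ∀ x, ‖x - y‖ ≤ 3 * δ → ‖fderiv ℝ (fderiv ℝ a) x‖ ≤ C
  n_lip : ∀ y ∈ Srf.S, ∀ y' ∈ Srf.S, ‖Srf.n y - Srf.n y'‖ ≤ C * ‖y - y'‖

lemma PJ.exists_tub {Srf : SmoothSurface} (Q : PJ Srf) : ∃ T : Tub Srf, T.toPJ = Q := by
  obtain ⟨U, hU, hSU, hn⟩ := Srf.n_smooth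
  obtain ⟨d, hd, hdK⟩ := Srf.compact.exists_cthickening_subset_open (Q.N_open.inter hU)
    (Set.subset_inter Q.S_sub hSU)
  set K := cthickening d Srf.S with hK
  have hKc : IsCompact K := Srf.compact.cthickening
  have ha1 : ContinuousOn (fderiv ℝ Q.a) K :=
    (Q.a_smooth.continuousOn_fderiv_of_isOpen Q.N_open (by simp)).mono (hdK.trans Set.inter_subset_left)
  have hda : ContDiffOn ℝ (⊤ : ℕ∞) (fderiv ℝ Q.a) Q.N :=
    Q.a_smooth.fderiv_of_isOpen Q.N_open (by simp)
  have ha2 : ContinuousOn (fderiv ℝ (fderiv ℝ Q.a)) K :=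
    (hda.continuousOn_fderiv_of_isOpen Q.N_open (by simp)).mono (hdK.trans Set.inter_subset_left)
  have hn1 : ContinuousOn (fderiv ℝ Srf.n) K :=
    (hn.continuousOn_fderiv_of_isOpen hU (by simp)).mono (hdK.trans Set.inter_subset_right)
  obtain ⟨C1, hC1⟩ := hKc.exists_bound_of_continuousOn ha1
  obtain ⟨C2, hC2⟩ := hKc.exists_bound_of_continuousOn (f := fderiv ℝ (fderiv ℝ Q.a)) ha2
  obtain ⟨C3, hC3⟩ := hKc.exists_bound_of_continuousOn hn1
  set δ := min (d / 3) 1 with hδ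
  have hδ0 : 0 < δ := lt_min (by positivity) one_pos
  have h3 : 3 * δ ≤ d := by have := min_le_left (d / 3) 1; linarith
  have hmem : ∀ y ∈ Srf.S, ∀ x, ‖x - y‖ ≤ 3 * δ → x ∈ K := by
    intro y hy x hx
    exact mem_cthickening_of_dist_le x y d _ hy (by rw [dist_eq_norm]; linarith)
  set C := max 1 (max C1 (max C2 (max C3 (2 / (3 * δ))))) with hC
  have c0 : 1 ≤ C := le_max_left _ _
  have c1 : C1 ≤ C := (le_max_left _ _).trans (le_max_right _ _)
  have c2 : C2 ≤ C := ((le_max_left _ _).trans (le_max_right _ _)).trans (le_max_right _ _)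
  have c3 : C3 ≤ C :=
    (((le_max_left _ _).trans (le_max_right _ _)).trans (le_max_right _ _)).trans (le_max_right _ _)
  have c4 : 2 / (3 * δ) ≤ C :=
    (((le_max_right _ _).trans (le_max_right _ _)).trans (le_max_right _ _)).trans (le_max_right _ _)
  refine ⟨⟨Q, δ, C, hδ0, min_le_right _ _, c0, fun y hy x hx => (hdK (hmem y hy x hx)).1,
    fun y hy x hx => (hC1 x (hmem y hy x hx)).trans c1,
    fun y hy x hx => (hC2 x (hmem y hy x hx)).trans c2, ?_⟩, rfl⟩
  intro y hy y' hy'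
  by_cases hc : ‖y - y'‖ ≤ 3 * δ
  · have := (convex_closedBall y' (3 * δ)).norm_image_sub_le_of_norm_fderiv_le (f := Srf.n) (C := C) (𝕜 := ℝ)
      (fun x hx => by
        have : x ∈ U := (hdK (hmem y' hy' x (by simpa [dist_eq_norm] using hx))).2
        exact ((hn.contDiffAt (hU.mem_nhds this)).differentiableAt (by simp)))
      (fun x hx => (hC3 x (hmem y' hy' x (by simpa [dist_eq_norm] using hx))).trans c3)
      (x := y') (y := y) (by simp [hδ0.le]) (by simpa [dist_eq_norm] using hc)
    exact this
  · push Not at hc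
    calc ‖Srf.n y - Srf.n y'‖ ≤ ‖Srf.n y‖ + ‖Srf.n y'‖ := norm_sub_le _ _
      _ = 2 / (3 * δ) * (3 * δ) := by rw [Srf.n_unit y hy, Srf.n_unit y' hy']; field_simp; norm_num
      _ ≤ C * ‖y - y'‖ := by gcongr

namespace Tub
variable {Srf : SmoothSurface} (Q : Tub Srf)

lemma C_pos : 0 < Q.C := lt_of_lt_of_le one_pos Q.C_one

lemma cdda {x : E3} (hx : x ∈ Q.N) : ContDiffAt ℝ (⊤ : ℕ∞) (fderiv ℝ Q.a) x :=
  (Q.a_smooth.fderiv_of_isOpen Q.N_open (by simp)).contDiffAt (Q.nh hx)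

lemma da_diff {x : E3} (hx : x ∈ Q.N) : DifferentiableAt ℝ (fderiv ℝ Q.a) x :=
  (Q.cdda hx).differentiableAt (by simp)

lemma da_lip {y : E3} (hy : y ∈ Srf.S) {x x' : E3} (hx : ‖x - y‖ ≤ 3 * Q.δ) (hx' : ‖x' - y‖ ≤ 3 * Q.δ) :
    ‖fderiv ℝ Q.a x - fderiv ℝ Q.a x'‖ ≤ Q.C * ‖x - x'‖ :=
  (convex_closedBall y (3 * Q.δ)).norm_image_sub_le_of_norm_fderiv_le (f := fderiv ℝ Q.a) (𝕜 := ℝ)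
    (fun z hz => Q.da_diff (Q.mem y hy z (by simpa [dist_eq_norm] using hz)))
    (fun z hz => Q.dda_le y hy z (by simpa [dist_eq_norm] using hz))
    (by simpa [dist_eq_norm] using hx') (by simpa [dist_eq_norm] using hx)

lemma a_lip {y : E3} (hy : y ∈ Srf.S) {x x' : E3} (hx : ‖x - y‖ ≤ 3 * Q.δ) (hx' : ‖x' - y‖ ≤ 3 * Q.δ) :
    ‖Q.a x - Q.a x'‖ ≤ Q.C * ‖x - x'‖ :=
  (convex_closedBall y (3 * Q.δ)).norm_image_sub_le_of_norm_fderiv_le (f := Q.a) (𝕜 := ℝ)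
    (fun z hz => Q.diff (Q.mem y hy z (by simpa [dist_eq_norm] using hz)))
    (fun z hz => Q.da_le y hy z (by simpa [dist_eq_norm] using hz))
    (by simpa [dist_eq_norm] using hx') (by simpa [dist_eq_norm] using hx)

/-- If the derivative is close to `L` on a convex subset of a tube ball, increments are close to `L`. -/
lemma a_incr {y : E3} (hy : y ∈ Srf.S) {s : Set E3} (hs : Convex ℝ s) (hsub : ∀ z ∈ s, ‖z - y‖ ≤ 3 * Q.δ)
    (L : E3 →L[ℝ] E3) (c : ℝ) (hL : ∀ z ∈ s, ‖fderiv ℝ Q.a z - L‖ ≤ c) {x x' : E3} (hx : x ∈ s) (hx' : x' ∈ s) :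
    ‖Q.a x - Q.a x' - L (x - x')‖ ≤ c * ‖x - x'‖ :=
  hs.norm_image_sub_le_of_norm_hasFDerivWithin_le' (f' := fun z => fderiv ℝ Q.a z)
    (fun z hz => (Q.diff (Q.mem y hy z (hsub z hz))).hasFDerivAt.hasFDerivWithinAt) hL hx' hx

/-- Quadratic flatness of the surface. -/
lemma quad {y y' : E3} (hy : y ∈ Srf.S) (hy' : y' ∈ Srf.S) (h : ‖y' - y‖ ≤ 3 * Q.δ) :
    |⟪Srf.n y, y' - y⟫| ≤ Q.C * ‖y' - y‖ ^ 2 := by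
  have hsub : ∀ z ∈ segment ℝ y y', ‖z - y‖ ≤ ‖y' - y‖ := by
    intro z hz
    have := norm_sub_le_of_mem_segment hz
    exact this
  have := Q.a_incr hy (convex_segment y y') (fun z hz => (hsub z hz).trans h) (fderiv ℝ Q.a y) (Q.C * ‖y' - y‖)
    (fun z hz => (Q.da_lip hy ((hsub z hz).trans h) (by simp [Q.δ_pos.le])).trans (by
      have := Q.C_pos
      gcongr; exact hsub z hz)) (right_mem_segment ℝ y y') (left_mem_segment ℝ y y')
  rw [Q.fix hy, Q.fix hy', Q.deriv_S hy, sub_sub_cancel, norm_smul, Srf.n_unit y hy, mul_one] at this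
  rw [← Real.norm_eq_abs]
  exact this.trans (le_of_eq (by ring))

/-- The tangential gradient is the gradient of the normal extension. -/
lemma grad_eq {φ : E3 → ℝ} {y : E3} (hy : y ∈ Srf.S) (h : DifferentiableAt ℝ (fun z => φ (Q.a z)) y) :
    Srf.grad φ y = gradient (fun z => φ (Q.a z)) y := by
  set w := fun z => φ (Q.a z) with hw
  have hyN := Q.S_sub hy
  have hwa : (fun z => w (Q.a z)) =ᶠ[nhds y] w := by
    filter_upwards [Q.nh hyN] with z hz
    simp only [hw, Q.idem hz]
  have hchain : ∀ v, fderiv ℝ w y v = fderiv ℝ w y (fderiv ℝ Q.a y v) := by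
    intro v
    have h0 : DifferentiableAt ℝ w (Q.a y) := by rwa [Q.fix hy]
    have h1 := h0.hasFDerivAt.comp y (Q.diff hyN).hasFDerivAt
    have h2 := h1.unique (h.hasFDerivAt.congr_of_eventuallyEq hwa)
    rw [Q.fix hy] at h2
    exact (congrArg (fun L : E3 →L[ℝ] ℝ => L v) h2).symm
  have hwithin : HasFDerivWithinAt φ (fderiv ℝ w y) Srf.S y :=
    h.hasFDerivAt.hasFDerivWithinAt.congr (fun z hz => by simp only [hw, Q.fix hz])
      (by simp only [hw, Q.fix hy])
  have hwithin2 := hwithin.differentiableWithinAt.hasFDerivWithinAt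
  -- the two derivatives agree on tangent vectors
  have hagree : ∀ v, fderivWithin ℝ φ Srf.S y (fderiv ℝ Q.a y v) = fderiv ℝ w y v := by
    intro v
    have h1 : HasFDerivAt (fun z => φ (Q.a z)) ((fderivWithin ℝ φ Srf.S y).comp (fderiv ℝ Q.a y)) y := by
      have hh : HasFDerivWithinAt φ (fderivWithin ℝ φ Srf.S y) Srf.S (Q.a y) := by rwa [Q.fix hy]
      have := hh.comp y ((Q.diff hyN).hasFDerivAt.hasFDerivWithinAt (s := Q.N)) (fun z hz => Q.a_mem z hz)
      exact this.hasFDerivAt (Q.nh hyN)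
    exact congrArg (fun L : E3 →L[ℝ] ℝ => L v) (h1.unique h.hasFDerivAt)
  unfold SmoothSurface.grad tGrad
  rw [Submodule.coe_orthogonalProjectionOnto_apply]
  refine Submodule.eq_starProjection_of_mem_of_inner_eq_zero ?_ ?_
  · rw [SmoothSurface.tangent, Submodule.mem_orthogonal_singleton_iff_inner_left]
    rw [gradient, InnerProductSpace.toDual_symm_apply, hchain, Q.deriv_n hy, map_zero]
  · intro v hv
    rw [SmoothSurface.tangent, Submodule.mem_orthogonal_singleton_iff_inner_right] at hv
    have h3 := hagree v
    rw [Q.tan hy v hv] at h3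
    rw [inner_sub_left, gradient, InnerProductSpace.toDual_symm_apply, InnerProductSpace.toDual_symm_apply, h3, sub_self]

end Tub

/-- Surface measure. -/
abbrev SmoothSurface.μ (Srf : SmoothSurface) : Measure E3 := (μH[2] : Measure E3).restrict Srf.S

lemma SmoothSurface.measS (Srf : SmoothSurface) : MeasurableSet Srf.S := Srf.compact.measurableSet

lemma SmoothSurface.int_cont (Srf : SmoothSurface) (hfin : μH[2] Srf.S < ⊤) {f : E3 → ℝ}
    (hf : ContinuousOn f Srf.S) : Integrable f Srf.μ := by
  obtain ⟨M, hM⟩ := Srf.compact.exists_bound_of_continuousOn hf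
  have : IsFiniteMeasure Srf.μ := ⟨by simpa using hfin⟩
  refine Integrable.of_bound (hf.aestronglyMeasurable Srf.measS) M ?_
  filter_upwards [ae_restrict_mem Srf.measS] with x hx using hM x hx

lemma SmoothSurface.ae_S (Srf : SmoothSurface) : ∀ᵐ y ∂Srf.μ, y ∈ Srf.S := ae_restrict_mem Srf.measS

namespace Tub
variable {Srf : SmoothSurface} (Q : Tub Srf)

/-- Smooth functions on `N` constant along normals. -/
structure NC (w : E3 → ℝ) : Prop where
  smooth : ContDiffOn ℝ (⊤ : ℕ∞) w Q.N
  inv : ∀ x ∈ Q.N, w (Q.a x) = w x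

/-- Tangential partial derivative, extended constantly along normals. -/
def D (e : E3) (w : E3 → ℝ) : E3 → ℝ := fun z => fderiv ℝ w (Q.a z) e

lemma nc_hat {g : E3 → ℝ} (hg : SmoothNear g Srf.S) : Q.NC (fun z => g (Q.a z)) := by
  obtain ⟨V, hV, hSV, hg⟩ := hg
  exact ⟨hg.comp Q.a_smooth (fun x hx => hSV (Q.a_mem x hx)), fun x hx => by rw [Q.idem hx]⟩

variable {Q}

lemma NC.cda {w : E3 → ℝ} (h : Q.NC w) {x : E3} (hx : x ∈ Q.N) : ContDiffAt ℝ (⊤ : ℕ∞) w x :=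
  h.smooth.contDiffAt (Q.nh hx)

lemma NC.diff {w : E3 → ℝ} (h : Q.NC w) {x : E3} (hx : x ∈ Q.N) : DifferentiableAt ℝ w x :=
  (h.cda hx).differentiableAt (by simp)

lemma NC.dsmooth {w : E3 → ℝ} (h : Q.NC w) : ContDiffOn ℝ (⊤ : ℕ∞) (fderiv ℝ w) Q.N :=
  h.smooth.fderiv_of_isOpen Q.N_open (by simp)

lemma NC.ddiff {w : E3 → ℝ} (h : Q.NC w) {x : E3} (hx : x ∈ Q.N) : DifferentiableAt ℝ (fderiv ℝ w) x :=
  (h.dsmooth.contDiffAt (Q.nh hx)).differentiableAt (by simp)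

lemma NC.near {w : E3 → ℝ} (h : Q.NC w) : SmoothNear w Srf.S := ⟨Q.N, Q.N_open, Q.S_sub, h.smooth⟩

lemma NC.contS {w : E3 → ℝ} (h : Q.NC w) : ContinuousOn w Srf.S := h.smooth.continuousOn.mono Q.S_sub

lemma NC.D {w : E3 → ℝ} (h : Q.NC w) (e : E3) : Q.NC (Q.D e w) := by
  refine Q.nc_hat (g := fun z => fderiv ℝ w z e) ⟨Q.N, Q.N_open, Q.S_sub, ?_⟩
  exact h.dsmooth.clm_apply contDiffOn_const

lemma NC.mul {p q : E3 → ℝ} (hp : Q.NC p) (hq : Q.NC q) : Q.NC (fun x => p x * q x) :=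
  ⟨hp.smooth.mul hq.smooth, fun x hx => by simp only [hp.inv x hx, hq.inv x hx]⟩

lemma NC.add {p q : E3 → ℝ} (hp : Q.NC p) (hq : Q.NC q) : Q.NC (fun x => p x + q x) :=
  ⟨hp.smooth.add hq.smooth, fun x hx => by simp only [hp.inv x hx, hq.inv x hx]⟩

lemma NC.sum {ι : Type*} (s : Finset ι) {p : ι → E3 → ℝ} (hp : ∀ i ∈ s, Q.NC (p i)) :
    Q.NC (fun x => ∑ i ∈ s, p i x) :=
  ⟨ContDiffOn.sum fun i hi => (hp i hi).smooth,
    fun x hx => Finset.sum_congr rfl fun i hi => (hp i hi).inv x hx⟩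

lemma NC.smul {p : E3 → ℝ} (hp : Q.NC p) (c : ℝ) : Q.NC (fun x => c * p x) :=
  ⟨contDiffOn_const.mul hp.smooth, fun x hx => by simp only [hp.inv x hx]⟩

lemma D_S (w : E3 → ℝ) (e : E3) {y : E3} (hy : y ∈ Srf.S) : Q.D e w y = fderiv ℝ w y e := by
  simp only [Tub.D, Q.fix hy]

lemma NC.D_mul {p q : E3 → ℝ} (hp : Q.NC p) (hq : Q.NC q) (e : E3) {y : E3} (hy : y ∈ Srf.S) :
    Q.D e (fun x => p x * q x) y = p y * Q.D e q y + q y * Q.D e p y := by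
  have hyN := Q.S_sub hy
  simp only [D_S _ _ hy]
  rw [fderiv_fun_mul (hp.diff hyN) (hq.diff hyN)]
  simp

/-- First order chain rule. -/
lemma NC.chain {w : E3 → ℝ} (h : Q.NC w) {x : E3} (hx : x ∈ Q.N) :
    fderiv ℝ w x = (fderiv ℝ w (Q.a x)).comp (fderiv ℝ Q.a x) := by
  have h1 : (fun z => w (Q.a z)) =ᶠ[nhds x] w := by
    filter_upwards [Q.nh hx] with z hz using h.inv z hz
  have h2 := (h.diff (Q.memN hx)).hasFDerivAt.comp x (Q.diff hx).hasFDerivAt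
  exact ((h.diff hx).hasFDerivAt.congr_of_eventuallyEq h1).unique h2

/-- Second order chain rule. -/
lemma NC.chain2 {w : E3 → ℝ} (h : Q.NC w) {x : E3} (hx : x ∈ Q.N) (v v' : E3) :
    fderiv ℝ (fderiv ℝ w) x v v' =
      fderiv ℝ (fderiv ℝ w) (Q.a x) (fderiv ℝ Q.a x v) (fderiv ℝ Q.a x v')
        + fderiv ℝ w (Q.a x) (fderiv ℝ (fderiv ℝ Q.a) x v v') := by
  have h1 : (fun z => (fderiv ℝ w (Q.a z)).comp (fderiv ℝ Q.a z)) =ᶠ[nhds x] fderiv ℝ w := by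
    filter_upwards [Q.nh hx] with z hz using (h.chain hz).symm
  have h2 := (h.ddiff (Q.memN hx)).hasFDerivAt.comp x (Q.diff hx).hasFDerivAt
  have h3 := h2.clm_comp (Q.da_diff hx).hasFDerivAt
  have h4 := ((h.ddiff hx).hasFDerivAt.congr_of_eventuallyEq h1).unique h3
  rw [h4]
  simp only [Function.comp_apply, add_apply, ContinuousLinearMap.comp_apply,
    ContinuousLinearMap.compL_apply, ContinuousLinearMap.flip_apply]
  ring

lemma NC.symm {w : E3 → ℝ} (h : Q.NC w) {x : E3} (hx : x ∈ Q.N) (v v' : E3) :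
    fderiv ℝ (fderiv ℝ w) x v v' = fderiv ℝ (fderiv ℝ w) x v' v :=
  ((h.cda hx).isSymmSndFDerivAt (by simp only [minSmoothness_of_isRCLikeNormedField]; exact WithTop.coe_le_coe.2 (le_top : (2:ℕ∞) ≤ ⊤))) v v'

lemma NC.normal2 {w : E3 → ℝ} (h : Q.NC w) {y : E3} (hy : y ∈ Srf.S) (v : E3) :
    fderiv ℝ (fderiv ℝ w) y (Srf.n y) v = fderiv ℝ w y (fderiv ℝ (fderiv ℝ Q.a) y (Srf.n y) v) := by
  rw [h.chain2 (Q.S_sub hy), Q.deriv_n hy, Q.fix hy]; simp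

lemma NC.DD {w : E3 → ℝ} (h : Q.NC w) {y : E3} (hy : y ∈ Srf.S) (e e' : E3) :
    Q.D e (Q.D e' w) y = fderiv ℝ (fderiv ℝ w) y e e' -
      ⟪Srf.n y, e⟫ * fderiv ℝ w y (fderiv ℝ (fderiv ℝ Q.a) y (Srf.n y) e') := by
  have hyN := Q.S_sub hy
  rw [D_S _ _ hy]
  have h0 : HasFDerivAt (fderiv ℝ w) (fderiv ℝ (fderiv ℝ w) y) (Q.a y) := by
    rw [Q.fix hy]; exact (h.ddiff hyN).hasFDerivAt
  have h2 := (h0.comp y (Q.diff hyN).hasFDerivAt).clm_apply (hasFDerivAt_const e' y)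
  have h3 : fderiv ℝ (Q.D e' w) y e = fderiv ℝ (fderiv ℝ w) y (fderiv ℝ Q.a y e) e' := by
    have : HasFDerivAt (Q.D e' w) _ y := h2
    rw [this.fderiv]; simp
  rw [h3, Q.deriv_S hy, map_sub, map_smul]
  simp only [sub_apply, smul_apply, smul_eq_mul]
  rw [h.normal2 hy]

/-- Commutator vector. -/
def Γ (Q : Tub Srf) (e e' y : E3) : E3 :=
  ⟪Srf.n y, e'⟫ • fderiv ℝ (fderiv ℝ Q.a) y (Srf.n y) e - ⟪Srf.n y, e⟫ • fderiv ℝ (fderiv ℝ Q.a) y (Srf.n y) e'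

lemma NC.comm {w : E3 → ℝ} (h : Q.NC w) {y : E3} (hy : y ∈ Srf.S) (e e' : E3) :
    Q.D e (Q.D e' w) y = Q.D e' (Q.D e w) y + fderiv ℝ w y (Q.Γ e e' y) := by
  rw [h.DD hy, h.DD hy, h.symm (Q.S_sub hy) e e', Γ, map_sub, map_smul, map_smul]
  simp only [smul_eq_mul]; ring

lemma dda_n_le {y : E3} (hy : y ∈ Srf.S) (e : E3) (he : ‖e‖ ≤ 1) :
    ‖fderiv ℝ (fderiv ℝ Q.a) y (Srf.n y) e‖ ≤ Q.C := by
  have h1 := Q.dda_le y hy y (by simp [Q.δ_pos.le])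
  have := (fderiv ℝ (fderiv ℝ Q.a) y).le_opNorm₂ (Srf.n y) e
  rw [Srf.n_unit y hy, mul_one] at this
  refine this.trans ?_
  have := norm_nonneg (fderiv ℝ (fderiv ℝ Q.a) y)
  nlinarith [norm_nonneg e]

lemma n_inner_le {y : E3} (hy : y ∈ Srf.S) (e : E3) : |⟪Srf.n y, e⟫| ≤ ‖e‖ := by
  have := abs_real_inner_le_norm (Srf.n y) e
  rwa [Srf.n_unit y hy, one_mul] at this

lemma Γ_le {y : E3} (hy : y ∈ Srf.S) (e e' : E3) (he : ‖e‖ ≤ 1) (he' : ‖e'‖ ≤ 1) :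
    ‖Q.Γ e e' y‖ ≤ 2 * Q.C := by
  unfold Γ
  refine (norm_sub_le _ _).trans ?_
  rw [norm_smul, norm_smul, Real.norm_eq_abs, Real.norm_eq_abs]
  have h1 := dda_n_le (Q := Q) hy e he
  have h2 := dda_n_le (Q := Q) hy e' he'
  have h3 := (n_inner_le hy e).trans he
  have h4 := (n_inner_le hy e').trans he'
  have h5 := abs_nonneg (⟪Srf.n y, e⟫)
  have h6 := abs_nonneg (⟪Srf.n y, e'⟫)
  have := Q.C_pos
  have h7 : |⟪Srf.n y, e'⟫| * ‖fderiv ℝ (fderiv ℝ Q.a) y (Srf.n y) e‖ ≤ 1 * Q.C := by gcongr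
  have h8 : |⟪Srf.n y, e⟫| * ‖fderiv ℝ (fderiv ℝ Q.a) y (Srf.n y) e'‖ ≤ 1 * Q.C := by gcongr
  linarith

end Tub

namespace Tub
variable {Srf : SmoothSurface} (Q : Tub Srf)

lemma flow_near {y y' e : E3} (hy : y ∈ Srf.S) (hy' : y' ∈ Srf.S) (he : ‖e‖ ≤ 1) {s : ℝ} (hs : 0 ≤ s)
    (hsδ : s ≤ Q.δ) :
    ‖Q.a (y + s • e) - Q.a (y' + s • e) - (y - y')‖ ≤ (2 * Q.C / Q.δ) * s * ‖y - y'‖ := by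
  have hC := Q.C_pos
  have hδ := Q.δ_pos
  have hse : ‖s • e‖ ≤ s := by
    rw [norm_smul, Real.norm_of_nonneg hs]; nlinarith
  by_cases hc : ‖y - y'‖ ≤ Q.δ
  · have hsub : ∀ z ∈ closedBall y' Q.δ, ‖z - y'‖ ≤ 3 * Q.δ ∧ ‖z + s • e - y'‖ ≤ 3 * Q.δ := by
      intro z hz
      rw [mem_closedBall, dist_eq_norm] at hz
      refine ⟨by linarith, ?_⟩
      have : z + s • e - y' = (z - y') + s • e := by abel
      rw [this]
      exact (norm_add_le _ _).trans (by linarith)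
    have h := (convex_closedBall y' Q.δ).norm_image_sub_le_of_norm_hasFDerivWithin_le
      (f := fun z => Q.a (z + s • e) - Q.a z) (C := Q.C * s)
      (f' := fun z => fderiv ℝ Q.a (z + s • e) - fderiv ℝ Q.a z) (x := y') (y := y)
      (fun z hz => by
        have h1 := (Q.diff (Q.mem y' hy' _ (hsub z hz).2)).hasFDerivAt.comp z
          ((hasFDerivAt_id z).add_const (s • e))
        have h2 := (Q.diff (Q.mem y' hy' _ (hsub z hz).1)).hasFDerivAt
        exact (h1.sub h2).hasFDerivWithinAt)
      (fun z hz => (Q.da_lip hy' (hsub z hz).2 (hsub z hz).1).trans (by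
        rw [add_sub_cancel_left]; gcongr))
      (by simp [hδ.le]) (by simpa [dist_eq_norm] using hc)
    simp only [Q.fix hy, Q.fix hy'] at h
    have e1 : Q.a (y + s • e) - y - (Q.a (y' + s • e) - y') = Q.a (y + s • e) - Q.a (y' + s • e) - (y - y') := by abel
    rw [e1] at h
    refine h.trans ?_
    gcongr
    rw [le_div_iff₀ hδ]
    nlinarith [Q.δ_le]
  · push Not at hc
    have h1 : ∀ z ∈ Srf.S, ‖Q.a (z + s • e) - z‖ ≤ Q.C * s := by
      intro z hz
      have := Q.a_lip hz (x := z + s • e) (x' := z) (by rw [add_sub_cancel_left]; linarith) (by simp [hδ.le])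
      rw [Q.fix hz, add_sub_cancel_left] at this
      exact this.trans (by gcongr)
    have e1 : Q.a (y + s • e) - Q.a (y' + s • e) - (y - y') = (Q.a (y + s • e) - y) - (Q.a (y' + s • e) - y') := by abel
    rw [e1]
    calc _ ≤ Q.C * s + Q.C * s := (norm_sub_le _ _).trans (add_le_add (h1 y hy) (h1 y' hy'))
      _ = 2 * Q.C / Q.δ * s * Q.δ := by field_simp; ring
      _ ≤ _ := by gcongr

lemma cont_shift {e : E3} (he : ‖e‖ ≤ 1) {s : ℝ} (hs : |s| ≤ Q.δ) {g : E3 → ℝ} (hg : ContinuousOn g Q.N) :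
    ContinuousOn (fun y => g (y + s • e)) Srf.S := by
  refine hg.comp (by fun_prop) (fun y hy => Q.mem y hy _ ?_)
  rw [add_sub_cancel_left, norm_smul, Real.norm_eq_abs]
  have := Q.δ_pos
  nlinarith [abs_nonneg s]

lemma flow_meas {e : E3} (he : ‖e‖ ≤ 1) {s : ℝ} (hs : 0 ≤ s) (hsδ : s ≤ Q.δ)
    (hs2 : (2 * Q.C / Q.δ) * s ≤ 1 / 2) :
    (Srf.μ).map (fun y => Q.a (y + s • e)) ≤
      ENNReal.ofReal ((1 + 2 * ((2 * Q.C / Q.δ) * s)) ^ 2) • Srf.μ := by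
  set c := (2 * Q.C / Q.δ) * s with hc
  have hC := Q.C_pos
  have hδ := Q.δ_pos
  have hc0 : 0 ≤ c := by positivity
  set Φ : E3 → E3 := fun y => Q.a (y + s • e) with hΦ
  have hmemN : ∀ y ∈ Srf.S, y + s • e ∈ Q.N := by
    intro y hy
    refine Q.mem y hy _ ?_
    rw [add_sub_cancel_left, norm_smul, Real.norm_of_nonneg hs]; nlinarith
  have hcont : ContinuousOn Φ Srf.S :=
    Q.a_smooth.continuousOn.comp (by fun_prop) hmemN
  have hΦm : AEMeasurable Φ Srf.μ := hcont.aemeasurable Srf.measS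
  refine Measure.le_iff.2 fun B hB => ?_
  rw [Measure.map_apply_of_aemeasurable hΦm hB, Measure.smul_apply, Measure.restrict_apply hB,
    Measure.restrict_apply' Srf.measS]
  set A := Φ ⁻¹' B ∩ Srf.S with hA
  have hanti : ∀ x ∈ A, ∀ x' ∈ A, edist (id x) (id x') ≤ (Real.toNNReal (1 + 2 * c) : ℝ≥0) * edist (Φ x) (Φ x') := by
    intro x hx x' hx'
    have h := Q.flow_near hx.2 hx'.2 he hs hsδ
    rw [edist_dist, edist_dist, dist_eq_norm, dist_eq_norm]
    have h2 : ‖x - x'‖ ≤ ‖Φ x - Φ x'‖ + c * ‖x - x'‖ := by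
      calc ‖x - x'‖ = ‖(Φ x - Φ x') - (Φ x - Φ x' - (x - x'))‖ := by congr 1; abel
        _ ≤ _ := (norm_sub_le _ _).trans (by gcongr)
    rw [ENNReal.ofNNReal_toNNReal, ← ENNReal.ofReal_mul (by positivity)]
    apply ENNReal.ofReal_le_ofReal
    simp only [id]
    have hn := norm_nonneg (x - x')
    have hn' := norm_nonneg (Φ x - Φ x')
    have h3 : (1 - c) * ‖x - x'‖ ≤ ‖Φ x - Φ x'‖ := by linarith
    have h4 : 1 ≤ (1 + 2 * c) * (1 - c) := by nlinarith
    calc ‖x - x'‖ ≤ ((1 + 2 * c) * (1 - c)) * ‖x - x'‖ := by nlinarith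
      _ = (1 + 2 * c) * ((1 - c) * ‖x - x'‖) := by ring
      _ ≤ _ := by gcongr
  have := haus_image_le id Φ A _ hanti
  rw [Set.image_id] at this
  refine this.trans ?_
  rw [smul_eq_mul, ENNReal.ofReal_pow (by positivity), ENNReal.ofNNReal_toNNReal]
  gcongr
  rintro _ ⟨x, hx, rfl⟩
  exact ⟨hx.1, Q.a_mem _ (hmemN x hx.2)⟩

lemma flow_int (hfin : μH[2] Srf.S < ⊤) {e : E3} (he : ‖e‖ ≤ 1) {s : ℝ} (hs : 0 ≤ s) (hsδ : s ≤ Q.δ)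
    (hs2 : (2 * Q.C / Q.δ) * s ≤ 1 / 2) {g : E3 → ℝ} (hg : Q.NC g) (hg0 : ∀ y ∈ Srf.S, 0 ≤ g y) :
    ∫ y, g (y + s • e) ∂Srf.μ ≤ (1 + s * (12 * Q.C / Q.δ)) * ∫ y, g y ∂Srf.μ := by
  set c := (2 * Q.C / Q.δ) * s with hc
  have hC := Q.C_pos
  have hδ := Q.δ_pos
  have hc0 : 0 ≤ c := by positivity
  have hmemN : ∀ y ∈ Srf.S, y + s • e ∈ Q.N := by
    intro y hy
    refine Q.mem y hy _ ?_
    rw [add_sub_cancel_left, norm_smul, Real.norm_of_nonneg hs]; nlinarith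
  have hcont : ContinuousOn (fun y => Q.a (y + s • e)) Srf.S :=
    Q.a_smooth.continuousOn.comp (by fun_prop) hmemN
  have hΦm : AEMeasurable (fun y => Q.a (y + s • e)) Srf.μ := hcont.aemeasurable Srf.measS
  have hgi := Srf.int_cont hfin hg.contS
  have hle := Q.flow_meas he hs hsδ hs2
  have hgi2 : Integrable g (ENNReal.ofReal ((1 + 2 * c) ^ 2) • Srf.μ) :=
    hgi.smul_measure ENNReal.ofReal_ne_top
  have h1 : ∫ y, g (y + s • e) ∂Srf.μ = ∫ z, g z ∂((Srf.μ).map (fun y => Q.a (y + s • e))) := by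
    rw [integral_map hΦm (hgi2.mono_measure hle).aestronglyMeasurable]
    refine integral_congr_ae ?_
    filter_upwards [Srf.ae_S] with y hy
    rw [hg.inv _ (hmemN y hy)]
  rw [h1]
  have hnn : 0 ≤ᵐ[Srf.μ] g := by filter_upwards [Srf.ae_S] with y hy using hg0 y hy
  calc _ ≤ ∫ z, g z ∂(ENNReal.ofReal ((1 + 2 * c) ^ 2) • Srf.μ) :=
        integral_mono_measure hle (Measure.ae_smul_measure hnn _) hgi2
    _ = (1 + 2 * c) ^ 2 * ∫ y, g y ∂Srf.μ := by
        rw [integral_smul_measure, ENNReal.toReal_ofReal (by positivity), smul_eq_mul]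
    _ ≤ _ := by
        have : 0 ≤ ∫ y, g y ∂Srf.μ := integral_nonneg_of_ae hnn
        gcongr
        have : s * (12 * Q.C / Q.δ) = 6 * c := by rw [hc]; ring
        rw [this]; nlinarith

lemma flow_ineq (hfin : μH[2] Srf.S < ⊤) {e : E3} (he : ‖e‖ ≤ 1) {g : E3 → ℝ} (hg : Q.NC g)
    (hg0 : ∀ y ∈ Srf.S, 0 ≤ g y) :
    ∫ y, Q.D e g y ∂Srf.μ ≤ (12 * Q.C / Q.δ) * ∫ y, g y ∂Srf.μ := by
  have hC := Q.C_pos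
  have hδ := Q.δ_pos
  have : IsFiniteMeasure Srf.μ := ⟨by simpa using hfin⟩
  set K := cthickening Q.δ Srf.S with hK
  have hKN : K ⊆ Q.N := by
    rw [hK, Srf.compact.cthickening_eq_biUnion_closedBall hδ.le]
    intro x hx
    simp only [Set.mem_iUnion, mem_closedBall, dist_eq_norm] at hx
    obtain ⟨y, hy, hxy⟩ := hx
    exact Q.mem y hy x (by linarith)
  obtain ⟨M, hM⟩ := (Srf.compact.cthickening (r := Q.δ)).exists_bound_of_continuousOn
    (hg.dsmooth.continuousOn.mono hKN)
  have hmem : ∀ y ∈ Srf.S, ∀ s : ℝ, |s| ≤ Q.δ → y + s • e ∈ K := by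
    intro y hy s hs
    refine mem_cthickening_of_dist_le _ y _ _ hy ?_
    rw [dist_eq_norm, add_sub_cancel_left, norm_smul, Real.norm_eq_abs]
    nlinarith [abs_nonneg s]
  have hder := hasDerivAt_integral_of_dominated_loc_of_deriv_le (μ := Srf.μ) (x₀ := (0:ℝ))
    (s := ball 0 Q.δ) (F := fun s y => g (y + s • e)) (F' := fun s y => fderiv ℝ g (y + s • e) e)
    (bound := fun _ => M)
    (ball_mem_nhds _ hδ)
    (by
      filter_upwards [ball_mem_nhds (0:ℝ) hδ] with s hs
      have hs : |s| < Q.δ := by simpa using hs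
      exact (Q.cont_shift he hs.le hg.smooth.continuousOn).aestronglyMeasurable Srf.measS)
    (by simpa using Srf.int_cont hfin hg.contS)
    (by
      have : ContinuousOn (fun y => fderiv ℝ g y e) Srf.S :=
        (hg.dsmooth.continuousOn.mono Q.S_sub).clm_apply continuousOn_const
      simpa using this.aestronglyMeasurable Srf.measS)
    (by
      filter_upwards [Srf.ae_S] with y hy s hs
      have hs : |s| < Q.δ := by simpa using hs
      have h1 := hM _ (hmem y hy s hs.le)
      refine ((fderiv ℝ g (y + s • e)).le_opNorm e).trans ?_
      have := norm_nonneg (fderiv ℝ g (y + s • e))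
      nlinarith [norm_nonneg e])
    (integrable_const _)
    (by
      filter_upwards [Srf.ae_S] with y hy s hs
      have hs : |s| < Q.δ := by simpa using hs
      have h3 : HasDerivAt (fun s : ℝ => y + s • e) e s := by
        simpa using ((hasDerivAt_id s).smul_const e).const_add y
      exact (hg.diff (hKN (hmem y hy s hs.le))).hasFDerivAt.comp_hasDerivAt s h3)
  have hsl := hder.2.tendsto_slope_zero_right
  have e1 : ∫ y, Q.D e g y ∂Srf.μ = ∫ y, fderiv ℝ g (y + (0:ℝ) • e) e ∂Srf.μ := by
    refine integral_congr_ae ?_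
    filter_upwards [Srf.ae_S] with y hy
    rw [D_S _ _ hy, zero_smul, add_zero]
  rw [e1]
  refine le_of_tendsto hsl ?_
  have hpos : 0 < min Q.δ (1 / 2 / (2 * Q.C / Q.δ)) := by positivity
  filter_upwards [Ioo_mem_nhdsGT hpos] with s hs
  have hs1 : s ≤ Q.δ := hs.2.le.trans (min_le_left _ _)
  have hs2 : (2 * Q.C / Q.δ) * s ≤ 1 / 2 := by
    have := hs.2.le.trans (min_le_right _ _)
    rw [le_div_iff₀ (by positivity)] at this
    linarith
  have h := Q.flow_int hfin he hs.1.le hs1 hs2 hg hg0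
  simp only [zero_add, zero_smul, add_zero, smul_eq_mul]
  rw [inv_mul_le_iff₀ hs.1]
  linarith

lemma flow_abs (hfin : μH[2] Srf.S < ⊤) {e : E3} (he : ‖e‖ ≤ 1) {g : E3 → ℝ} (hg : Q.NC g)
    (hg0 : ∀ y ∈ Srf.S, 0 ≤ g y) :
    |∫ y, Q.D e g y ∂Srf.μ| ≤ (12 * Q.C / Q.δ) * ∫ y, g y ∂Srf.μ := by
  refine abs_le.2 ⟨?_, Q.flow_ineq hfin he hg hg0⟩
  have h := Q.flow_ineq hfin (e := -e) (by simpa using he) hg hg0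
  have : ∀ y, Q.D (-e) g y = - Q.D e g y := fun y => by simp [Tub.D]
  simp only [this, integral_neg] at h
  linarith

/-- Integration by parts inequality for products. -/
lemma flow_prod (hfin : μH[2] Srf.S < ⊤) {e : E3} (he : ‖e‖ ≤ 1) {p q : E3 → ℝ} (hp : Q.NC p) (hq : Q.NC q)
    {l : ℝ} (hl : 0 < l) :
    |∫ y, Q.D e (fun x => p x * q x) y ∂Srf.μ| ≤
      (12 * Q.C / Q.δ) * (l⁻¹ ^ 2 * ∫ y, p y ^ 2 ∂Srf.μ + l ^ 2 * ∫ y, q y ^ 2 ∂Srf.μ) := by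
  have hC := Q.C_pos
  have hδ := Q.δ_pos
  set P : E3 → ℝ := fun x => l⁻¹ * p x + l * q x with hP
  set M : E3 → ℝ := fun x => l⁻¹ * p x + (-l) * q x with hM
  have hPn : Q.NC P := (hp.smul _).add (hq.smul _)
  have hMn : Q.NC M := (hp.smul _).add (hq.smul _)
  have hPP := hPn.mul hPn
  have hMM := hMn.mul hMn
  have e1 : ∀ y ∈ Srf.S, Q.D e (fun x => p x * q x) y =
      (1/4) * (Q.D e (fun x => P x * P x) y - Q.D e (fun x => M x * M x) y) := by
    intro y hy
    have hyN := Q.S_sub hy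
    rw [hPn.D_mul hPn e hy, hMn.D_mul hMn e hy, hp.D_mul hq e hy]
    have h1 : Q.D e P y = l⁻¹ * Q.D e p y + l * Q.D e q y := by
      simp only [D_S _ _ hy, hP]
      rw [fderiv_fun_add ((hp.diff hyN).const_mul _) ((hq.diff hyN).const_mul _),
        fderiv_const_mul (hp.diff hyN), fderiv_const_mul (hq.diff hyN)]
      simp
    have h2 : Q.D e M y = l⁻¹ * Q.D e p y + (-l) * Q.D e q y := by
      simp only [D_S _ _ hy, hM]
      rw [fderiv_fun_add ((hp.diff hyN).const_mul _) ((hq.diff hyN).const_mul _),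
        fderiv_const_mul (hp.diff hyN), fderiv_const_mul (hq.diff hyN)]
      simp
    rw [h1, h2]
    simp only [hP, hM]
    field_simp
    ring
  have e2 : ∫ y, Q.D e (fun x => p x * q x) y ∂Srf.μ =
      (1/4) * (∫ y, Q.D e (fun x => P x * P x) y ∂Srf.μ - ∫ y, Q.D e (fun x => M x * M x) y ∂Srf.μ) := by
    rw [← integral_sub (Srf.int_cont hfin (hPP.D e).contS) (Srf.int_cont hfin (hMM.D e).contS),
      ← integral_const_mul]
    refine integral_congr_ae ?_
    filter_upwards [Srf.ae_S] with y hy using e1 y hy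
  have f1 := Q.flow_abs hfin he hPP (fun y _ => mul_self_nonneg _)
  have f2 := Q.flow_abs hfin he hMM (fun y _ => mul_self_nonneg _)
  have e3 : ∫ y, P y * P y ∂Srf.μ + ∫ y, M y * M y ∂Srf.μ =
      2 * (l⁻¹ ^ 2 * ∫ y, p y ^ 2 ∂Srf.μ + l ^ 2 * ∫ y, q y ^ 2 ∂Srf.μ) := by
    have ip : Integrable (fun y => p y ^ 2) Srf.μ := Srf.int_cont hfin (hp.contS.pow 2)
    have iq : Integrable (fun y => q y ^ 2) Srf.μ := Srf.int_cont hfin (hq.contS.pow 2)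
    rw [← integral_add (Srf.int_cont hfin hPP.contS) (Srf.int_cont hfin hMM.contS),
      ← integral_const_mul, ← integral_const_mul, ← integral_add (ip.const_mul _) (iq.const_mul _),
      ← integral_const_mul]
    congr 1
    ext y
    simp only [hP, hM]; ring
  have hk : 0 ≤ 12 * Q.C / Q.δ := by positivity
  have ipp : 0 ≤ ∫ y, p y ^ 2 ∂Srf.μ := integral_nonneg fun _ => sq_nonneg _
  have iqq : 0 ≤ ∫ y, q y ^ 2 ∂Srf.μ := integral_nonneg fun _ => sq_nonneg _
  have hT : 0 ≤ (12 * Q.C / Q.δ) * (l⁻¹ ^ 2 * ∫ y, p y ^ 2 ∂Srf.μ + l ^ 2 * ∫ y, q y ^ 2 ∂Srf.μ) := by positivity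
  rw [e2, abs_mul, abs_of_pos (by norm_num : (0:ℝ) < 1/4)]
  have := (abs_sub _ _).trans (add_le_add f1 f2)
  rw [← mul_add, e3] at this
  linarith

end Tub

/-- Standard basis vector. -/
def eb (i : Fin 3) : E3 := EuclideanSpace.single i 1

lemma eb_norm (i : Fin 3) : ‖eb i‖ = 1 := by simp [eb]

lemma eb_sum (v : E3) : v = ∑ i, v i • eb i := by
  ext j
  fin_cases j <;> simp [eb, Fin.sum_univ_three]

lemma grad_coord (w : E3 → ℝ) (y : E3) (i : Fin 3) : gradient w y i = fderiv ℝ w y (eb i) := by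
  have : ⟪gradient w y, eb i⟫ = fderiv ℝ w y (eb i) := by
    rw [gradient, InnerProductSpace.toDual_symm_apply]
  rw [← this, eb, EuclideanSpace.inner_single_right]; simp

lemma grad_inner (w φ : E3 → ℝ) (y : E3) :
    ⟪gradient w y, gradient φ y⟫ = ∑ i, fderiv ℝ w y (eb i) * fderiv ℝ φ y (eb i) := by
  rw [PiLp.inner_apply]
  refine Finset.sum_congr rfl fun i _ => ?_
  rw [← grad_coord, ← grad_coord]; simp [mul_comm]

lemma grad_norm (w : E3 → ℝ) (y : E3) : ‖gradient w y‖ = ‖fderiv ℝ w y‖ := by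
  rw [gradient, LinearIsometryEquiv.norm_map]

lemma fnorm (w : E3 → ℝ) (y : E3) : ‖fderiv ℝ w y‖ ^ 2 = ∑ i, fderiv ℝ w y (eb i) ^ 2 := by
  rw [← grad_norm, ← real_inner_self_eq_norm_sq, grad_inner]
  simp only [sq]

lemma bnorm (T : E3 →L[ℝ] E3 →L[ℝ] ℝ) : ‖T‖ ≤ ∑ i, ∑ j, |T (eb i) (eb j)| := by
  refine ContinuousLinearMap.opNorm_le_bound₂ _ (by positivity) fun v v' => ?_
  have h1 : T v v' = ∑ i, ∑ j, v i * v' j * T (eb i) (eb j) := by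
    conv_lhs => rw [eb_sum v, eb_sum v']
    simp only [map_sum, sum_apply, map_smul, smul_apply, smul_eq_mul]
    simp only [Finset.mul_sum]
    rw [Finset.sum_comm]
    refine Finset.sum_congr rfl fun i _ => Finset.sum_congr rfl fun j _ => ?_
    ring
  rw [h1, Real.norm_eq_abs, Finset.sum_mul, Finset.sum_mul]
  refine (Finset.abs_sum_le_sum_abs _ _).trans (Finset.sum_le_sum fun i _ => ?_)
  rw [Finset.sum_mul, Finset.sum_mul]
  refine (Finset.abs_sum_le_sum_abs _ _).trans (Finset.sum_le_sum fun j _ => ?_)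
  rw [abs_mul, abs_mul, mul_comm (|v i| * |v' j|), mul_assoc]
  have h2 : |v i| ≤ ‖v‖ := PiLp.norm_apply_le v i
  have h3 : |v' j| ≤ ‖v'‖ := PiLp.norm_apply_le v' j
  gcongr

lemma bnorm_sq (T : E3 →L[ℝ] E3 →L[ℝ] ℝ) : ‖T‖ ^ 2 ≤ 9 * ∑ i, ∑ j, T (eb i) (eb j) ^ 2 := by
  have h := bnorm T
  have h1 : ‖T‖ ^ 2 ≤ (∑ i, ∑ j, |T (eb i) (eb j)|) ^ 2 := by gcongr
  refine h1.trans ?_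
  have h2 := sq_sum_le_card_mul_sum_sq (s := (Finset.univ : Finset (Fin 3 × Fin 3)))
    (f := fun ij => |T (eb ij.1) (eb ij.2)|)
  simp only [Fintype.sum_prod_type, sq_abs] at h2
  simpa using h2

namespace Tub
variable {Srf : SmoothSurface} {Q : Tub Srf}

lemma exists_ext {φ : E3 → ℝ} (hφ : ContDiffOn ℝ (⊤ : ℕ∞) φ Q.N) :
    ∃ φ' : E3 → ℝ, ContDiff ℝ (⊤ : ℕ∞) φ' ∧ ∀ y ∈ Srf.S, φ' y = φ y := by
  obtain ⟨χ, h0, h1, -⟩ := exists_contMDiffMap_zero_one_nhds_of_isClosed (n := (⊤ : ℕ∞))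
    (modelWithCornersSelf ℝ E3) Q.N_open.isClosed_compl Srf.compact.isClosed
    (Set.disjoint_left.2 fun x hx hx' => hx (Q.S_sub hx'))
  have hχ : ContDiff ℝ (⊤ : ℕ∞) χ := χ.contMDiff.contDiff
  refine ⟨fun x => χ x * φ x, ?_, fun y hy => ?_⟩
  · rw [contDiff_iff_contDiffAt]
    intro x
    by_cases hx : x ∈ Q.N
    · exact hχ.contDiffAt.mul (hφ.contDiffAt (Q.nh hx))
    · have : ∀ᶠ z in nhds x, χ z = 0 := Filter.Eventually.filter_mono (nhds_le_nhdsSet hx) h0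
      refine (contDiffAt_const (c := (0:ℝ))).congr_of_eventuallyEq ?_
      filter_upwards [this] with z hz
      simp [hz]
  · have : χ y = 1 := h1.self_of_nhdsSet y hy
    simp [this]

/-- Weak form for normal-constant test functions. -/
lemma weak {f u : E3 → ℝ} (hu : IsSolution Srf f u) {φ : E3 → ℝ} (hφ : Q.NC φ) :
    ∫ y, (∑ i, Q.D (eb i) (fun z => u (Q.a z)) y * Q.D (eb i) φ y + u y * φ y) ∂Srf.μ
      = ∫ y, f y * φ y ∂Srf.μ := by
  obtain ⟨φ', hφ', he⟩ := exists_ext hφ.smooth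
  have hw := Q.nc_hat hu.1
  have h := hu.2 φ' hφ'
  have hpe : (fun z => φ' (Q.a z)) = fun z => φ' (Q.a z) := rfl
  have hev : ∀ y ∈ Srf.S, (fun z => φ' (Q.a z)) =ᶠ[nhds y] φ := by
    intro y hy
    filter_upwards [Q.nh (Q.S_sub hy)] with z hz
    rw [he _ (Q.a_mem z hz), hφ.inv z hz]
  have e1 : ∫ x in Srf.S, f x * φ' x ∂μH[2] = ∫ y, f y * φ y ∂Srf.μ := by
    refine integral_congr_ae ?_
    filter_upwards [Srf.ae_S] with y hy
    rw [he y hy]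
  rw [← e1, ← h, SmoothSurface.aForm]
  refine integral_congr_ae ?_
  filter_upwards [Srf.ae_S] with y hy
  have hyN := Q.S_sub hy
  rw [Q.grad_eq hy (hw.diff hyN),
    Q.grad_eq hy ((hφ.diff hyN).congr_of_eventuallyEq (hev y hy)), grad_inner, he y hy]
  congr 1
  refine Finset.sum_congr rfl fun i _ => ?_
  rw [D_S _ _ hy, D_S _ _ hy, (hev y hy).fderiv_eq]

lemma young (x y : ℝ) {ε : ℝ} (hε : 0 < ε) : x * y ≤ ε * x ^ 2 + (4 * ε)⁻¹ * y ^ 2 := by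
  have : ε * x ^ 2 + (4 * ε)⁻¹ * y ^ 2 - x * y = ε * (x - (2 * ε)⁻¹ * y) ^ 2 := by
    field_simp; ring
  have h2 : 0 ≤ ε * (x - (2 * ε)⁻¹ * y) ^ 2 := by positivity
  linarith

lemma pointwise_real (H I A B : Fin 3 → Fin 3 → ℝ) (p : Fin 3 → ℝ) (C F w : ℝ)
    (b1 : ∀ i j, - (H i j * A i j) ≤ 1/16 * H i j ^ 2 + 16 * C ^ 2 * ∑ i, p i ^ 2)
    (b2 : ∀ i j, p i * B i j ≤ 48 * C ^ 2 * p i ^ 2 + 1/48 * ∑ k, H k j ^ 2)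
    (b3 : ∀ j, (w - F) * H j j ≤ 8 * (F ^ 2 + w ^ 2) + 1/16 * H j j ^ 2) :
    ∑ i, ∑ j, H i j ^ 2 ≤ ∑ i, ∑ j, I i j
      - (∑ i, ∑ j, (I i j - H i j ^ 2 - H i j * A i j + p i * B i j) + w * ∑ j, H j j - F * ∑ j, H j j)
      + (3 / 16 * ∑ i, ∑ j, H i j ^ 2 + 288 * C ^ 2 * ∑ i, p i ^ 2 + 24 * (F ^ 2 + w ^ 2)) := by
  have c1 := Finset.sum_le_sum fun i (_ : i ∈ Finset.univ) => Finset.sum_le_sum fun j (_ : j ∈ Finset.univ) => b1 i j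
  have c2 := Finset.sum_le_sum fun i (_ : i ∈ Finset.univ) => Finset.sum_le_sum fun j (_ : j ∈ Finset.univ) => b2 i j
  have c3 := Finset.sum_le_sum fun i (_ : i ∈ Finset.univ) => b3 i
  clear b1 b2 b3
  simp only [Fin.sum_univ_three] at *
  linarith [sq_nonneg (H 0 1), sq_nonneg (H 0 2), sq_nonneg (H 1 0), sq_nonneg (H 1 2), sq_nonneg (H 2 0), sq_nonneg (H 2 1)]

/-- Pointwise form of the second derivative estimate. -/
lemma pointwise_H {w : E3 → ℝ} (hw : Q.NC w) (F : ℝ) {y : E3} (hy : y ∈ Srf.S) :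
    ∑ i, ∑ j, Q.D (eb i) (Q.D (eb j) w) y ^ 2 ≤
      ∑ i, ∑ j, Q.D (eb j) (fun x => Q.D (eb i) w x * Q.D (eb i) (Q.D (eb j) w) x) y
      - (∑ i, Q.D (eb i) w y * Q.D (eb i) (fun x => ∑ j, Q.D (eb j) (Q.D (eb j) w) x) y
          + w y * ∑ j, Q.D (eb j) (Q.D (eb j) w) y - F * ∑ j, Q.D (eb j) (Q.D (eb j) w) y)
      + (3 / 16 * ∑ i, ∑ j, Q.D (eb i) (Q.D (eb j) w) y ^ 2 + 288 * Q.C ^ 2 * ∑ i, Q.D (eb i) w y ^ 2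
        + 24 * (F ^ 2 + w y ^ 2)) := by
  have hyN := Q.S_sub hy
  have hC := Q.C_pos
  set p : Fin 3 → E3 → ℝ := fun i => Q.D (eb i) w with hp
  have hpn : ∀ i, Q.NC (p i) := fun i => hw.D _
  set H : Fin 3 → Fin 3 → ℝ := fun i j => Q.D (eb i) (Q.D (eb j) w) y with hH
  have hsumD : ∀ i, Q.D (eb i) (fun x => ∑ j, Q.D (eb j) (Q.D (eb j) w) x) y =
      ∑ j, Q.D (eb i) (Q.D (eb j) (p j)) y := by
    intro i
    rw [D_S _ _ hy, fderiv_fun_sum (fun j _ => ((hw.D (eb j)).D (eb j)).diff hyN), sum_apply]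
    exact Finset.sum_congr rfl fun j _ => (D_S _ _ hy).symm
  have key : ∀ i j, p i y * Q.D (eb i) (Q.D (eb j) (p j)) y =
      Q.D (eb j) (fun x => Q.D (eb i) w x * Q.D (eb i) (Q.D (eb j) w) x) y - H i j ^ 2
        - H i j * fderiv ℝ w y (Q.Γ (eb j) (eb i) y) + p i y * fderiv ℝ (p j) y (Q.Γ (eb i) (eb j) y) := by
    intro i j
    rw [(hpn j).comm hy (eb i) (eb j), (hpn i).D_mul ((hpn j).D (eb i)) (eb j) hy]
    have : Q.D (eb j) (Q.D (eb i) w) y = H i j + fderiv ℝ w y (Q.Γ (eb j) (eb i) y) :=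
      hw.comm hy (eb j) (eb i)
    rw [this]
    simp only [hH, hp]
    ring
  have hd : ∀ (g : E3 → ℝ) i j, fderiv ℝ g y (Q.Γ (eb i) (eb j) y) ^ 2 ≤ 4 * Q.C ^ 2 * ∑ k, fderiv ℝ g y (eb k) ^ 2 := by
    intro g i j
    have h1 := (fderiv ℝ g y).le_opNorm (Q.Γ (eb i) (eb j) y)
    have h2 := Γ_le (Q := Q) hy (eb i) (eb j) (eb_norm i).le (eb_norm j).le
    rw [← fnorm, ← sq_abs, ← Real.norm_eq_abs]
    calc _ ≤ (‖fderiv ℝ g y‖ * (2 * Q.C)) ^ 2 := by gcongr; exact h1.trans (by gcongr)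
      _ = _ := by ring
  set PP := ∑ i, p i y ^ 2 with hPP
  have hPP' : ∑ k, fderiv ℝ w y (eb k) ^ 2 = PP :=
    Finset.sum_congr rfl fun k _ => by simp only [hp, D_S _ _ hy]
  have hHj : ∀ j, ∑ k, fderiv ℝ (p j) y (eb k) ^ 2 = ∑ k, H k j ^ 2 := fun j =>
    Finset.sum_congr rfl fun k _ => by simp only [hH]; rw [D_S (w := Q.D (eb j) w) _ hy]
  have b1 : ∀ i j, - (H i j * fderiv ℝ w y (Q.Γ (eb j) (eb i) y)) ≤ 1/16 * H i j ^ 2 + 16 * Q.C ^ 2 * PP := by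
    intro i j
    have h1 := hd w j i
    rw [hPP'] at h1
    have h2 := young (H i j) (-fderiv ℝ w y (Q.Γ (eb j) (eb i) y)) (ε := 1/16) (by norm_num)
    norm_num at h2
    linarith
  have b2 : ∀ i j, p i y * fderiv ℝ (p j) y (Q.Γ (eb i) (eb j) y) ≤
      48 * Q.C ^ 2 * p i y ^ 2 + 1/48 * ∑ k, H k j ^ 2 := by
    intro i j
    have h1 := hd (p j) i j
    rw [hHj] at h1
    have h2 := young (p i y) (fderiv ℝ (p j) y (Q.Γ (eb i) (eb j) y)) (ε := 48 * Q.C ^ 2) (by positivity)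
    refine h2.trans (add_le_add le_rfl ?_)
    rw [inv_mul_le_iff₀ (by positivity)]
    calc _ ≤ _ := h1
      _ = _ := by ring
  have b3 : ∀ j, (w y - F) * H j j ≤ 8 * (F ^ 2 + w y ^ 2) + 1/16 * H j j ^ 2 := by
    intro j
    have h2 := young (H j j) (w y - F) (ε := 1/16) (by norm_num)
    norm_num at h2
    nlinarith [sq_nonneg (F + w y)]
  simp only [hsumD]
  have hkey2 : ∑ i, p i y * ∑ j, Q.D (eb i) (Q.D (eb j) (p j)) y =
      ∑ i, ∑ j, (Q.D (eb j) (fun x => Q.D (eb i) w x * Q.D (eb i) (Q.D (eb j) w) x) y - H i j ^ 2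
        - H i j * fderiv ℝ w y (Q.Γ (eb j) (eb i) y) + p i y * fderiv ℝ (p j) y (Q.Γ (eb i) (eb j) y)) := by
    refine Finset.sum_congr rfl fun i _ => ?_
    rw [Finset.mul_sum]
    exact Finset.sum_congr rfl fun j _ => key i j
  have hh : ∑ i, Q.D (eb i) w y * ∑ j, Q.D (eb i) (Q.D (eb j) (p j)) y =
    ∑ i, p i y * ∑ j, Q.D (eb i) (Q.D (eb j) (p j)) y := rfl
  rw [hh, hkey2]
  exact pointwise_real H (fun i j => Q.D (eb j) (fun x => Q.D (eb i) w x * Q.D (eb i) (Q.D (eb j) w) x) y)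
    (fun i j => fderiv ℝ w y (Q.Γ (eb j) (eb i) y)) (fun i j => fderiv ℝ (p j) y (Q.Γ (eb i) (eb j) y))
    (fun i => p i y) Q.C F (w y) b1 b2 b3

end Tub

namespace Tub
variable {Srf : SmoothSurface} {Q : Tub Srf}

lemma NC.int (hfin : μH[2] Srf.S < ⊤) {w : E3 → ℝ} (h : Q.NC w) : Integrable w Srf.μ :=
  Srf.int_cont hfin h.contS

lemma NC.int_sq (hfin : μH[2] Srf.S < ⊤) {w : E3 → ℝ} (h : Q.NC w) :
    Integrable (fun y => w y ^ 2) Srf.μ :=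
  Srf.int_cont hfin (h.contS.pow 2)

lemma D2_le {w : E3 → ℝ} (hw : Q.NC w) {y : E3} (hy : y ∈ Srf.S) :
    ‖fderiv ℝ (fderiv ℝ w) y‖ ^ 2 ≤ 18 * (∑ i, ∑ j, Q.D (eb i) (Q.D (eb j) w) y ^ 2)
      + 162 * Q.C ^ 2 * ∑ i, Q.D (eb i) w y ^ 2 := by
  have hC := Q.C_pos
  have hPP : ∑ i, Q.D (eb i) w y ^ 2 = ‖fderiv ℝ w y‖ ^ 2 := by
    rw [fnorm]; exact Finset.sum_congr rfl fun k _ => by rw [D_S _ _ hy]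
  have h1 : ∀ i j, fderiv ℝ (fderiv ℝ w) y (eb i) (eb j) ^ 2 ≤
      2 * Q.D (eb i) (Q.D (eb j) w) y ^ 2 + 2 * Q.C ^ 2 * ‖fderiv ℝ w y‖ ^ 2 := by
    intro i j
    have h2 := hw.DD hy (eb i) (eb j)
    have h3 : |⟪Srf.n y, eb i⟫ * fderiv ℝ w y (fderiv ℝ (fderiv ℝ Q.a) y (Srf.n y) (eb j))| ≤
        Q.C * ‖fderiv ℝ w y‖ := by
      rw [abs_mul]
      have h4 := n_inner_le hy (eb i)
      rw [eb_norm] at h4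
      have h5 := (fderiv ℝ w y).le_opNorm (fderiv ℝ (fderiv ℝ Q.a) y (Srf.n y) (eb j))
      have h6 := dda_n_le (Q := Q) hy (eb j) (eb_norm j).le
      rw [Real.norm_eq_abs] at h5
      calc _ ≤ 1 * (‖fderiv ℝ w y‖ * Q.C) := by
            gcongr
            exact h5.trans (by gcongr)
        _ = _ := by ring
    generalize ⟪Srf.n y, eb i⟫ * fderiv ℝ w y (fderiv ℝ (fderiv ℝ Q.a) y (Srf.n y) (eb j)) = r at *
    have h7 : fderiv ℝ (fderiv ℝ w) y (eb i) (eb j) = Q.D (eb i) (Q.D (eb j) w) y + r := by linarith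
    have h8 : r ^ 2 ≤ Q.C ^ 2 * ‖fderiv ℝ w y‖ ^ 2 := by
      rw [← sq_abs, ← mul_pow]; gcongr
    rw [h7]
    nlinarith [sq_nonneg (Q.D (eb i) (Q.D (eb j) w) y - r)]
  have h2 := bnorm_sq (fderiv ℝ (fderiv ℝ w) y)
  have c1 := Finset.sum_le_sum fun i (_ : i ∈ Finset.univ) => Finset.sum_le_sum fun j (_ : j ∈ Finset.univ) => h1 i j
  rw [hPP]
  simp only [Fin.sum_univ_three] at *
  linarith

/-- The regularity constant. -/
lemma h2_reg (Q : Tub Srf) (hfin : μH[2] Srf.S < ⊤) :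
    ∃ K : ℝ, 1 ≤ K ∧ ∀ f u : E3 → ℝ, SmoothNear f Srf.S → IsSolution Srf f u →
      ∫ y, (u (Q.a y) ^ 2 + ‖fderiv ℝ (fun z => u (Q.a z)) y‖ ^ 2
        + ‖fderiv ℝ (fderiv ℝ (fun z => u (Q.a z))) y‖ ^ 2) ∂Srf.μ ≤ K * ∫ y, f y ^ 2 ∂Srf.μ := by
  have hC := Q.C_pos
  have hδ := Q.δ_pos
  set K := 12 * Q.C / Q.δ with hK
  have hKp : 0 < K := by positivity
  refine ⟨2 + 162 * Q.C ^ 2 + 36 * (12 * K ^ 2 + 288 * Q.C ^ 2 + 48), by nlinarith [sq_nonneg Q.C, sq_nonneg K], ?_⟩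
  intro f u hf hu
  obtain ⟨w, hwdef⟩ : ∃ w : E3 → ℝ, w = fun z => u (Q.a z) := ⟨_, rfl⟩
  have hw : Q.NC w := by rw [hwdef]; exact Q.nc_hat hu.1
  have hwu : ∀ y ∈ Srf.S, w y = u y := fun y hy => by rw [hwdef]; simp only [Q.fix hy]
  have hfc : ContinuousOn f Srf.S := by
    obtain ⟨V, hV, hSV, h⟩ := hf
    exact h.continuousOn.mono hSV
  have hA : Integrable (fun y => f y ^ 2) Srf.μ := Srf.int_cont hfin (hfc.pow 2)
  have hp : ∀ i, Q.NC (Q.D (eb i) w) := fun i => hw.D _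
  have hH : ∀ i j, Q.NC (Q.D (eb i) (Q.D (eb j) w)) := fun i j => (hp j).D _
  have hPPi : Integrable (fun y => ∑ i, Q.D (eb i) w y ^ 2) Srf.μ :=
    integrable_finsetSum _ fun i _ => (hp i).int_sq hfin
  have hHHi : Integrable (fun y => ∑ i, ∑ j, Q.D (eb i) (Q.D (eb j) w) y ^ 2) Srf.μ :=
    integrable_finsetSum _ fun i _ => integrable_finsetSum _ fun j _ => (hH i j).int_sq hfin
  have hW := hw.int_sq hfin
  have weak' : ∀ φ : E3 → ℝ, Q.NC φ →
      ∫ y, (∑ i, Q.D (eb i) w y * Q.D (eb i) φ y + w y * φ y - f y * φ y) ∂Srf.μ = 0 := by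
    intro φ hφ
    have h := weak hu hφ
    rw [← hwdef] at h
    have i1 : Integrable (fun y => ∑ i, Q.D (eb i) w y * Q.D (eb i) φ y + w y * φ y) Srf.μ :=
      (integrable_finsetSum _ fun i _ => ((hp i).mul (hφ.D (eb i))).int hfin).add ((hw.mul hφ).int hfin)
    have i2 : Integrable (fun y => f y * φ y) Srf.μ := Srf.int_cont hfin (hfc.mul hφ.contS)
    rw [integral_sub i1 i2, sub_eq_zero, ← h]
    refine integral_congr_ae ?_
    filter_upwards [Srf.ae_S] with y hy
    rw [hwu y hy]
  -- energy
  have en : 2 * ∫ y, (∑ i, Q.D (eb i) w y ^ 2) ∂Srf.μ + ∫ y, w y ^ 2 ∂Srf.μ ≤ ∫ y, f y ^ 2 ∂Srf.μ := by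
    have h := weak' w hw
    have i1 : Integrable (fun y => ∑ i, Q.D (eb i) w y * Q.D (eb i) w y + w y * w y - f y * w y) Srf.μ :=
      Srf.int_cont hfin (((continuousOn_finsetSum _ fun i _ => (hp i).contS.mul (hp i).contS).add
        (hw.contS.mul hw.contS)).sub (hfc.mul hw.contS))
    have h2 : ∫ y, (2 * (∑ i, Q.D (eb i) w y ^ 2) + w y ^ 2) ∂Srf.μ ≤
        ∫ y, (f y ^ 2 + 2 * (∑ i, Q.D (eb i) w y * Q.D (eb i) w y + w y * w y - f y * w y)) ∂Srf.μ := by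
      refine integral_mono ((hPPi.const_mul 2).add hW) (hA.add (i1.const_mul 2)) fun y => ?_
      simp only [sq]
      nlinarith [sq_nonneg (f y - w y)]
    rw [integral_add (hPPi.const_mul 2) hW, integral_add hA (i1.const_mul 2), integral_const_mul,
      integral_const_mul, h] at h2
    linarith
  have hφ : Q.NC (fun x => ∑ j, Q.D (eb j) (Q.D (eb j) w) x) := NC.sum _ fun j _ => hH j j
  have hl : 0 < Real.sqrt (1 / (4 * K)) := Real.sqrt_pos.2 (by positivity)
  have hl2 : Real.sqrt (1 / (4 * K)) ^ 2 = 1 / (4 * K) := Real.sq_sqrt (by positivity)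
  have fl : ∀ i j, ∫ y, Q.D (eb j) (fun x => Q.D (eb i) w x * Q.D (eb i) (Q.D (eb j) w) x) y ∂Srf.μ ≤
      4 * K ^ 2 * ∫ y, Q.D (eb i) w y ^ 2 ∂Srf.μ + 1 / 4 * ∫ y, Q.D (eb i) (Q.D (eb j) w) y ^ 2 ∂Srf.μ := by
    intro i j
    refine (le_abs_self _).trans ((flow_prod Q hfin (eb_norm j).le (hp i) (hH i j) hl).trans (le_of_eq ?_))
    rw [← hK, inv_pow, hl2]
    field_simp
  have hIi : ∀ i j, Integrable (Q.D (eb j) (fun x => Q.D (eb i) w x * Q.D (eb i) (Q.D (eb j) w) x)) Srf.μ :=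
    fun i j => (((hp i).mul (hH i j)).D _).int hfin
  have second : ∫ y, (∑ i, ∑ j, Q.D (eb i) (Q.D (eb j) w) y ^ 2) ∂Srf.μ ≤
      2 * ((12 * K ^ 2 + 288 * Q.C ^ 2) * ∫ y, (∑ i, Q.D (eb i) w y ^ 2) ∂Srf.μ
        + 24 * (∫ y, f y ^ 2 ∂Srf.μ + ∫ y, w y ^ 2 ∂Srf.μ)) := by
    have hz := weak' _ hφ
    have i1 : Integrable (fun y => ∑ i, ∑ j, Q.D (eb j) (fun x => Q.D (eb i) w x * Q.D (eb i) (Q.D (eb j) w) x) y) Srf.μ :=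
      integrable_finsetSum _ fun i _ => integrable_finsetSum _ fun j _ => hIi i j
    have i2 : Integrable (fun y => ∑ i, Q.D (eb i) w y * Q.D (eb i) (fun x => ∑ j, Q.D (eb j) (Q.D (eb j) w) x) y
          + w y * (∑ j, Q.D (eb j) (Q.D (eb j) w) y) - f y * ∑ j, Q.D (eb j) (Q.D (eb j) w) y) Srf.μ :=
      Srf.int_cont hfin (((continuousOn_finsetSum _ fun i _ => (hp i).contS.mul (hφ.D _).contS).add
        (hw.contS.mul hφ.contS)).sub (hfc.mul hφ.contS))
    have i3 : Integrable (fun y => 3 / 16 * ∑ i, ∑ j, Q.D (eb i) (Q.D (eb j) w) y ^ 2 + 288 * Q.C ^ 2 * ∑ i, Q.D (eb i) w y ^ 2) Srf.μ :=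
      (hHHi.const_mul _).add (hPPi.const_mul _)
    have i4 : Integrable (fun y => 24 * (f y ^ 2 + w y ^ 2)) Srf.μ := (hA.add hW).const_mul _
    have h1 := integral_mono_ae hHHi ((i1.sub i2).add (i3.add i4)) (by
      filter_upwards [Srf.ae_S] with y hy
      exact pointwise_H hw (f y) hy)
    simp only [Pi.add_apply, Pi.sub_apply] at h1
    have h2 : ∫ y, (∑ i, ∑ j, Q.D (eb i) (Q.D (eb j) w) y ^ 2) ∂Srf.μ = ∑ i, ∑ j, ∫ y, Q.D (eb i) (Q.D (eb j) w) y ^ 2 ∂Srf.μ := by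
      rw [integral_finsetSum _ fun i _ => integrable_finsetSum _ fun j _ => (hH i j).int_sq hfin]
      exact Finset.sum_congr rfl fun i _ => integral_finsetSum _ fun j _ => (hH i j).int_sq hfin
    have h3 : ∫ y, (∑ i, Q.D (eb i) w y ^ 2) ∂Srf.μ = ∑ i, ∫ y, Q.D (eb i) w y ^ 2 ∂Srf.μ :=
      integral_finsetSum _ fun i _ => (hp i).int_sq hfin
    have h4 : ∫ y, (∑ i, ∑ j, Q.D (eb j) (fun x => Q.D (eb i) w x * Q.D (eb i) (Q.D (eb j) w) x) y) ∂Srf.μ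
        = ∑ i, ∑ j, ∫ y, Q.D (eb j) (fun x => Q.D (eb i) w x * Q.D (eb i) (Q.D (eb j) w) x) y ∂Srf.μ := by
      rw [integral_finsetSum _ fun i _ => integrable_finsetSum _ fun j _ => hIi i j]
      exact Finset.sum_congr rfl fun i _ => integral_finsetSum _ fun j _ => hIi i j
    have h5 := integral_add (i1.sub i2) (i3.add i4)
    have h6 := integral_sub i1 i2
    have h7 := integral_add i3 i4
    have h8 := integral_add (hHHi.const_mul (3/16)) (hPPi.const_mul (288 * Q.C ^ 2))
    have h9 := integral_add hA hW
    simp only [Pi.add_apply, Pi.sub_apply] at h5 h6 h7 h8 h9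
    rw [h5, h6, h7, h8, integral_const_mul, integral_const_mul, integral_const_mul, h9, hz, h4] at h1
    have c1 := Finset.sum_le_sum fun i (_ : i ∈ Finset.univ) => Finset.sum_le_sum fun j (_ : j ∈ Finset.univ) => fl i j
    have hnn : 0 ≤ ∫ y, (∑ i, ∑ j, Q.D (eb i) (Q.D (eb j) w) y ^ 2) ∂Srf.μ :=
      integral_nonneg fun y => by positivity
    have c2 : ∑ i, ∑ j, (4 * K ^ 2 * ∫ y, Q.D (eb i) w y ^ 2 ∂Srf.μ + 1 / 4 * ∫ y, Q.D (eb i) (Q.D (eb j) w) y ^ 2 ∂Srf.μ)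
        = 12 * K ^ 2 * ∫ y, (∑ i, Q.D (eb i) w y ^ 2) ∂Srf.μ + 1/4 * ∫ y, (∑ i, ∑ j, Q.D (eb i) (Q.D (eb j) w) y ^ 2) ∂Srf.μ := by
      rw [h2, h3]
      simp only [Fin.sum_univ_three]; ring
    rw [c2] at c1
    linarith
  have hlast : ∫ y, (u (Q.a y) ^ 2 + ‖fderiv ℝ w y‖ ^ 2 + ‖fderiv ℝ (fderiv ℝ w) y‖ ^ 2) ∂Srf.μ ≤
      ∫ y, (w y ^ 2 + ((1 + 162 * Q.C ^ 2) * ∑ i, Q.D (eb i) w y ^ 2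
        + 18 * ∑ i, ∑ j, Q.D (eb i) (Q.D (eb j) w) y ^ 2)) ∂Srf.μ := by
    refine integral_mono_of_nonneg (Filter.Eventually.of_forall fun y => by positivity)
      (hW.add ((hPPi.const_mul _).add (hHHi.const_mul _))) ?_
    filter_upwards [Srf.ae_S] with y hy
    have h1 := D2_le hw hy
    have hPP : ∑ i, Q.D (eb i) w y ^ 2 = ‖fderiv ℝ w y‖ ^ 2 := by
      rw [fnorm]; exact Finset.sum_congr rfl fun k _ => by rw [D_S _ _ hy]
    have h3 : u (Q.a y) = w y := by rw [hwdef]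
    rw [h3]
    rw [hPP] at h1 ⊢
    linarith
  rw [← hwdef]
  refine hlast.trans ?_
  have q1 := integral_add hW ((hPPi.const_mul (1 + 162 * Q.C ^ 2)).add (hHHi.const_mul 18))
  have q2 := integral_add (hPPi.const_mul (1 + 162 * Q.C ^ 2)) (hHHi.const_mul 18)
  simp only [Pi.add_apply] at q1 q2
  rw [q1, q2, integral_const_mul, integral_const_mul]
  have n1 : 0 ≤ ∫ y, (∑ i, Q.D (eb i) w y ^ 2) ∂Srf.μ := integral_nonneg fun y => by positivity
  have n2 : 0 ≤ ∫ y, w y ^ 2 ∂Srf.μ := integral_nonneg fun y => by positivity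
  generalize ∫ y, (∑ i, Q.D (eb i) w y ^ 2) ∂Srf.μ = P at *
  generalize ∫ y, w y ^ 2 ∂Srf.μ = W at *
  generalize ∫ y, f y ^ 2 ∂Srf.μ = A at *
  generalize ∫ y, (∑ i, ∑ j, Q.D (eb i) (Q.D (eb j) w) y ^ 2) ∂Srf.μ = HH at *
  have hPA : P ≤ A := by linarith
  have hWA : W ≤ A := by linarith
  have m1 : (12 * K ^ 2 + 288 * Q.C ^ 2) * P ≤ (12 * K ^ 2 + 288 * Q.C ^ 2) * A := by gcongr
  have m2 : (1 + 162 * Q.C ^ 2) * P ≤ (1 + 162 * Q.C ^ 2) * A := by gcongr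
  nlinarith

end Tub

/-- Geometric constant. -/
def Tub.K {Srf : SmoothSurface} (Q : Tub Srf) (γ : ℝ) : ℝ := 3 * Q.C + 2 * Q.C / γ

/-- A good small triangle. -/
structure GoodTri {Srf : SmoothSurface} (Q : Tub Srf) (γ h : ℝ) (t : E3 × E3 × E3) : Prop where
  γ_pos : 0 < γ
  h_pos : 0 < h
  h_le : h ≤ Q.δ
  Kh_le : Q.K γ * h ≤ 1 / 4
  indep : AffineIndependent ℝ ![t.1, t.2.1, t.2.2]
  verts_on : vertsOf t ⊆ Srf.S
  diam_le : Metric.diam (triOf t) ≤ h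
  disk : ∃ y ∈ triOf t, closedBall y (γ * h) ∩ planeOf t ⊆ triOf t

lemma tri_compact (t : E3 × E3 × E3) : IsCompact (triOf t) := by
  unfold triOf
  exact (Set.toFinite _).isCompact_convexHull (𝕜 := ℝ)

lemma tri_convex (t : E3 × E3 × E3) : Convex ℝ (triOf t) := convex_convexHull _ _

lemma vert_mem (t : E3 × E3 × E3) {v : E3} (hv : v ∈ vertsOf t) : v ∈ triOf t := subset_convexHull _ _ hv

lemma v1_mem (t : E3 × E3 × E3) : t.1 ∈ vertsOf t := by simp [vertsOf]

lemma tri_plane (t : E3 × E3 × E3) : triOf t ⊆ planeOf t := convexHull_subset_affineSpan _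

lemma sub_dir {t : E3 × E3 × E3} {x x' : E3} (hx : x ∈ planeOf t) (hx' : x' ∈ planeOf t) : x - x' ∈ dirOf t :=
  AffineSubspace.vsub_mem_direction hx hx'

lemma add_plane {t : E3 × E3 × E3} {x τ : E3} (hx : x ∈ planeOf t) (hτ : τ ∈ dirOf t) : x + τ ∈ planeOf t := by
  have := AffineSubspace.vadd_mem_of_mem_direction hτ hx
  rwa [vadd_eq_add, add_comm] at this

lemma tri_measurable (t : E3 × E3 × E3) : MeasurableSet (triOf t) := (tri_compact t).measurableSet

namespace GoodTri
variable {Srf : SmoothSurface} {Q : Tub Srf} {γ h : ℝ} {t : E3 × E3 × E3} (g : GoodTri Q γ h t)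
include g

lemma Kpos : 0 < Q.K γ := by
  have := Q.C_pos; have := g.γ_pos
  unfold Tub.K; positivity

lemma dist_le {x x' : E3} (hx : x ∈ triOf t) (hx' : x' ∈ triOf t) : ‖x - x'‖ ≤ h := by
  rw [← dist_eq_norm]
  exact (dist_le_diam_of_mem (tri_compact t).isBounded hx hx').trans g.diam_le

lemma v1S : t.1 ∈ Srf.S := g.verts_on (v1_mem t)

lemma d3 {x : E3} (hx : x ∈ triOf t) : ‖x - t.1‖ ≤ 3 * Q.δ := by
  have := g.dist_le hx (vert_mem t (v1_mem t))
  have := g.h_le; have := Q.δ_pos; linarith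

lemma mem {x : E3} (hx : x ∈ triOf t) : x ∈ Q.N := Q.mem _ g.v1S _ (g.d3 hx)

lemma near {x : E3} (hx : x ∈ triOf t) : ‖x - Q.a x‖ ≤ h := by
  have := Q.a_nearest x (g.mem hx) _ g.v1S
  rw [dist_eq_norm, dist_eq_norm] at this
  exact this.trans (g.dist_le hx (vert_mem t (v1_mem t)))

lemma aff_le {L : E3 →ₗ[ℝ] ℝ} {c M : ℝ} (hM : ∀ v ∈ vertsOf t, |L v + c| ≤ M) {x : E3} (hx : x ∈ triOf t) :
    |L x + c| ≤ M := by
  have hconv : Convex ℝ {x : E3 | |L x + c| ≤ M} := by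
    intro x hx y hy a b ha hb hab
    simp only [Set.mem_ofPred_eq, map_add, map_smul, smul_eq_mul, abs_le] at *
    have hc : c = a * c + b * c := by rw [← add_mul, hab, one_mul]
    have hM' : M = a * M + b * M := by rw [← add_mul, hab, one_mul]
    constructor <;> rw [hc, hM'] <;> nlinarith [mul_le_mul_of_nonneg_left hx.1 ha, mul_le_mul_of_nonneg_left hx.2 ha, mul_le_mul_of_nonneg_left hy.1 hb, mul_le_mul_of_nonneg_left hy.2 hb]
  exact convexHull_min hM hconv hx

lemma aff_dir {L : E3 →ₗ[ℝ] ℝ} {c M : ℝ} (hM : ∀ v ∈ vertsOf t, |L v + c| ≤ M) {τ : E3} (hτ : τ ∈ dirOf t) :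
    |L τ| ≤ 2 * M / (γ * h) * ‖τ‖ := by
  have hγ := g.γ_pos
  have hh := g.h_pos
  by_cases h0 : τ = 0
  · simp [h0]
  have hn : 0 < ‖τ‖ := norm_pos_iff.2 h0
  obtain ⟨y, hy, hd⟩ := g.disk
  have hy' : y + (γ * h / ‖τ‖) • τ ∈ triOf t := by
    refine hd ⟨?_, add_plane (tri_plane t hy) ((dirOf t).smul_mem _ hτ)⟩
    rw [mem_closedBall, dist_eq_norm, add_sub_cancel_left, norm_smul, Real.norm_eq_abs, abs_of_pos (by positivity),
      div_mul_cancel₀ _ hn.ne']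
  have h1 := abs_le.1 (g.aff_le hM hy)
  have h2 := abs_le.1 (g.aff_le hM hy')
  rw [map_add, map_smul, smul_eq_mul] at h2
  have h3 : |γ * h / ‖τ‖ * L τ| ≤ 2 * M := by rw [abs_le]; constructor <;> linarith
  rw [abs_mul, abs_of_pos (by positivity), div_mul_eq_mul_div, div_le_iff₀ hn] at h3
  rw [div_mul_eq_mul_div, le_div_iff₀ (by positivity)]
  linarith

/-- tangency -/
lemma G2 {x : E3} (hx : x ∈ triOf t) {τ : E3} (hτ : τ ∈ dirOf t) :
    |⟪Srf.n (Q.a x), τ⟫| ≤ (2 * Q.C + 2 * Q.C / γ) * h * ‖τ‖ := by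
  have hγ := g.γ_pos
  have hh := g.h_pos
  have hC := Q.C_pos
  have h1 : |⟪Srf.n t.1, τ⟫| ≤ 2 * (Q.C * h ^ 2) / (γ * h) * ‖τ‖ := by
    refine g.aff_dir (L := (innerSL ℝ (Srf.n t.1)).toLinearMap) (c := - ⟪Srf.n t.1, t.1⟫) (M := Q.C * h ^ 2) ?_ hτ
    intro v hv
    have h2 := Q.quad g.v1S (g.verts_on hv) (g.d3 (vert_mem t hv))
    have h3 := g.dist_le (vert_mem t hv) (vert_mem t (v1_mem t))
    rw [inner_sub_right] at h2
    calc _ ≤ _ := h2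
      _ ≤ _ := by gcongr
  have h4 : ‖Srf.n (Q.a x) - Srf.n t.1‖ ≤ Q.C * (2 * h) := by
    refine (Q.n_lip _ (Q.a_mem x (g.mem hx)) _ g.v1S).trans ?_
    gcongr
    calc ‖Q.a x - t.1‖ = ‖(x - t.1) - (x - Q.a x)‖ := by congr 1; abel
      _ ≤ _ := norm_sub_le _ _
      _ ≤ h + h := add_le_add (g.dist_le hx (vert_mem t (v1_mem t))) (g.near hx)
      _ = _ := by ring
  have h5 : |⟪Srf.n (Q.a x) - Srf.n t.1, τ⟫| ≤ Q.C * (2 * h) * ‖τ‖ :=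
    (abs_real_inner_le_norm _ _).trans (by gcongr)
  have h6 : ⟪Srf.n (Q.a x), τ⟫ = ⟪Srf.n (Q.a x) - Srf.n t.1, τ⟫ + ⟪Srf.n t.1, τ⟫ := by
    rw [inner_sub_left]; ring
  rw [h6]
  refine (abs_add_le _ _).trans ((add_le_add h5 h1).trans (le_of_eq ?_))
  field_simp

lemma G2' {x : E3} (hx : x ∈ triOf t) {τ : E3} (hτ : τ ∈ dirOf t) :
    |⟪Srf.n (Q.a x), τ⟫| ≤ Q.K γ * h * ‖τ‖ := by
  refine (g.G2 hx hτ).trans ?_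
  have := g.h_pos; have := Q.C_pos
  unfold Tub.K
  gcongr
  linarith

lemma G3 {x : E3} (hx : x ∈ triOf t) {τ : E3} (hτ : τ ∈ dirOf t) :
    ‖fderiv ℝ Q.a x τ - τ‖ ≤ Q.K γ * h * ‖τ‖ := by
  have hC := Q.C_pos
  have hS := Q.a_mem x (g.mem hx)
  have hnear := g.near hx
  have hd := g.h_le
  have h1 : ‖fderiv ℝ Q.a x - fderiv ℝ Q.a (Q.a x)‖ ≤ Q.C * h :=
    (Q.da_lip hS (by linarith [Q.δ_pos]) (by simp [Q.δ_pos.le])).trans (by gcongr)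
  have h2 : fderiv ℝ Q.a x τ - τ = (fderiv ℝ Q.a x - fderiv ℝ Q.a (Q.a x)) τ - ⟪Srf.n (Q.a x), τ⟫ • Srf.n (Q.a x) := by
    rw [sub_apply, Q.deriv_S hS]; abel
  rw [h2]
  refine (norm_sub_le _ _).trans ?_
  rw [norm_smul, Srf.n_unit _ hS, mul_one, Real.norm_eq_abs]
  have h3 := ((fderiv ℝ Q.a x - fderiv ℝ Q.a (Q.a x)).le_opNorm τ).trans (mul_le_mul_of_nonneg_right h1 (norm_nonneg _))
  refine (add_le_add h3 (g.G2 hx hτ)).trans (le_of_eq ?_)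
  unfold Tub.K; ring

lemma G4 {x x' : E3} (hx : x ∈ triOf t) (hx' : x' ∈ triOf t) :
    ‖Q.a x - Q.a x' - (x - x')‖ ≤ Q.K γ * h * ‖x - x'‖ := by
  have hτ := sub_dir (tri_plane t hx) (tri_plane t hx')
  have hmem : ∀ s ∈ Set.Icc (0:ℝ) 1, x' + s • (x - x') ∈ triOf t := fun s hs =>
    (tri_convex t).add_smul_sub_mem hx' hx hs
  have h1 : ∀ s ∈ Set.Icc (0:ℝ) 1, HasDerivWithinAt (fun s : ℝ => Q.a (x' + s • (x - x')) - s • (x - x'))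
      (fderiv ℝ Q.a (x' + s • (x - x')) (x - x') - (x - x')) (Set.Icc 0 1) s := by
    intro s hs
    have e1 : HasDerivAt (fun s : ℝ => x' + s • (x - x')) (x - x') s := by
      simpa using ((hasDerivAt_id s).smul_const (x - x')).const_add x'
    have e2 : HasDerivAt (fun s : ℝ => s • (x - x')) (x - x') s := by
      simpa using ((hasDerivAt_id s).smul_const (x - x'))
    have e3 := (Q.diff (g.mem (hmem s hs))).hasFDerivAt.comp_hasDerivAt s e1
    exact (e3.sub e2).hasDerivWithinAt
  have h2 := norm_image_sub_le_of_norm_deriv_le_segment_01' h1 (C := Q.K γ * h * ‖x - x'‖)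
    (fun s hs => g.G3 (hmem s (Set.Ico_subset_Icc_self hs)) hτ)
  simp only [one_smul, zero_smul, add_zero, sub_zero, add_sub_cancel] at h2
  rwa [sub_right_comm]

end GoodTri

/-- Decomposition along a unit vector spanning the orthogonal complement. -/
lemma exists_unit_normal {t : E3 × E3 × E3} (hi : AffineIndependent ℝ ![t.1, t.2.1, t.2.2]) :
    ∃ ν : E3, ‖ν‖ = 1 ∧ (∀ τ ∈ dirOf t, ⟪ν, τ⟫ = 0) ∧ ∀ v : E3, v - ⟪ν, v⟫ • ν ∈ dirOf t := by
  have hr : Set.range ![t.1, t.2.1, t.2.2] = vertsOf t := by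
    ext z
    simp only [vertsOf, Set.mem_range, Set.mem_insert_iff, Set.mem_singleton_iff, Fin.exists_fin_succ]
    simp [eq_comm]
  have hfin : Module.finrank ℝ (dirOf t) = 2 := by
    have := hi.finrank_vectorSpan (n := 2) (by simp)
    rwa [hr, ← direction_affineSpan] at this
  have h3 : Module.finrank ℝ (dirOf t)ᗮ = 1 := by
    have := (dirOf t).finrank_add_finrank_orthogonal
    rw [hfin] at this
    simp at this
    omega
  obtain ⟨⟨ν₀, hν₀⟩, hne, hsp⟩ := finrank_eq_one_iff'.1 h3
  have hne' : ν₀ ≠ 0 := fun h => hne (by simp [h])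
  have hn : 0 < ‖ν₀‖ := norm_pos_iff.2 hne'
  refine ⟨‖ν₀‖⁻¹ • ν₀, by rw [norm_smul, norm_inv, norm_norm, inv_mul_cancel₀ hn.ne'], ?_, ?_⟩
  · intro τ hτ
    rw [inner_smul_left, real_inner_comm, (dirOf t).mem_orthogonal ν₀ |>.1 hν₀ τ hτ, mul_zero]
  · intro v
    rw [← (dirOf t).orthogonal_orthogonal, Submodule.mem_orthogonal]
    intro w hw
    obtain ⟨c, hc⟩ := hsp ⟨w, hw⟩
    have hc' : c • ν₀ = w := congrArg Subtype.val hc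
    rw [← hc']
    simp only [inner_sub_right, inner_smul_left, inner_smul_right, real_inner_self_eq_norm_sq]
    simp
    field_simp
    ring

namespace GoodTri
variable {Srf : SmoothSurface} {Q : Tub Srf} {γ h : ℝ} {t : E3 × E3 × E3} (g : GoodTri Q γ h t)
include g

lemma nν {ν : E3} (h2 : ∀ τ ∈ dirOf t, ⟪ν, τ⟫ = 0) (h3 : ∀ v : E3, v - ⟪ν, v⟫ • ν ∈ dirOf t)
    {x : E3} (hx : x ∈ triOf t) : 1 / 2 ≤ |⟪ν, Srf.n (Q.a x)⟫| ∧
      ‖Srf.n (Q.a x) - ⟪ν, Srf.n (Q.a x)⟫ • ν‖ ≤ Q.K γ * h := by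
  have hn := Srf.n_unit _ (Q.a_mem x (g.mem hx))
  set n := Srf.n (Q.a x) with hndef
  set m := n - ⟪ν, n⟫ • ν with hm
  have hmd : m ∈ dirOf t := h3 n
  have e1 := g.G2' hx hmd
  rw [← hndef] at e1
  have e2 : ⟪n, m⟫ = ‖m‖ ^ 2 := by
    have : n = m + ⟪ν, n⟫ • ν := by rw [hm]; abel
    conv_lhs => rw [this]
    rw [inner_add_left, inner_smul_left, h2 m hmd, real_inner_self_eq_norm_sq]; simp
  have e3 : ‖m‖ ≤ Q.K γ * h := by
    rw [e2, abs_of_nonneg (by positivity)] at e1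
    by_contra hc
    push Not at hc
    have : 0 < ‖m‖ := lt_of_le_of_lt (by have := g.Kpos; have := g.h_pos; positivity) hc
    nlinarith
  have e4 : ⟪n, m⟫ = 1 - ⟪ν, n⟫ ^ 2 := by
    rw [hm, inner_sub_right, inner_smul_right, real_inner_self_eq_norm_sq, hn, real_inner_comm]; ring
  refine ⟨?_, e3⟩
  have e5 := g.Kh_le
  have e6 : ‖m‖ ^ 2 ≤ (1/4) ^ 2 := by gcongr; linarith
  rw [← Real.sqrt_sq (show (0:ℝ) ≤ 1 / 2 by norm_num), ← Real.sqrt_sq_eq_abs]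
  exact Real.sqrt_le_sqrt (by linarith)

lemma G6 {x : E3} (hx : x ∈ triOf t) {G g' : E3} (hG : ⟪Srf.n (Q.a x), G⟫ = 0) (hg : g' ∈ dirOf t)
    (he : ∀ τ ∈ dirOf t, ⟪g', τ⟫ = ⟪G, fderiv ℝ Q.a x τ⟫) : ‖g' - G‖ ≤ 3 * Q.K γ * h * ‖G‖ := by
  obtain ⟨ν, h1, h2, h3⟩ := exists_unit_normal g.indep
  obtain ⟨hn1, hn2⟩ := g.nν h2 h3 hx
  have hK := g.Kpos
  have hh := g.h_pos
  set n := Srf.n (Q.a x) with hndef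
  set w := g' - G with hw
  set m := w - ⟪ν, w⟫ • ν with hm
  have hmd : m ∈ dirOf t := h3 w
  have e1 : ‖m‖ ≤ Q.K γ * h * ‖G‖ := by
    have a1 : ⟪w, m⟫ = ‖m‖ ^ 2 := by
      have : w = m + ⟪ν, w⟫ • ν := by rw [hm]; abel
      conv_lhs => rw [this]
      rw [inner_add_left, inner_smul_left, h2 m hmd, real_inner_self_eq_norm_sq]; simp
    have a2 : ⟪w, m⟫ = ⟪G, fderiv ℝ Q.a x m - m⟫ := by
      have a0 : ⟪w, m⟫ = ⟪g', m⟫ - ⟪G, m⟫ := inner_sub_left _ _ _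
      rw [a0, he m hmd, inner_sub_right G (fderiv ℝ Q.a x m) m]
    have a3 := (real_inner_le_norm G (fderiv ℝ Q.a x m - m)).trans
      (mul_le_mul_of_nonneg_left (g.G3 hx hmd) (norm_nonneg _))
    by_contra hc
    push Not at hc
    have : 0 < ‖m‖ := lt_of_le_of_lt (by positivity) hc
    nlinarith
  have e2 : |⟪ν, w⟫| ≤ 2 * (Q.K γ * h * ‖G‖) := by
    have b1 : ⟪ν, w⟫ = - ⟪ν, G⟫ := by rw [hw, inner_sub_right, h2 g' hg]; ring
    have b2 : ⟪ν, n⟫ * ⟪ν, G⟫ = - ⟪n - ⟪ν, n⟫ • ν, G⟫ := by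
      rw [inner_sub_left, hG, inner_smul_left]; simp
    have b3 : |⟪ν, n⟫| * |⟪ν, G⟫| ≤ Q.K γ * h * ‖G‖ := by
      rw [← abs_mul, b2, abs_neg]
      exact (abs_real_inner_le_norm _ _).trans (by gcongr)
    rw [b1, abs_neg]
    nlinarith [abs_nonneg ⟪ν, G⟫]
  have e3 : w = m + ⟪ν, w⟫ • ν := by rw [hm]; abel
  rw [e3]
  refine (norm_add_le _ _).trans ?_
  rw [norm_smul, h1, mul_one, Real.norm_eq_abs]
  linarith

end GoodTri

lemma gradTri_mem (t : E3 × E3 × E3) (w : E3 → ℝ) (x : E3) : gradTri t w x ∈ dirOf t := by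
  unfold gradTri tGrad
  exact Submodule.coe_mem _

/-- Inverse of the projection on the plane through `p` with normal `ν`. -/
def kap (Srf : SmoothSurface) (ν p y : E3) : E3 := y + (⟪ν, p - y⟫ / ⟪ν, Srf.n y⟫) • Srf.n y

lemma kap_a {Srf : SmoothSurface} (Q : Tub Srf) {ν p z : E3} (hz : z ∈ Q.N) (hp : ⟪ν, z - p⟫ = 0)
    (hn : ⟪ν, Srf.n (Q.a z)⟫ ≠ 0) : kap Srf ν p (Q.a z) = z := by
  have h := Q.normal hz
  have h1 : ⟪ν, p - Q.a z⟫ = ⟪Srf.n (Q.a z), z - Q.a z⟫ * ⟪ν, Srf.n (Q.a z)⟫ := by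
    have : p - Q.a z = (z - Q.a z) - (z - p) := by abel
    rw [this, inner_sub_right, hp, sub_zero]
    conv_lhs => rw [h]
    rw [inner_smul_right]
  unfold kap
  rw [h1, mul_div_cancel_right₀ _ hn, ← h]; abel

lemma kap_smooth (Srf : SmoothSurface) {ν p y : E3} (hy : y ∈ Srf.S) (hn : ⟪ν, Srf.n y⟫ ≠ 0) :
    ContDiffAt ℝ (⊤ : ℕ∞) (kap Srf ν p) y := by
  obtain ⟨U, hU, hSU, hs⟩ := Srf.n_smooth
  have h1 : ContDiffAt ℝ (⊤ : ℕ∞) Srf.n y := hs.contDiffAt (hU.mem_nhds (hSU hy))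
  unfold kap
  have h2 : ContDiffAt ℝ (⊤ : ℕ∞) (fun y => ⟪ν, p - y⟫) y :=
    contDiffAt_const.inner ℝ (contDiffAt_const.sub contDiffAt_id)
  have h3 : ContDiffAt ℝ (⊤ : ℕ∞) (fun y => ⟪ν, Srf.n y⟫) y := contDiffAt_const.inner ℝ h1
  exact contDiffAt_id.add ((h2.div h3 hn).smul h1)

namespace GoodTri
variable {Srf : SmoothSurface} {Q : Tub Srf} {γ h : ℝ} {t : E3 × E3 × E3} (g : GoodTri Q γ h t)
include g

lemma gradTri_inner {w : E3 → ℝ} {L : E3 →ₗ[ℝ] ℝ} {c : ℝ} (hw : ∀ x ∈ triOf t, w x = L x + c)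
    {x : E3} (hx : x ∈ triOf t) {τ : E3} (hτ : τ ∈ dirOf t) : ⟪gradTri t w x, τ⟫ = L τ := by
  have hL : HasFDerivWithinAt w L.toContinuousLinearMap (triOf t) x := by
    have : HasFDerivAt (fun x => L.toContinuousLinearMap x + c) L.toContinuousLinearMap x :=
      L.toContinuousLinearMap.hasFDerivAt.add_const c
    exact this.hasFDerivWithinAt.congr hw (hw x hx)
  have hu := hL.differentiableWithinAt.hasFDerivWithinAt.unique_on hL
  set F := fderivWithin ℝ w (triOf t) x with hF
  have h1 : ∀ z ∈ triOf t, F (z - x) = L (z - x) := fun z hz =>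
    hu (mem_tangentConeAt_of_segment_subset ((tri_convex t).segment_subset hx hz))
  have h2 : F τ = L τ := by
    by_cases h0 : τ = 0
    · simp [h0]
    have hγ := g.γ_pos
    have hh := g.h_pos
    have hn : 0 < ‖τ‖ := norm_pos_iff.2 h0
    obtain ⟨y, hy, hd⟩ := g.disk
    have hy' : y + (γ * h / ‖τ‖) • τ ∈ triOf t := by
      refine hd ⟨?_, add_plane (tri_plane t hy) ((dirOf t).smul_mem _ hτ)⟩
      rw [mem_closedBall, dist_eq_norm, add_sub_cancel_left, norm_smul, Real.norm_eq_abs, abs_of_pos (by positivity),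
        div_mul_cancel₀ _ hn.ne']
    have a1 := h1 _ hy
    have a2 := h1 _ hy'
    rw [add_sub_right_comm, map_add, map_add, a1, map_smul, map_smul] at a2
    have a3 := add_left_cancel a2
    exact smul_right_injective ℝ (show γ * h / ‖τ‖ ≠ 0 by positivity) a3
  unfold gradTri tGrad
  have := Submodule.inner_orthogonalProjectionOnto_eq_of_mem_right (K := dirOf t) ⟨τ, hτ⟩
    ((InnerProductSpace.toDual ℝ E3).symm F)
  rw [← hF, ← h2]
  rw [Submodule.coe_inner] at this
  rw [real_inner_comm] at this
  rw [real_inner_comm]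
  exact this.trans InnerProductSpace.toDual_symm_apply

lemma lift_deriv {L : E3 →ₗ[ℝ] ℝ} {c : ℝ} {W : E3 → ℝ} {x : E3} (hx : x ∈ triOf t)
    (hW : ∀ᶠ z in nhds (Q.a x), ∃ x' ∈ triOf t, Q.a x' = Q.a z ∧ W z = L x' + c) :
    ContDiffAt ℝ (⊤ : ℕ∞) W (Q.a x) ∧ fderiv ℝ W (Q.a x) (Srf.n (Q.a x)) = 0 ∧
      ∀ τ ∈ dirOf t, fderiv ℝ W (Q.a x) (fderiv ℝ Q.a x τ) = L τ := by
  obtain ⟨ν, h1, h2, h3⟩ := exists_unit_normal g.indep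
  have hxN := g.mem hx
  have hyS := Q.a_mem x hxN
  have hyN := Q.memN hxN
  have hnz : ∀ z ∈ triOf t, ⟪ν, Srf.n (Q.a z)⟫ ≠ 0 := by
    intro z hz h0
    have := (g.nν h2 h3 hz).1
    rw [h0] at this; norm_num at this
  set y := Q.a x with hy
  set p := t.1 with hp
  have hpl := tri_plane t (vert_mem t (v1_mem t))
  set ℓ : E3 → ℝ := fun z => L.toContinuousLinearMap (kap Srf ν p z) + c with hℓ
  have hWe : W =ᶠ[nhds y] fun z => ℓ (Q.a z) := by
    filter_upwards [hW] with z ⟨x', hx', he, hw⟩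
    rw [hw, ← he, hℓ]
    simp only
    rw [kap_a Q (g.mem hx') (h2 _ (sub_dir (tri_plane t hx') hpl)) (hnz x' hx')]
    rfl
  have hℓs : ContDiffAt ℝ (⊤ : ℕ∞) ℓ y :=
    (L.toContinuousLinearMap.contDiff.contDiffAt.comp y (kap_smooth Srf hyS (hnz x hx))).add contDiffAt_const
  have hay : Q.a y = y := Q.fix hyS
  have hℓa : HasFDerivAt (fun z => ℓ (Q.a z)) ((fderiv ℝ ℓ y).comp (fderiv ℝ Q.a y)) y := by
    have e1 : HasFDerivAt ℓ (fderiv ℝ ℓ y) (Q.a y) := by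
      rw [hay]; exact (hℓs.differentiableAt (by simp)).hasFDerivAt
    exact e1.comp y (Q.diff hyN).hasFDerivAt
  have hDW : fderiv ℝ W y = (fderiv ℝ ℓ y).comp (fderiv ℝ Q.a y) := by
    rw [hWe.fderiv_eq, hℓa.fderiv]
  refine ⟨?_, ?_, ?_⟩
  · have e1 : ContDiffAt ℝ (⊤ : ℕ∞) ℓ (Q.a y) := by rw [hay]; exact hℓs
    exact (e1.comp y (Q.cda hyN)).congr_of_eventuallyEq hWe
  · rw [hDW, ContinuousLinearMap.comp_apply, Q.deriv_n hyS, map_zero]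
  · intro τ hτ
    rw [hDW, ContinuousLinearMap.comp_apply, hy, Q.deriv_comp hxN, ← hy]
    have e1 : HasDerivAt (fun s : ℝ => x + s • τ) τ 0 := by
      simpa using ((hasDerivAt_id (0:ℝ)).smul_const τ).const_add x
    have e0 : x + (0:ℝ) • τ = x := by simp
    have e2 : HasFDerivAt (fun z => ℓ (Q.a z)) ((fderiv ℝ ℓ y).comp (fderiv ℝ Q.a x)) (x + (0:ℝ) • τ) := by
      rw [e0]
      exact (hℓs.differentiableAt (by simp)).hasFDerivAt.comp x (Q.diff hxN).hasFDerivAt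
    have e3 : HasDerivAt (fun s : ℝ => ℓ (Q.a (x + s • τ))) (fderiv ℝ ℓ y (fderiv ℝ Q.a x τ)) 0 :=
      HasFDerivAt.comp_hasDerivAt (l := fun z => ℓ (Q.a z)) (l' := (fderiv ℝ ℓ y).comp (fderiv ℝ Q.a x)) (0:ℝ) e2 e1
    have e4 : HasDerivAt (fun s : ℝ => L.toContinuousLinearMap (x + s • τ) + c) (L.toContinuousLinearMap τ) 0 :=
      (L.toContinuousLinearMap.hasFDerivAt.comp_hasDerivAt (0:ℝ) e1).add_const c
    have hcont : Filter.Tendsto (fun s : ℝ => x + s • τ) (nhds 0) (nhds x) := by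
      have := e1.continuousAt.tendsto
      simpa using this
    have hnn : ∀ᶠ z in nhds x, ⟪ν, Srf.n (Q.a z)⟫ ≠ 0 := by
      obtain ⟨U, hU, hSU, hs⟩ := Srf.n_smooth
      have c1 : ContinuousAt Srf.n (Q.a x) := (hs.continuousOn.continuousAt (hU.mem_nhds (hSU hyS)))
      have c2 : ContinuousAt (fun z => ⟪ν, Srf.n (Q.a z)⟫) x :=
        continuousAt_const.inner (c1.comp (Q.diff hxN).continuousAt)
      exact c2.eventually_ne (hnz x hx)
    have e5 : (fun s : ℝ => ℓ (Q.a (x + s • τ))) =ᶠ[nhds 0] fun s : ℝ => L.toContinuousLinearMap (x + s • τ) + c := by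
      filter_upwards [hcont.eventually hnn, hcont.eventually (Q.nh hxN)] with s hs hsN
      simp only [hℓ]
      rw [kap_a Q hsN (h2 _ (sub_dir (add_plane (tri_plane t hx) ((dirOf t).smul_mem s hτ)) hpl)) hs]
    exact (e3.congr_of_eventuallyEq e5.symm).unique e4

lemma lift_grad {L : E3 →ₗ[ℝ] ℝ} {c : ℝ} {W w : E3 → ℝ} {x : E3} (hx : x ∈ triOf t)
    (hw : ∀ x ∈ triOf t, w x = L x + c)
    (hW : ∀ᶠ z in nhds (Q.a x), ∃ x' ∈ triOf t, Q.a x' = Q.a z ∧ W z = L x' + c) :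
    ‖gradTri t w x - gradient W (Q.a x)‖ ≤ 3 * Q.K γ * h * ‖gradient W (Q.a x)‖ := by
  obtain ⟨h1, h2, h3⟩ := g.lift_deriv hx hW
  have e : ∀ v, ⟪gradient W (Q.a x), v⟫ = fderiv ℝ W (Q.a x) v := fun v => by
    rw [gradient, InnerProductSpace.toDual_symm_apply]
  refine g.G6 hx ?_ (gradTri_mem t w x) fun τ hτ => ?_
  · rw [real_inner_comm, e, h2]
  · rw [e, h3 τ hτ, g.gradTri_inner hw hx hτ]

end GoodTri

namespace GoodTri
variable {Srf : SmoothSurface} {Q : Tub Srf} {γ h : ℝ} {t : E3 × E3 × E3} (g : GoodTri Q γ h t)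
include g

lemma Kh0 : 0 < Q.K γ * h := mul_pos g.Kpos g.h_pos

lemma contA : ContinuousOn Q.a (triOf t) := fun _ hx => (Q.diff (g.mem hx)).continuousAt.continuousWithinAt

lemma img_le (A : Set E3) (hA : A ⊆ triOf t) :
    μH[2] (Q.a '' A) ≤ ((1 + 2 * (Q.K γ * h)).toNNReal : ℝ≥0∞) ^ 2 * μH[2] A := by
  have hk := g.Kh0
  have := haus_image_le Q.a id A (1 + 2 * (Q.K γ * h)).toNNReal (fun x hx x' hx' => by
    have h4 := g.G4 (hA hx) (hA hx')
    rw [edist_nndist, edist_nndist, ← ENNReal.coe_mul, ENNReal.coe_le_coe, ← NNReal.coe_le_coe]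
    push_cast
    rw [Real.coe_toNNReal _ (by linarith), dist_eq_norm, dist_eq_norm]
    have h5 := norm_le_norm_add_norm_sub' (Q.a x - Q.a x') (x - x')
    simp only [id]
    nlinarith [norm_nonneg (x - x')])
  simpa using this

lemma img_ge (A : Set E3) (hA : A ⊆ triOf t) :
    μH[2] A ≤ ((1 + 2 * (Q.K γ * h)).toNNReal : ℝ≥0∞) ^ 2 * μH[2] (Q.a '' A) := by
  have hk := g.Kh0
  have := haus_image_le id Q.a A (1 + 2 * (Q.K γ * h)).toNNReal (fun x hx x' hx' => by
    have h4 := g.G4 (hA hx) (hA hx')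
    have hq := g.Kh_le
    rw [edist_nndist, edist_nndist, ← ENNReal.coe_mul, ENNReal.coe_le_coe, ← NNReal.coe_le_coe]
    push_cast
    rw [Real.coe_toNNReal _ (by linarith), dist_eq_norm, dist_eq_norm]
    have h5 := norm_le_norm_add_norm_sub (Q.a x - Q.a x') (x - x')
    simp only [id]
    set p := ‖x - x'‖ with hp
    set q := ‖Q.a x - Q.a x'‖
    set k := Q.K γ * h
    have hp0 : 0 ≤ p := norm_nonneg _
    have h6 : (1 - k) * p ≤ q := by linarith
    nlinarith [mul_nonneg hk.le hp0, mul_nonneg (mul_nonneg hk.le hp0) (sub_nonneg.2 hq)])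
  simpa using this

end GoodTri

lemma seg_null (v w : E3) : μH[2] (segment ℝ v w) = 0 := by
  rcases Measure.hausdorffMeasure_zero_or_top (d₁ := 1) (d₂ := 2) (by norm_num) (segment ℝ v w) with h | h
  · exact h
  · rw [hausdorffMeasure_segment] at h
    exact absurd h (edist_ne_top _ _)

namespace Triangulation
variable {Srf : SmoothSurface} {γ h : ℝ} (Tr : Triangulation Srf γ h)

lemma good (Q : Tub Srf) (hγ : 0 < γ) (hh : 0 < h) (hδ : h ≤ Q.δ) (hK : Q.K γ * h ≤ 1 / 4) :
    ∀ t ∈ Tr.T, GoodTri Q γ h t := fun t ht =>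
  ⟨hγ, hh, hδ, hK, Tr.indep t ht, Tr.verts_on t ht, Tr.diam_le t ht, Tr.disk t ht⟩

lemma mem_Sh {x : E3} : x ∈ Tr.Sh ↔ ∃ t ∈ Tr.T, x ∈ triOf t := by simp [Sh]

lemma Sh_compact : IsCompact Tr.Sh := Tr.T.isCompact_biUnion fun t _ => tri_compact t

lemma inter_null {t t' : E3 × E3 × E3} (ht : t ∈ Tr.T) (ht' : t' ∈ Tr.T) (hn : t ≠ t') :
    μH[2] (triOf t ∩ triOf t') = 0 := by
  rcases Tr.meet t ht t' ht' hn with h | ⟨v, _, h⟩ | ⟨v, w, _, _, _, h⟩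
  · simp [h]
  · rw [h, ← segment_same ℝ v]; exact seg_null _ _
  · rw [h]; exact seg_null _ _

/-- The inverse of the projection on the polyhedral surface. -/
def inv (y : E3) : E3 := Function.invFunOn Tr.a Tr.Sh y

variable {Q : Tub Srf} (hg : ∀ t ∈ Tr.T, GoodTri Q γ h t)
include hg

lemma ShN {x : E3} (hx : x ∈ Tr.Sh) : x ∈ Q.N := by
  obtain ⟨t, ht, hx⟩ := Tr.mem_Sh.1 hx
  exact (hg t ht).mem hx

lemma aeq {x : E3} (hx : x ∈ Tr.Sh) : Tr.a x = Q.a x :=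
  PJ.agree Q.toPJ Tr.toPJ (Tr.ShN hg hx) (Tr.Sh_sub hx)

lemma bij : Set.BijOn Q.a Tr.Sh Srf.S := Tr.a_bij.congr fun _ hx => Tr.aeq hg hx

lemma inv_mem {y : E3} (hy : y ∈ Srf.S) : Tr.inv y ∈ Tr.Sh :=
  Function.invFunOn_mem (Tr.a_bij.surjOn hy)

lemma a_inv {y : E3} (hy : y ∈ Srf.S) : Q.a (Tr.inv y) = y := by
  rw [← Tr.aeq hg (Tr.inv_mem hg hy)]
  exact Function.invFunOn_eq (Tr.a_bij.surjOn hy)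

lemma inv_a {x : E3} (hx : x ∈ Tr.Sh) : Tr.inv (Q.a x) = x :=
  (Tr.bij hg).injOn (Tr.inv_mem hg ((Tr.bij hg).mapsTo hx)) hx (Tr.a_inv hg ((Tr.bij hg).mapsTo hx))

lemma contA : ContinuousOn Q.a Tr.Sh := fun _ hx => (Q.diff (Tr.ShN hg hx)).continuousAt.continuousWithinAt

lemma inv_cont : ContinuousOn Tr.inv Srf.S := by
  rw [continuousOn_iff_isClosed]
  intro F hF
  refine ⟨Q.a '' (Tr.Sh ∩ F), ((Tr.Sh_compact.inter_right hF).image_of_continuousOn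
    ((Tr.contA hg).mono Set.inter_subset_left)).isClosed, ?_⟩
  ext y
  constructor
  · rintro ⟨hy, hyS⟩
    exact ⟨⟨Tr.inv y, ⟨Tr.inv_mem hg hyS, hy⟩, Tr.a_inv hg hyS⟩, hyS⟩
  · rintro ⟨⟨x, ⟨hx, hxF⟩, rfl⟩, hyS⟩
    refine ⟨?_, hyS⟩
    show Tr.inv (Q.a x) ∈ F
    rwa [Tr.inv_a hg hx]

omit hg in
/-- Points of the surface only covered by `t`. -/
def O (Q : Tub Srf) (t : E3 × E3 × E3) : Set E3 := Srf.S \ ⋃ t' ∈ Tr.T, ⋃ _ : t' ≠ t, Q.a '' triOf t'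

lemma O_tri {t : E3 × E3 × E3} {y : E3} (hy : y ∈ Tr.O Q t) : Tr.inv y ∈ triOf t ∧ t ∈ Tr.T := by
  obtain ⟨hyS, hn⟩ := hy
  obtain ⟨t', ht', hx⟩ := Tr.mem_Sh.1 (Tr.inv_mem hg hyS)
  by_cases he : t' = t
  · exact he ▸ ⟨hx, ht'⟩
  · exact absurd (by simp only [Set.mem_iUnion]; exact ⟨t', ht', he, _, hx, Tr.a_inv hg hyS⟩) hn

lemma O_closed (t : E3 × E3 × E3) : IsClosed (⋃ t' ∈ Tr.T, ⋃ _ : t' ≠ t, Q.a '' triOf t') :=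
  Tr.T.finite_toSet.isClosed_biUnion fun t' ht' => isClosed_iUnion_of_finite fun _ =>
    ((tri_compact t').image_of_continuousOn ((hg t' ht').contA)).isClosed

lemma O_ev {t : E3 × E3 × E3} {y : E3} (hy : y ∈ Tr.O Q t) : ∀ᶠ z in nhds y, Q.a z ∈ Tr.O Q t := by
  have hyN := Q.S_sub hy.1
  have hc := (Q.diff hyN).continuousAt
  have : (⋃ t' ∈ Tr.T, ⋃ _ : t' ≠ t, Q.a '' triOf t')ᶜ ∈ nhds (Q.a y) := by
    rw [Q.fix hy.1]
    exact (Tr.O_closed hg t).isOpen_compl.mem_nhds hy.2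
  filter_upwards [hc this, Q.nh hyN] with z hz hzN using ⟨Q.a_mem z hzN, hz⟩

omit hg in
/-- Normal extension of the lift of a function on the polyhedral surface. -/
def hat (Q : Tub Srf) (φ : E3 → ℝ) : E3 → ℝ := fun z => Tr.liftS φ (Q.a z)

lemma hat_S {φ : E3 → ℝ} {y : E3} (hy : y ∈ Srf.S) : Tr.hat Q φ y = φ (Tr.inv y) := by
  simp only [hat, liftS, Q.fix hy]; rfl

lemma hat_a {φ : E3 → ℝ} {x : E3} (hx : x ∈ Tr.Sh) : Tr.hat Q φ (Q.a x) = φ x := by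
  rw [Tr.hat_S hg ((Tr.bij hg).mapsTo hx), Tr.inv_a hg hx]

lemma hat_ev {φ : E3 → ℝ} {t : E3 × E3 × E3} {L : E3 →ₗ[ℝ] ℝ} {c : ℝ} (hφ : ∀ x ∈ triOf t, φ x = L x + c)
    {y : E3} (hy : y ∈ Tr.O Q t) :
    ∀ᶠ z in nhds y, ∃ x' ∈ triOf t, Q.a x' = Q.a z ∧ Tr.hat Q φ z = L x' + c := by
  filter_upwards [Tr.O_ev hg hy] with z hz
  exact ⟨Tr.inv (Q.a z), (Tr.O_tri hg hz).1, Tr.a_inv hg hz.1, hφ _ (Tr.O_tri hg hz).1⟩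

lemma img_null {t t' : E3 × E3 × E3} (ht : t ∈ Tr.T) (ht' : t' ∈ Tr.T) (hn : t ≠ t') :
    μH[2] (Q.a '' triOf t ∩ Q.a '' triOf t') = 0 := by
  have he : Q.a '' triOf t ∩ Q.a '' triOf t' ⊆ Q.a '' (triOf t ∩ triOf t') := by
    rintro _ ⟨⟨x, hx, rfl⟩, ⟨x', hx', he⟩⟩
    have := (Tr.bij hg).injOn (Tr.mem_Sh.2 ⟨t', ht', hx'⟩) (Tr.mem_Sh.2 ⟨t, ht, hx⟩) he
    exact ⟨x, ⟨hx, this ▸ hx'⟩, rfl⟩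
  refine measure_mono_null he (le_antisymm (((hg t ht).img_le _ Set.inter_subset_left).trans ?_) zero_le)
  rw [Tr.inter_null ht ht' hn, mul_zero]

/-- Almost every point of a triangle projects to a point only covered by that triangle. -/
lemma ae_tri {t : E3 × E3 × E3} (ht : t ∈ Tr.T) :
    ∀ᵐ x ∂(μH[2] : Measure E3).restrict (triOf t), Q.a x ∈ Tr.O Q t := by
  rw [ae_restrict_iff' (tri_measurable t)]
  have : ∀ t' ∈ Tr.T, ∀ᵐ x ∂(μH[2] : Measure E3), t' ≠ t → x ∉ triOf t ∩ triOf t' := by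
    intro t' ht'
    by_cases hn : t' = t
    · simp [hn]
    · have := measure_eq_zero_iff_ae_notMem.1 (Tr.inter_null ht ht' (Ne.symm hn))
      filter_upwards [this] with x hx _ using hx
  filter_upwards [(ae_ball_iff Tr.T.countable_toSet).2 this] with x hx hxt
  have hxS := Tr.mem_Sh.2 ⟨t, ht, hxt⟩
  refine ⟨(Tr.bij hg).mapsTo hxS, ?_⟩
  simp only [Set.mem_iUnion, not_exists]
  rintro t' ht' hn ⟨x', hx', he⟩
  have := (Tr.bij hg).injOn (Tr.mem_Sh.2 ⟨t', ht', hx'⟩) hxS he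
  exact hx t' ht' hn ⟨hxt, this ▸ hx'⟩

lemma cover : Srf.S = ⋃ t ∈ Tr.T, Q.a '' triOf t := by
  rw [← (Tr.bij hg).image_eq, Sh, Set.image_iUnion₂]

omit hg in
/-- Push-forward of the polyhedral surface measure. -/
def ν (Q : Tub Srf) : Measure E3 := ∑ t ∈ Tr.T, Measure.map Q.a ((μH[2] : Measure E3).restrict (triOf t))

lemma aem {t : E3 × E3 × E3} (ht : t ∈ Tr.T) : AEMeasurable Q.a ((μH[2] : Measure E3).restrict (triOf t)) :=
  ((hg t ht).contA).aemeasurable (tri_measurable t)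

lemma ν_apply {B : Set E3} (hB : MeasurableSet B) : Tr.ν Q B = ∑ t ∈ Tr.T, μH[2] (Q.a ⁻¹' B ∩ triOf t) := by
  simp only [ν, Measure.coe_finsetSum, Finset.sum_apply]
  refine Finset.sum_congr rfl fun t ht => ?_
  rw [Measure.map_apply_of_aemeasurable (Tr.aem hg ht) hB, Measure.restrict_apply' (tri_measurable t)]

omit hg in
/-- Density bound. -/
def κ (Q : Tub Srf) (γ h : ℝ) : ℝ≥0 := (1 + 2 * (Q.K γ * h)).toNNReal ^ 2

lemma img_pre (t : E3 × E3 × E3) (B : Set E3) : Q.a '' (Q.a ⁻¹' B ∩ triOf t) = B ∩ Q.a '' triOf t := by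
  rw [Set.inter_comm, Set.image_inter_preimage, Set.inter_comm]

lemma μ_le_ν : Srf.μ ≤ κ Q γ h • Tr.ν Q := by
  refine Measure.le_iff.2 fun B hB => ?_
  rw [Measure.restrict_apply hB, Measure.smul_apply, Tr.ν_apply hg hB]
  have : B ∩ Srf.S = ⋃ t ∈ Tr.T, Q.a '' (Q.a ⁻¹' B ∩ triOf t) := by
    conv_lhs => rw [Tr.cover hg, Set.inter_iUnion₂]
    simp_rw [Tr.img_pre hg]
  rw [this, ENNReal.smul_def, smul_eq_mul, Finset.mul_sum]
  refine (measure_biUnion_finset_le _ _).trans (Finset.sum_le_sum fun t ht => ?_)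
  refine ((hg t ht).img_le _ Set.inter_subset_right).trans (le_of_eq ?_)
  rw [κ]; push_cast; rfl

lemma ν_le_μ : Tr.ν Q ≤ κ Q γ h • Srf.μ := by
  refine Measure.le_iff.2 fun B hB => ?_
  rw [Measure.smul_apply, Measure.restrict_apply hB, Tr.ν_apply hg hB]
  have : B ∩ Srf.S = ⋃ t ∈ Tr.T, (B ∩ Q.a '' triOf t) := by
    conv_lhs => rw [Tr.cover hg, Set.inter_iUnion₂]
  have hm : ∀ t ∈ Tr.T, NullMeasurableSet (B ∩ Q.a '' triOf t) (μH[2] : Measure E3) := fun t ht =>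
    (hB.inter (((tri_compact t).image_of_continuousOn ((hg t ht).contA)).measurableSet)).nullMeasurableSet
  have hd : (Tr.T : Set (E3 × E3 × E3)).Pairwise
      (Function.onFun (AEDisjoint (μH[2] : Measure E3)) fun t => B ∩ Q.a '' triOf t) := by
    intro t ht t' ht' hn
    show μH[2] ((B ∩ Q.a '' triOf t) ∩ (B ∩ Q.a '' triOf t')) = 0
    refine measure_mono_null ?_ (Tr.img_null hg ht ht' hn)
    exact fun x hx => ⟨hx.1.2, hx.2.2⟩
  rw [this, measure_biUnion_finset₀ hd hm, ENNReal.smul_def, smul_eq_mul, Finset.mul_sum]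
  refine Finset.sum_le_sum fun t ht => ?_
  refine ((hg t ht).img_ge _ Set.inter_subset_right).trans (le_of_eq ?_)
  rw [κ, Tr.img_pre hg]; push_cast; rfl

end Triangulation

lemma tri_fin (t : E3 × E3 × E3) : μH[2] (triOf t) < ⊤ := by
  set A : H2 →L[ℝ] E3 := (EuclideanSpace.proj 0 : H2 →L[ℝ] ℝ).smulRight (t.2.1 - t.1) +
    (EuclideanSpace.proj 1 : H2 →L[ℝ] ℝ).smulRight (t.2.2 - t.1) with hA
  have hL : LipschitzWith ‖A‖₊ (fun p => t.1 + A p) :=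
    fun p q => by
      simpa [edist_add_left] using A.lipschitz p q
  have hAe : ∀ p : H2, A p = p 0 • (t.2.1 - t.1) + p 1 • (t.2.2 - t.1) := fun p => by simp [hA]
  have hsub : triOf t ⊆ (fun p => t.1 + A p) '' closedBall (0 : H2) 2 := by
    refine convexHull_min ?_ ?_
    · intro v hv
      simp only [Set.mem_insert_iff, Set.mem_singleton_iff] at hv
      rcases hv with rfl | rfl | rfl
      · exact ⟨0, by simp, by simp⟩
      · exact ⟨!₂[1, 0], by simp [EuclideanSpace.norm_eq], by simp [hAe]⟩
      · exact ⟨!₂[0, 1], by simp [EuclideanSpace.norm_eq], by simp [hAe]⟩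
    · have h1 := ((convex_closedBall (0:H2) 2).linear_image A.toLinearMap).vadd t.1
      convert h1 using 1
      ext z
      simp [Set.mem_vadd_set]
  have h2 := hL.hausdorffMeasure_image_le (d := 2) (by norm_num) (closedBall (0:H2) 2)
  refine (measure_mono hsub).trans_lt (h2.trans_lt ?_)
  refine ENNReal.mul_lt_top (by simp) (isCompact_closedBall (0:H2) 2).measure_lt_top

lemma cmp_pos {μ ν : Measure E3} {k : ℝ≥0} (h2 : ν ≤ k • μ) {F : E3 → ℝ} (h0 : ∀ x, 0 ≤ F x) (hF : Integrable F μ) :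
    ∫ x, F x ∂ν ≤ k * ∫ x, F x ∂μ := by
  have := integral_mono_measure h2 (Filter.Eventually.of_forall h0) (hF.smul_measure_nnreal (c := k))
  rwa [integral_smul_nnreal_measure, NNReal.smul_def, smul_eq_mul] at this

lemma int_cmp {μ ν : Measure E3} {k : ℝ≥0} (h2 : ν ≤ k • μ) {F : E3 → ℝ} (hF : Integrable F μ) : Integrable F ν :=
  Integrable.mono_measure (hF.smul_measure_nnreal (c := k)) h2

lemma meas_cmp {μ ν : Measure E3} {k : ℝ≥0} (hk : 1 ≤ k) (h1 : μ ≤ k • ν) (h2 : ν ≤ k • μ) {F : E3 → ℝ}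
    (hF : Integrable F μ) : |∫ x, F x ∂ν - ∫ x, F x ∂μ| ≤ (k - 1) * ∫ x, |F x| ∂μ := by
  have hk' : (1:ℝ) ≤ k := by exact_mod_cast hk
  have key : ∀ G : E3 → ℝ, (∀ x, 0 ≤ G x) → Integrable G μ →
      |∫ x, G x ∂ν - ∫ x, G x ∂μ| ≤ (k - 1) * ∫ x, G x ∂μ := by
    intro G h0 hG
    have a1 := cmp_pos h2 h0 hG
    have a2 := cmp_pos h1 h0 (int_cmp h2 hG)
    have a3 : 0 ≤ ∫ x, G x ∂μ := integral_nonneg h0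
    have a4 : 0 ≤ ∫ x, G x ∂ν := integral_nonneg h0
    rw [abs_le]
    constructor <;> nlinarith
  have hp := key (fun x => max (F x) 0) (fun x => le_max_right _ _) hF.pos_part
  have hn := key (fun x => max (-F x) 0) (fun x => le_max_right _ _) hF.neg_part
  have hFν := int_cmp h2 hF
  have e : ∀ x, F x = max (F x) 0 - max (-F x) 0 := fun x => by
    rcases le_total 0 (F x) with h | h <;> simp [h]
  have e' : ∀ x, |F x| = max (F x) 0 + max (-F x) 0 := fun x => by
    rcases le_total 0 (F x) with h | h <;> simp [h, abs_of_nonneg, abs_of_nonpos]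
  have i1 : ∫ x, F x ∂ν = ∫ x, max (F x) 0 ∂ν - ∫ x, max (-F x) 0 ∂ν := by
    rw [← integral_sub hFν.pos_part hFν.neg_part]; exact integral_congr_ae (.of_forall e)
  have i2 : ∫ x, F x ∂μ = ∫ x, max (F x) 0 ∂μ - ∫ x, max (-F x) 0 ∂μ := by
    rw [← integral_sub hF.pos_part hF.neg_part]; exact integral_congr_ae (.of_forall e)
  have i3 : ∫ x, |F x| ∂μ = ∫ x, max (F x) 0 ∂μ + ∫ x, max (-F x) 0 ∂μ := by
    rw [← integral_add hF.pos_part hF.neg_part]; exact integral_congr_ae (.of_forall e')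
  rw [i1, i2, i3]
  rw [abs_le] at *
  constructor <;> nlinarith [hp.1, hp.2, hn.1, hn.2]

namespace Triangulation
variable {Srf : SmoothSurface} {γ h : ℝ} (Tr : Triangulation Srf γ h)
variable {Q : Tub Srf} (hg : ∀ t ∈ Tr.T, GoodTri Q γ h t)
include hg

lemma S_fin : μH[2] Srf.S < ⊤ := by
  rw [Tr.cover hg]
  refine (measure_biUnion_finset_le _ _).trans_lt (ENNReal.sum_lt_top.2 fun t ht => ?_)
  refine ((hg t ht).img_le _ subset_rfl).trans_lt (ENNReal.mul_lt_top ?_ (tri_fin t))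
  exact ENNReal.pow_lt_top (by simp)

lemma κ_one : 1 ≤ κ Q γ h := by
  obtain ⟨t, ht⟩ := Tr.T_nonempty
  have := (hg t ht).Kh0
  unfold κ
  refine one_le_pow₀ ?_
  rw [Real.one_le_toNNReal]; linarith

lemma κ_le : (κ Q γ h : ℝ) - 1 ≤ 5 * (Q.K γ * h) ∧ (κ Q γ h : ℝ) ≤ 9 / 4 := by
  obtain ⟨t, ht⟩ := Tr.T_nonempty
  have := (hg t ht).Kh0
  have h2 := (hg t ht).Kh_le
  unfold κ
  push_cast
  rw [Real.coe_toNNReal _ (by linarith)]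
  constructor <;> nlinarith

lemma ae_O : ∀ᵐ y ∂Srf.μ, ∃ t ∈ Tr.T, y ∈ Tr.O Q t := by
  rw [ae_restrict_iff' Srf.measS]
  have : ∀ t ∈ Tr.T, ∀ t' ∈ Tr.T, ∀ᵐ x ∂(μH[2] : Measure E3), t' ≠ t → x ∉ Q.a '' triOf t ∩ Q.a '' triOf t' := by
    intro t ht t' ht'
    by_cases hn : t' = t
    · simp [hn]
    · have := measure_eq_zero_iff_ae_notMem.1 (Tr.img_null hg ht ht' (Ne.symm hn))
      filter_upwards [this] with x hx _ using hx
  have h2 : ∀ᵐ x ∂(μH[2] : Measure E3), ∀ t ∈ Tr.T, ∀ t' ∈ Tr.T, t' ≠ t → x ∉ Q.a '' triOf t ∩ Q.a '' triOf t' :=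
    (ae_ball_iff Tr.T.countable_toSet).2 fun t ht => (ae_ball_iff Tr.T.countable_toSet).2 fun t' ht' => this t ht t' ht'
  filter_upwards [h2] with y hy hyS
  have hc := hyS
  rw [Tr.cover hg] at hc
  simp only [Set.mem_iUnion] at hc
  obtain ⟨t, ht, hyt⟩ := hc
  refine ⟨t, ht, hyS, ?_⟩
  simp only [Set.mem_iUnion, not_exists]
  exact fun t' ht' hn hy' => hy t ht t' ht' hn ⟨hyt, hy'⟩

lemma aesm {F : E3 → ℝ} (hF : Integrable F Srf.μ) {t : E3 × E3 × E3} (ht : t ∈ Tr.T) :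
    Integrable F (Measure.map Q.a ((μH[2] : Measure E3).restrict (triOf t))) := by
  have h1 := int_cmp (Tr.ν_le_μ hg) hF
  unfold ν at h1
  exact (integrable_finsetSum_measure.1 h1) t ht

lemma int_tri {F : E3 → ℝ} (hF : Integrable F Srf.μ) {t : E3 × E3 × E3} (ht : t ∈ Tr.T) :
    IntegrableOn (fun x => F (Q.a x)) (triOf t) μH[2] :=
  (Tr.aesm hg hF ht).comp_aemeasurable (Tr.aem hg ht)

lemma int_ν {F : E3 → ℝ} (hF : Integrable F Srf.μ) :
    ∫ y, F y ∂Tr.ν Q = ∑ t ∈ Tr.T, ∫ x in triOf t, F (Q.a x) ∂μH[2] := by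
  unfold ν
  rw [integral_finsetSum_measure fun t ht => Tr.aesm hg hF ht]
  exact Finset.sum_congr rfl fun t ht => integral_map (Tr.aem hg ht) (Tr.aesm hg hF ht).1

lemma sum_Sh : (μH[2] : Measure E3).restrict Tr.Sh = ∑ t ∈ Tr.T, (μH[2] : Measure E3).restrict (triOf t) := by
  ext B hB
  rw [Measure.restrict_apply hB, Measure.coe_finsetSum, Finset.sum_apply]
  have : B ∩ Tr.Sh = ⋃ t ∈ Tr.T, (B ∩ triOf t) := by rw [Sh, Set.inter_iUnion₂]
  have hd : (Tr.T : Set (E3 × E3 × E3)).Pairwise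
      (Function.onFun (AEDisjoint (μH[2] : Measure E3)) fun t => B ∩ triOf t) := by
    intro t ht t' ht' hn
    show μH[2] ((B ∩ triOf t) ∩ (B ∩ triOf t')) = 0
    refine measure_mono_null ?_ (Tr.inter_null ht ht' hn)
    exact fun x hx => ⟨hx.1.2, hx.2.2⟩
  rw [this, measure_biUnion_finset₀ hd fun t _ => (hB.inter (tri_measurable t)).nullMeasurableSet]
  exact Finset.sum_congr rfl fun t _ => (Measure.restrict_apply hB).symm

lemma int_Sh {F : E3 → ℝ} {G : E3 → ℝ} (hF : Integrable F Srf.μ) (he : ∀ x ∈ Tr.Sh, G x = F (Q.a x)) :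
    ∫ x in Tr.Sh, G x ∂μH[2] = ∫ y, F y ∂Tr.ν Q := by
  rw [Tr.int_ν hg hF, setIntegral_congr_fun Tr.Sh_compact.measurableSet he, Tr.sum_Sh hg,
    integral_finsetSum_measure fun t ht => Tr.int_tri hg hF ht]

lemma hat_cont {φ : E3 → ℝ} (hφ : ContinuousOn φ Tr.Sh) : ContinuousOn (Tr.hat Q φ) Srf.S :=
  (hφ.comp (Tr.inv_cont hg) fun _ hy => Tr.inv_mem hg hy).congr fun _ hy => Tr.hat_S hg hy

omit hg in
lemma grad_meas (w : E3 → ℝ) : Measurable (gradient w) :=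
  (InnerProductSpace.toDual ℝ E3).symm.continuous.measurable.comp (measurable_fderiv ℝ w)

lemma near_tri {φ : E3 → ℝ} (hφ : Tr.IsVh φ) {t : E3 × E3 × E3} (ht : t ∈ Tr.T) {x : E3} (hx : x ∈ triOf t)
    (hO : Q.a x ∈ Tr.O Q t) :
    ‖gradTri t φ x - gradient (Tr.hat Q φ) (Q.a x)‖ ≤ 3 * Q.K γ * h * ‖gradient (Tr.hat Q φ) (Q.a x)‖ := by
  obtain ⟨L, c, hL⟩ := hφ.2 t ht
  exact (hg t ht).lift_grad hx hL (Tr.hat_ev hg hL hO)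

lemma hat_smooth {φ : E3 → ℝ} (hφ : Tr.IsVh φ) {t : E3 × E3 × E3} (ht : t ∈ Tr.T) {y : E3} (hO : y ∈ Tr.O Q t) :
    ContDiffAt ℝ (⊤ : ℕ∞) (Tr.hat Q φ) y := by
  obtain ⟨L, c, hL⟩ := hφ.2 t ht
  have h1 := Tr.a_inv hg hO.1
  have := (hg t ht).lift_deriv (Tr.O_tri hg hO).1 (L := L) (c := c) (W := Tr.hat Q φ) (by
    rw [h1]; exact Tr.hat_ev hg hL hO)
  rw [h1] at this
  exact this.1

lemma gradTri_const {φ : E3 → ℝ} (hφ : Tr.IsVh φ) {t : E3 × E3 × E3} (ht : t ∈ Tr.T) :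
    ∃ e : E3, ∀ x ∈ triOf t, gradTri t φ x = e := by
  obtain ⟨L, c, hL⟩ := hφ.2 t ht
  refine ⟨gradTri t φ t.1, fun x hx => ?_⟩
  have h1 := vert_mem t (v1_mem t)
  have hm := (dirOf t).sub_mem (gradTri_mem t φ x) (gradTri_mem t φ t.1)
  have : ⟪gradTri t φ x - gradTri t φ t.1, gradTri t φ x - gradTri t φ t.1⟫ = 0 := by
    conv_lhs => rw [inner_sub_left]
    rw [(hg t ht).gradTri_inner hL hx hm, (hg t ht).gradTri_inner hL h1 hm, sub_self]
  exact sub_eq_zero.1 (inner_self_eq_zero.1 this)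

lemma grad_bdd {φ : E3 → ℝ} (hφ : Tr.IsVh φ) : ∃ M : ℝ, 0 ≤ M ∧ ∀ t ∈ Tr.T, ∀ y ∈ Tr.O Q t,
    ‖gradient (Tr.hat Q φ) y‖ ≤ M := by
  choose! e he using fun t ht => Tr.gradTri_const hg hφ (t := t) ht
  refine ⟨∑ t ∈ Tr.T, 4 * ‖e t‖, by positivity, fun t ht y hy => ?_⟩
  have h1 := Tr.a_inv hg hy.1
  have hx := (Tr.O_tri hg hy).1
  have h2 := Tr.near_tri hg hφ ht hx (by rw [h1]; exact hy)
  rw [h1, he t ht _ hx] at h2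
  have h3 := norm_le_norm_add_norm_sub (e t) (gradient (Tr.hat Q φ) y)
  have h4 := (hg t ht).Kh_le
  have h5 : 3 * Q.K γ * h * ‖gradient (Tr.hat Q φ) y‖ ≤ 3 / 4 * ‖gradient (Tr.hat Q φ) y‖ := by
    gcongr; linarith
  have h6 : ‖gradient (Tr.hat Q φ) y‖ ≤ 4 * ‖e t‖ := by linarith
  exact h6.trans (Finset.single_le_sum (f := fun t => 4 * ‖e t‖) (fun t _ => by positivity) ht)

end Triangulation

/-- Functions that are admissible in the energy forms. -/
structure Reg (Srf : SmoothSurface) (w : E3 → ℝ) : Prop where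
  cont : ContinuousOn w Srf.S
  bdd : ∃ M : ℝ, ∀ᵐ y ∂Srf.μ, ‖gradient w y‖ ≤ M
  diff : ∀ᵐ y ∂Srf.μ, DifferentiableAt ℝ w y

/-- Squared energy norm. -/
def NN (Srf : SmoothSurface) (w : E3 → ℝ) : ℝ := ∫ y, (w y ^ 2 + ‖gradient w y‖ ^ 2) ∂Srf.μ

/-- Energy form. -/
def BB (Srf : SmoothSurface) (v w : E3 → ℝ) : ℝ := ∫ y, (⟪gradient v y, gradient w y⟫ + v y * w y) ∂Srf.μ

lemma gradient_sub' {v w : E3 → ℝ} {y : E3} (hv : DifferentiableAt ℝ v y) (hw : DifferentiableAt ℝ w y) :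
    gradient (fun z => v z - w z) y = gradient v y - gradient w y := by
  simp only [gradient]
  rw [fderiv_fun_sub hv hw, map_sub]

namespace Reg
variable {Srf : SmoothSurface} {v w : E3 → ℝ}

lemma sub (hv : Reg Srf v) (hw : Reg Srf w) : Reg Srf (fun z => v z - w z) := by
  obtain ⟨M, hM⟩ := hv.bdd
  obtain ⟨M', hM'⟩ := hw.bdd
  refine ⟨hv.cont.sub hw.cont, ⟨M + M', ?_⟩, ?_⟩
  · filter_upwards [hM, hM', hv.diff, hw.diff] with y h1 h2 h3 h4
    rw [gradient_sub' h3 h4]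
    exact (norm_sub_le _ _).trans (add_le_add h1 h2)
  · filter_upwards [hv.diff, hw.diff] with y h3 h4 using h3.sub h4

lemma gm (w : E3 → ℝ) : Measurable (gradient w) := Triangulation.grad_meas w

variable (hfin : μH[2] Srf.S < ⊤)
include hfin

lemma int_mul (hv : Reg Srf v) (hw : Reg Srf w) : Integrable (fun y => v y * w y) Srf.μ :=
  Srf.int_cont hfin (hv.cont.mul hw.cont)

lemma int_abs (hv : Reg Srf v) (hw : Reg Srf w) : Integrable (fun y => |v y| * |w y|) Srf.μ :=
  Srf.int_cont hfin (hv.cont.abs.mul hw.cont.abs)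

lemma int_nn (hv : Reg Srf v) (hw : Reg Srf w) : Integrable (fun y => ‖gradient v y‖ * ‖gradient w y‖) Srf.μ := by
  have : IsFiniteMeasure Srf.μ := ⟨by simpa using hfin⟩
  obtain ⟨M, hM⟩ := hv.bdd
  obtain ⟨M', hM'⟩ := hw.bdd
  refine Integrable.of_bound ((gm v).norm.mul (gm w).norm).aestronglyMeasurable (M * M') ?_
  filter_upwards [hM, hM'] with y h1 h2
  rw [Real.norm_eq_abs, abs_of_nonneg (by positivity)]
  exact mul_le_mul h1 h2 (norm_nonneg _) ((norm_nonneg _).trans h1)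

lemma int_gg (hv : Reg Srf v) (hw : Reg Srf w) : Integrable (fun y => ⟪gradient v y, gradient w y⟫) Srf.μ :=
  (hv.int_nn hfin hw).mono' ((gm v).inner (gm w)).aestronglyMeasurable
    (.of_forall fun y => norm_inner_le_norm _ _)

lemma int_B (hv : Reg Srf v) (hw : Reg Srf w) :
    Integrable (fun y => ⟪gradient v y, gradient w y⟫ + v y * w y) Srf.μ :=
  (hv.int_gg hfin hw).add (hv.int_mul hfin hw)

lemma int_A (hv : Reg Srf v) (hw : Reg Srf w) :
    Integrable (fun y => ‖gradient v y‖ * ‖gradient w y‖ + |v y| * |w y|) Srf.μ :=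
  (hv.int_nn hfin hw).add (hv.int_abs hfin hw)

lemma int_N (hw : Reg Srf w) : Integrable (fun y => w y ^ 2 + ‖gradient w y‖ ^ 2) Srf.μ := by
  refine ((hw.int_mul hfin hw).add (hw.int_nn hfin hw)).congr (.of_forall fun y => ?_)
  simp only [Pi.add_apply]; ring

lemma BB_sub (hv : Reg Srf v) (hw : Reg Srf w) {z : E3 → ℝ} (hz : Reg Srf z) :
    BB Srf (fun y => v y - w y) z = BB Srf v z - BB Srf w z := by
  unfold BB
  rw [← integral_sub (hv.int_B hfin hz) (hw.int_B hfin hz)]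
  refine integral_congr_ae ?_
  filter_upwards [hv.diff, hw.diff] with y h1 h2
  rw [gradient_sub' h1 h2, inner_sub_left]; ring

lemma NN_eq (hw : Reg Srf w) : NN Srf w = BB Srf w w := by
  refine integral_congr_ae (.of_forall fun y => ?_)
  simp only [real_inner_self_eq_norm_sq]; ring

omit hfin in
lemma NN_nonneg (w : E3 → ℝ) : 0 ≤ NN Srf w := integral_nonneg fun y => by positivity

/-- Young's inequality for the product integral. -/
lemma young (hv : Reg Srf v) (hw : Reg Srf w) (ε : ℝ) :
    ε * ∫ y, (‖gradient v y‖ * ‖gradient w y‖ + |v y| * |w y|) ∂Srf.μ ≤ 2 * ε ^ 2 * NN Srf v + NN Srf w / 8 := by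
  have e : 2 * ε ^ 2 * NN Srf v + NN Srf w / 8 =
      ∫ y, (2 * ε ^ 2 * (v y ^ 2 + ‖gradient v y‖ ^ 2) + (1 / 8) * (w y ^ 2 + ‖gradient w y‖ ^ 2)) ∂Srf.μ := by
    rw [integral_add ((hv.int_N hfin).const_mul _) ((hw.int_N hfin).const_mul _), integral_const_mul, integral_const_mul]
    unfold NN; ring
  rw [e, ← integral_const_mul]
  refine integral_mono ((hv.int_A hfin hw).const_mul _)
    (((hv.int_N hfin).const_mul _).add ((hw.int_N hfin).const_mul _)) fun y => ?_
  simp only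
  rw [← sq_abs (v y), ← sq_abs (w y)]
  nlinarith [sq_nonneg (4 * ε * ‖gradient v y‖ - ‖gradient w y‖), sq_nonneg (4 * ε * |v y| - |w y|)]

lemma NN_sub (hv : Reg Srf v) (hw : Reg Srf w) : NN Srf (fun y => v y - w y) ≤ 2 * NN Srf v + 2 * NN Srf w := by
  unfold NN
  rw [← integral_const_mul, ← integral_const_mul, ← integral_add ((hv.int_N hfin).const_mul _) ((hw.int_N hfin).const_mul _)]
  refine integral_mono_ae ((hv.sub hw).int_N hfin) (((hv.int_N hfin).const_mul _).add ((hw.int_N hfin).const_mul _)) ?_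
  filter_upwards [hv.diff, hw.diff] with y h1 h2
  rw [gradient_sub' h1 h2]
  have a1 := norm_sub_le (gradient v y) (gradient w y)
  nlinarith [sq_nonneg (v y + w y), sq_nonneg (‖gradient v y‖ - ‖gradient w y‖), norm_nonneg (gradient v y - gradient w y), norm_nonneg (gradient v y), norm_nonneg (gradient w y)]

end Reg

lemma Tub.NC.reg {Srf : SmoothSurface} {Q : Tub Srf} {w : E3 → ℝ} (hw : Q.NC w) : Reg Srf w := by
  refine ⟨hw.contS, ?_, ?_⟩
  · obtain ⟨M, hM⟩ := Srf.compact.exists_bound_of_continuousOn (hw.dsmooth.continuousOn.mono Q.S_sub)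
    refine ⟨M, ?_⟩
    filter_upwards [Srf.ae_S] with y hy
    rw [gradient, LinearIsometryEquiv.norm_map]; exact hM y hy
  · filter_upwards [Srf.ae_S] with y hy using hw.diff (Q.S_sub hy)

namespace Triangulation
variable {Srf : SmoothSurface} {γ h : ℝ} (Tr : Triangulation Srf γ h)
variable {Q : Tub Srf} (hg : ∀ t ∈ Tr.T, GoodTri Q γ h t)
include hg

lemma reg {φ : E3 → ℝ} (hφ : Tr.IsVh φ) : Reg Srf (Tr.hat Q φ) := by
  obtain ⟨M, _, hM⟩ := Tr.grad_bdd hg hφ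
  refine ⟨Tr.hat_cont hg hφ.1, ⟨M, ?_⟩, ?_⟩
  · filter_upwards [Tr.ae_O hg] with y ⟨t, ht, hy⟩ using hM t ht y hy
  · filter_upwards [Tr.ae_O hg] with y ⟨t, ht, hy⟩ using (Tr.hat_smooth hg hφ ht hy).differentiableAt (by simp)

lemma form_close {φ ψ : E3 → ℝ} (hφ : Tr.IsVh φ) (hψ : Tr.IsVh ψ) :
    |Tr.ahForm φ ψ - BB Srf (Tr.hat Q φ) (Tr.hat Q ψ)| ≤ 26 * (Q.K γ * h) *
      ∫ y, (‖gradient (Tr.hat Q φ) y‖ * ‖gradient (Tr.hat Q ψ) y‖ + |Tr.hat Q φ y| * |Tr.hat Q ψ y|) ∂Srf.μ := by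
  have hfin := Tr.S_fin hg
  obtain ⟨t0, ht0⟩ := Tr.T_nonempty
  have hk0 := (hg t0 ht0).Kh0
  have hk1 := (hg t0 ht0).Kh_le
  set k := Q.K γ * h with hk
  set Φ := Tr.hat Q φ with hΦ
  set Ψ := Tr.hat Q ψ with hΨ
  have rφ : Reg Srf Φ := Tr.reg hg hφ
  have rψ : Reg Srf Ψ := Tr.reg hg hψ
  set F := fun y => ⟪gradient Φ y, gradient Ψ y⟫ + Φ y * Ψ y with hF
  set H := fun y => ‖gradient Φ y‖ * ‖gradient Ψ y‖ with hH
  have iF : Integrable F Srf.μ := rφ.int_B hfin rψ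
  have iH : Integrable H Srf.μ := rφ.int_nn hfin rψ
  have iA := rφ.int_A hfin rψ
  have s1 : |Tr.ahForm φ ψ - ∫ y, F y ∂Tr.ν Q| ≤ 9 * k * ∫ y, H y ∂Tr.ν Q := by
    rw [Tr.int_ν hg iF, Tr.int_ν hg iH, ahForm, ← Finset.sum_sub_distrib, Finset.mul_sum]
    refine (Finset.abs_sum_le_sum_abs _ _).trans (Finset.sum_le_sum fun t ht => ?_)
    have hShs : ∀ x ∈ triOf t, x ∈ Tr.Sh := fun x hx => Tr.mem_Sh.2 ⟨t, ht, hx⟩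
    obtain ⟨e, he⟩ := Tr.gradTri_const hg hφ ht
    obtain ⟨e', he'⟩ := Tr.gradTri_const hg hψ ht
    have i1 : IntegrableOn (fun x => ⟪gradTri t φ x, gradTri t ψ x⟫ + φ x * ψ x) (triOf t) μH[2] := by
      have : ContinuousOn (fun x => ⟪e, e'⟫ + φ x * ψ x) (triOf t) :=
        continuousOn_const.add ((hφ.1.mono hShs).mul (hψ.1.mono hShs))
      obtain ⟨M, hM⟩ := (tri_compact t).exists_bound_of_continuousOn this
      have hf : IsFiniteMeasure ((μH[2] : Measure E3).restrict (triOf t)) := ⟨by simpa using tri_fin t⟩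
      have i2 : IntegrableOn (fun x => ⟪e, e'⟫ + φ x * ψ x) (triOf t) μH[2] :=
        Integrable.of_bound (this.aestronglyMeasurable (tri_measurable t)) M
          (by filter_upwards [ae_restrict_mem (tri_measurable t)] with x hx using hM x hx)
      refine i2.congr_fun (fun x hx => ?_) (tri_measurable t)
      simp only [he x hx, he' x hx]
    rw [← integral_sub i1 (Tr.int_tri hg iF ht), ← integral_const_mul]
    refine (abs_integral_le_integral_abs).trans (integral_mono_ae (i1.sub (Tr.int_tri hg iF ht)).abs
      ((Tr.int_tri hg iH ht).const_mul _) ?_)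
    filter_upwards [Tr.ae_tri hg ht, ae_restrict_mem (tri_measurable t)] with x hO hx
    have n1 := Tr.near_tri hg hφ ht hx hO
    have n2 := Tr.near_tri hg hψ ht hx hO
    simp only [hF, hH]
    rw [← hΦ] at n1
    rw [← hΨ] at n2
    have z1 : Φ (Q.a x) = φ x := Tr.hat_a hg (hShs x hx)
    have z2 : Ψ (Q.a x) = ψ x := Tr.hat_a hg (hShs x hx)
    rw [z1, z2, add_sub_add_right_eq_sub]
    set p := gradTri t φ x
    set q := gradTri t ψ x
    set P := gradient Φ (Q.a x)
    set R := gradient Ψ (Q.a x)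
    have e1 : ⟪p, q⟫ - ⟪P, R⟫ = ⟪p - P, q - R⟫ + ⟪p - P, R⟫ + ⟪P, q - R⟫ := by
      simp only [inner_sub_left, inner_sub_right]; ring
    rw [e1]
    have b1 := abs_real_inner_le_norm (p - P) (q - R)
    have b2 := abs_real_inner_le_norm (p - P) R
    have b3 := abs_real_inner_le_norm P (q - R)
    have c1 : ‖p - P‖ ≤ 3 * k * ‖P‖ := by rw [hk]; linarith
    have c2 : ‖q - R‖ ≤ 3 * k * ‖R‖ := by rw [hk]; linarith
    have d1 : ‖p - P‖ * ‖q - R‖ ≤ 3 * k * ‖P‖ * (3 * k * ‖R‖) := by gcongr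
    have d2 : ‖p - P‖ * ‖R‖ ≤ 3 * k * ‖P‖ * ‖R‖ := by gcongr
    have d3 : ‖P‖ * ‖q - R‖ ≤ ‖P‖ * (3 * k * ‖R‖) := by gcongr
    have := abs_add_le (⟪p - P, q - R⟫ + ⟪p - P, R⟫) ⟪P, q - R⟫
    have := abs_add_le ⟪p - P, q - R⟫ ⟪p - P, R⟫
    have d4 : 3 * k * ‖P‖ * (3 * k * ‖R‖) ≤ 3 * k * (‖P‖ * ‖R‖) := by
      have : 0 ≤ k * (‖P‖ * ‖R‖) := by positivity
      nlinarith
    nlinarith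
  have s2 := meas_cmp (Tr.κ_one hg) (Tr.μ_le_ν hg) (Tr.ν_le_μ hg) iF
  have s3 := cmp_pos (Tr.ν_le_μ hg) (F := H) (fun y => by positivity) iH
  obtain ⟨k1, k2⟩ := Tr.κ_le hg
  rw [← hk] at k1
  set A := ∫ y, (‖gradient Φ y‖ * ‖gradient Ψ y‖ + |Φ y| * |Ψ y|) ∂Srf.μ with hA
  have hHA : ∫ y, H y ∂Srf.μ ≤ A := integral_mono iH iA fun y => by simp only [hH]; linarith [mul_nonneg (abs_nonneg (Φ y)) (abs_nonneg (Ψ y))]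
  have hFA : ∫ y, |F y| ∂Srf.μ ≤ A := integral_mono iF.abs iA fun y => by
    simp only [hF]
    have := abs_add_le ⟪gradient Φ y, gradient Ψ y⟫ (Φ y * Ψ y)
    have b2 := abs_real_inner_le_norm (gradient Φ y) (gradient Ψ y)
    rw [abs_mul] at this
    linarith
  have hH0 : 0 ≤ ∫ y, H y ∂Srf.μ := integral_nonneg fun y => by positivity
  have hF0 : 0 ≤ ∫ y, |F y| ∂Srf.μ := integral_nonneg fun y => by positivity
  have hA0 : 0 ≤ A := hF0.trans hFA
  have t1 : 9 * k * ∫ y, H y ∂Tr.ν Q ≤ 21 * k * A := by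
    have : (κ Q γ h : ℝ) * ∫ y, H y ∂Srf.μ ≤ 9 / 4 * A := by gcongr
    nlinarith
  have t2 : ((κ Q γ h : ℝ) - 1) * ∫ y, |F y| ∂Srf.μ ≤ 5 * k * A := by gcongr
  have hB : BB Srf Φ Ψ = ∫ y, F y ∂Srf.μ := rfl
  rw [hB]
  have := abs_sub_le (Tr.ahForm φ ψ) (∫ y, F y ∂Tr.ν Q) (∫ y, F y ∂Srf.μ)
  linarith

lemma rhs_close {f φ : E3 → ℝ} (hf : ContinuousOn f Srf.S) (hφ : Tr.IsVh φ) :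
    |∫ x in Tr.Sh, f (Tr.a x) * φ x ∂μH[2] - ∫ y, f y * Tr.hat Q φ y ∂Srf.μ| ≤ 5 * (Q.K γ * h) *
      ∫ y, |f y| * |Tr.hat Q φ y| ∂Srf.μ := by
  have hfin := Tr.S_fin hg
  have iF : Integrable (fun y => f y * Tr.hat Q φ y) Srf.μ := Srf.int_cont hfin (hf.mul (Tr.hat_cont hg hφ.1))
  rw [Tr.int_Sh hg iF (fun x hx => by rw [Tr.aeq hg hx, Tr.hat_a hg hx])]
  refine (meas_cmp (Tr.κ_one hg) (Tr.μ_le_ν hg) (Tr.ν_le_μ hg) iF).trans ?_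
  obtain ⟨k1, k2⟩ := Tr.κ_le hg
  simp only [abs_mul]
  gcongr

end Triangulation

lemma cover_lip (g : ℝ → ℝ) {ι : Type*} (A : ι → Set ℝ) (M : ℝ) :
    ∀ (F : Finset ι) (a b : ℝ), a ≤ b → ContinuousOn g (Set.Icc a b) →
      (∀ i ∈ F, IsClosed (A i ∩ Set.Icc a b)) → (∀ i ∈ F, ∀ s ∈ A i, ∀ s' ∈ A i, s ∈ Set.Icc a b → s' ∈ Set.Icc a b →
        |g s - g s'| ≤ M * |s - s'|) →
      (∀ s ∈ Set.Icc a b, ∃ i ∈ F, s ∈ A i) → |g b - g a| ≤ M * (b - a) := by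
  classical
  intro F
  induction F using Finset.strongInduction with
  | H F ih =>
    intro a b hab hc hA hL hcov
    obtain ⟨i, hi, hai⟩ := hcov a ⟨le_rfl, hab⟩
    have hK : IsCompact (A i ∩ Set.Icc a b) := (isCompact_Icc (a := a) (b := b)).of_isClosed_subset (hA i hi) Set.inter_subset_right
    have hne : (A i ∩ Set.Icc a b).Nonempty := ⟨a, hai, le_rfl, hab⟩
    obtain ⟨s, hs, hmax⟩ := hK.exists_isGreatest hne
    have h1 : |g s - g a| ≤ M * (s - a) := by
      have := hL i hi s hs.1 a hai hs.2 ⟨le_rfl, hab⟩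
      rwa [abs_of_nonneg (by linarith [hs.2.1] : 0 ≤ s - a)] at this
    rcases eq_or_lt_of_le hs.2.2 with hsb | hsb
    · rw [← hsb]; exact h1
    have h2 : ∀ s' ∈ Set.Ioc s b, |g b - g s'| ≤ M * (b - s') := by
      intro s' hs'
      have hsub : Set.Icc s' b ⊆ Set.Icc a b := Set.Icc_subset_Icc (by linarith [hs.2.1, hs'.1]) le_rfl
      refine ih (F.erase i) (Finset.erase_ssubset hi) s' b hs'.2 (hc.mono hsub) ?_ ?_ ?_
      · intro j hj
        have := (hA j (Finset.mem_of_mem_erase hj)).inter (isClosed_Icc (a := s') (b := b))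
        rwa [Set.inter_assoc, Set.inter_eq_self_of_subset_right hsub] at this
      · intro j hj p hp p' hp' q q'
        exact hL j (Finset.mem_of_mem_erase hj) p hp p' hp' (hsub q) (hsub q')
      · intro p hp
        obtain ⟨j, hj, hpj⟩ := hcov p (hsub hp)
        refine ⟨j, Finset.mem_erase.2 ⟨?_, hj⟩, hpj⟩
        rintro rfl
        have := hmax ⟨hpj, hsub hp⟩
        linarith [hs'.1, hp.1]
    have hev : ∀ᶠ p in nhdsWithin s (Set.Ioi s), p ∈ Set.Ioc s b := Ioc_mem_nhdsGT hsb
    have h3 : |g b - g s| ≤ M * (b - s) := by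
      have ct : Filter.Tendsto g (nhdsWithin s (Set.Ioi s)) (nhds (g s)) := by
        have := hc s hs.2
        refine this.mono_left (nhdsWithin_le_iff.2 ?_)
        filter_upwards [hev] with p hp using ⟨by linarith [hs.2.1, hp.1], hp.2⟩
      have ci : Filter.Tendsto (fun p : ℝ => p) (nhdsWithin s (Set.Ioi s)) (nhds s) := nhdsWithin_le_nhds
      refine le_of_tendsto_of_tendsto (ct.const_sub (g b)).abs ((ci.const_sub b).const_mul M) ?_
      filter_upwards [hev] with p hp using h2 p hp
    have := abs_sub_le (g b) (g s) (g a)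
    linarith

open scoped Convolution in
lemma mollify (ψ : E3 → ℝ) (M : ℝ≥0) (hψ : LipschitzWith M ψ) : ∃ g : ℕ → E3 → ℝ,
    (∀ k, ContDiff ℝ (⊤ : ℕ∞) (g k)) ∧ (∀ y, Filter.Tendsto (fun k => g k y) Filter.atTop (nhds (ψ y))) ∧
    (∀ k x, |g k x - ψ x| ≤ M) ∧ (∀ k x, ‖fderiv ℝ (g k) x‖ ≤ M) ∧
    ∀ y, ∀ D : E3 →L[ℝ] ℝ, HasStrictFDerivAt ψ D y →
      Filter.Tendsto (fun k => fderiv ℝ (g k) y) Filter.atTop (nhds D) := by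
  have hr : ∀ k : ℕ, 0 < 1 / ((k:ℝ) + 1) := fun k => by positivity
  set ρ : ∀ k : ℕ, ContDiffBump (0 : E3) := fun k => ⟨1 / ((k:ℝ) + 1) / 2, 1 / ((k:ℝ) + 1), by positivity, by linarith [hr k]⟩ with hρ
  have hc := hψ.continuous
  set g : ℕ → E3 → ℝ := fun k => ((ρ k).normed volume ⋆[ContinuousLinearMap.lsmul ℝ ℝ, volume] ψ) with hgdef
  have hIntg : ∀ k (F : E3 → ℝ), Continuous F → Integrable (fun t => (ρ k).normed volume t * F t) volume := fun k F hF =>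
    ((ρ k).continuous_normed.mul hF).integrable_of_hasCompactSupport ((ρ k).hasCompactSupport_normed.mul_right)
  have hg : ∀ k x, g k x = ∫ t, (ρ k).normed volume t * ψ (x - t) := fun k x => by
    simp only [hgdef, convolution_def, ContinuousLinearMap.lsmul_apply, smul_eq_mul]
  have key0 : ∀ (k : ℕ) (F : E3 → ℝ) (c : ℝ), Continuous F → (∀ t, ‖t‖ < 1 / ((k:ℝ) + 1) → |F t| ≤ c) →
      |∫ t, (ρ k).normed volume t * F t| ≤ c := by
    intro k F c hF hb
    have e1 : ∫ t, (ρ k).normed volume t * c = c := by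
      rw [integral_mul_const, (ρ k).integral_normed, one_mul]
    rw [← Real.norm_eq_abs]
    refine (norm_integral_le_of_norm_le (hIntg k (fun _ => c) continuous_const) (.of_forall fun t => ?_)).trans e1.le
    rw [norm_mul, Real.norm_eq_abs, abs_of_nonneg ((ρ k).nonneg_normed t)]
    by_cases ht : ‖t‖ < 1 / ((k:ℝ) + 1)
    · exact mul_le_mul_of_nonneg_left (hb t ht) ((ρ k).nonneg_normed t)
    · have : (ρ k).normed volume t = 0 := by
        have hs := (ρ k).support_normed_eq (μ := volume)
        by_contra hne
        have : t ∈ Function.support ((ρ k).normed volume) := hne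
        rw [hs] at this
        exact ht (by simpa only [mem_ball_zero_iff] using this)
      simp [this]
  have sh : ∀ x, Continuous fun t => ψ (x - t) := fun x => hc.comp (continuous_const.sub continuous_id)
  have hval : ∀ (k : ℕ) x, |g k x - ψ x| ≤ M * (1 / ((k:ℝ) + 1)) := by
    intro k x
    have e1 : ∫ t, (ρ k).normed volume t * ψ x = ψ x := by
      rw [integral_mul_const, (ρ k).integral_normed, one_mul]
    have e2 : g k x - ψ x = ∫ t, (ρ k).normed volume t * (ψ (x - t) - ψ x) := by
      rw [hg]
      have q := integral_sub (hIntg k _ (sh x)) (hIntg k (fun _ => ψ x) continuous_const)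
      rw [e1] at q
      rw [← q]
      simp only [mul_sub]
    rw [e2]
    refine key0 k _ _ ((sh x).sub continuous_const) fun t ht => ?_
    have := hψ.dist_le_mul (x - t) x
    rw [Real.dist_eq, dist_eq_norm, sub_sub_cancel_left, norm_neg] at this
    exact this.trans (by gcongr)
  have key : ∀ (k : ℕ) x x' (D : E3 →L[ℝ] ℝ) (ε : ℝ), (∀ t, ‖t‖ < 1 / ((k:ℝ) + 1) →
      |ψ (x - t) - ψ (x' - t) - D (x - x')| ≤ ε) → |g k x - g k x' - D (x - x')| ≤ ε := by
    intro k x x' D ε hb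
    have e1 : ∫ t, (ρ k).normed volume t * D (x - x') = D (x - x') := by
      rw [integral_mul_const, (ρ k).integral_normed, one_mul]
    have e2 : g k x - g k x' - D (x - x') = ∫ t, (ρ k).normed volume t * (ψ (x - t) - ψ (x' - t) - D (x - x')) := by
      rw [hg, hg]
      have q0 := integral_sub (hIntg k _ (sh x)) (hIntg k _ (sh x'))
      have q := integral_sub ((hIntg k _ (sh x)).sub (hIntg k _ (sh x'))) (hIntg k (fun _ => D (x - x')) continuous_const)
      simp only [Pi.sub_apply] at q
      rw [e1, q0] at q
      rw [← q]
      simp only [mul_sub]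
    rw [e2]
    exact key0 k _ _ (((sh x).sub (sh x')).sub continuous_const) hb
  have hsm : ∀ k, ContDiff ℝ (⊤ : ℕ∞) (g k) := fun k =>
    HasCompactSupport.contDiff_convolution_left _ (ρ k).hasCompactSupport_normed (ρ k).contDiff_normed hc.locallyIntegrable
  have hdiff : ∀ k y, DifferentiableAt ℝ (g k) y := fun k y => (hsm k).differentiable (by simp) y
  have dkey : ∀ (k : ℕ) y (D : E3 →L[ℝ] ℝ) (ε : ℝ), 0 ≤ ε → (∀ᶠ x in nhds y, ∀ t, ‖t‖ < 1 / ((k:ℝ) + 1) →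
      |ψ (x - t) - ψ (y - t) - D (x - y)| ≤ ε * ‖x - y‖) → ‖fderiv ℝ (g k) y - D‖ ≤ ε := by
    intro k y D ε hε hb
    have hd : HasFDerivAt (fun x => g k x - D x) (fderiv ℝ (g k) y - D) y := (hdiff k y).hasFDerivAt.sub D.hasFDerivAt
    refine hd.le_of_lip' hε ?_
    filter_upwards [hb] with x hx
    have := key k x y D _ hx
    rw [Real.norm_eq_abs]
    rwa [map_sub, sub_sub_sub_comm] at this
  have hz : Filter.Tendsto (fun k : ℕ => 1 / ((k:ℝ) + 1)) Filter.atTop (nhds 0) := tendsto_one_div_add_atTop_nhds_zero_nat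
  refine ⟨g, hsm, ?_, ?_, ?_, ?_⟩
  · intro y
    rw [tendsto_iff_dist_tendsto_zero]
    refine squeeze_zero (fun _ => dist_nonneg) (fun k => hval k y) ?_
    simpa using hz.const_mul (M:ℝ)
  · intro k x
    refine (hval k x).trans (mul_le_of_le_one_right M.2 ?_)
    rw [div_le_one (by positivity)]; linarith [(Nat.cast_nonneg k : (0:ℝ) ≤ k)]
  · intro k x
    have := dkey k x 0 M M.2 (.of_forall fun z t _ => by
      have := hψ.dist_le_mul (z - t) (x - t)
      rw [Real.dist_eq, dist_eq_norm, sub_sub_sub_cancel_right] at this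
      simpa using this)
    simpa using this
  · intro y D hD
    rw [Metric.tendsto_atTop]
    intro ε hε
    have h1 := hD.isLittleO.def (half_pos hε)
    obtain ⟨r, hr0, hr1⟩ := Metric.eventually_nhds_iff.1 h1
    have h2 := (hz.eventually (gt_mem_nhds (half_pos hr0)))
    obtain ⟨k0, hk0⟩ := Filter.eventually_atTop.1 h2
    refine ⟨k0, fun k hk => ?_⟩
    rw [dist_eq_norm]
    refine (dkey k y D (ε / 2) (by positivity) ?_).trans_lt (by linarith)
    filter_upwards [Metric.ball_mem_nhds y (half_pos hr0)] with x hx t ht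
    have ht' := ht.trans (hk0 k hk)
    have hxy : ‖x - y‖ < r / 2 := by simpa [dist_eq_norm] using hx
    have := @hr1 (x - t, y - t) (by
      rw [Prod.dist_eq, max_lt_iff]
      simp only [dist_eq_norm]
      constructor
      · calc ‖x - t - y‖ = ‖(x - y) - t‖ := by congr 1; abel
          _ ≤ ‖x - y‖ + ‖t‖ := norm_sub_le _ _
          _ < r := by linarith
      · rw [sub_sub_cancel_left, norm_neg]; linarith)
    simpa only [sub_sub_sub_cancel_right, Real.norm_eq_abs] using this

namespace Triangulation
variable {Srf : SmoothSurface} {γ h : ℝ} (Tr : Triangulation Srf γ h)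
variable {Q : Tub Srf} (hg : ∀ t ∈ Tr.T, GoodTri Q γ h t)
include hg

lemma hat_lip_S {φ : E3 → ℝ} (hφ : Tr.IsVh φ) : ∃ M : ℝ, 0 ≤ M ∧ ∀ y ∈ Srf.S, ∀ y' ∈ Srf.S, ‖y' - y‖ ≤ Q.δ →
    |Tr.hat Q φ y' - Tr.hat Q φ y| ≤ M * ‖y' - y‖ := by
  choose! L c hL using hφ.2
  set M : ℝ := ∑ t ∈ Tr.T, 2 * ‖(LinearMap.toContinuousLinearMap (L t))‖ with hM
  have hM0 : 0 ≤ M := by positivity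
  have hMt : ∀ t ∈ Tr.T, ∀ x, 2 * |L t x| ≤ M * ‖x‖ := by
    intro t ht x
    have h1 := (LinearMap.toContinuousLinearMap (L t)).le_opNorm x
    have h2 := Finset.single_le_sum (f := fun t => 2 * ‖(LinearMap.toContinuousLinearMap (L t))‖) (fun t _ => by positivity) ht
    rw [LinearMap.coe_toContinuousLinearMap', Real.norm_eq_abs] at h1
    calc 2 * |L t x| ≤ 2 * (‖(LinearMap.toContinuousLinearMap (L t))‖ * ‖x‖) := by linarith
      _ = (2 * ‖(LinearMap.toContinuousLinearMap (L t))‖) * ‖x‖ := by ring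
      _ ≤ _ := mul_le_mul_of_nonneg_right h2 (norm_nonneg _)
  have himg : ∀ t ∈ Tr.T, ∀ z ∈ Q.a '' triOf t, ∀ z' ∈ Q.a '' triOf t, |Tr.hat Q φ z - Tr.hat Q φ z'| ≤ M * ‖z - z'‖ := by
    rintro t ht _ ⟨x, hx, rfl⟩ _ ⟨x', hx', rfl⟩
    rw [Tr.hat_a hg (Tr.mem_Sh.2 ⟨t, ht, hx⟩), Tr.hat_a hg (Tr.mem_Sh.2 ⟨t, ht, hx'⟩), hL t ht x hx, hL t ht x' hx']
    have h4 := (hg t ht).G4 hx hx'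
    have h5 := (hg t ht).Kh_le
    have h6 : Q.K γ * h * ‖x - x'‖ ≤ 1 / 4 * ‖x - x'‖ := by gcongr
    have h7 := norm_le_norm_add_norm_sub (Q.a x - Q.a x') (x - x')
    have h9 : ‖x - x'‖ ≤ 2 * ‖Q.a x - Q.a x'‖ := by
      rw [norm_sub_rev] at h4
      have := norm_sub_rev (x - x') (Q.a x - Q.a x')
      linarith [norm_nonneg (x - x')]
    have h8 := hMt t ht (x - x')
    rw [map_sub] at h8
    rw [add_sub_add_right_eq_sub]
    have := mul_le_mul_of_nonneg_left h9 hM0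
    linarith
  refine ⟨M * Q.C, by have := Q.C_pos; positivity, fun y hy y' hy' hd => ?_⟩
  set p : ℝ → E3 := fun s => Q.a (y + s • (y' - y)) with hp
  have hnear : ∀ s ∈ Set.Icc (0:ℝ) 1, ‖y + s • (y' - y) - y‖ ≤ 3 * Q.δ := by
    intro s hs
    rw [add_sub_cancel_left, norm_smul, Real.norm_eq_abs, abs_of_nonneg hs.1]
    have := Q.δ_pos
    nlinarith [mul_le_of_le_one_left (norm_nonneg (y' - y)) hs.2]
  have hS : ∀ s ∈ Set.Icc (0:ℝ) 1, p s ∈ Srf.S := fun s hs => Q.a_mem _ (Q.mem y hy _ (hnear s hs))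
  have hplip : ∀ s ∈ Set.Icc (0:ℝ) 1, ∀ s' ∈ Set.Icc (0:ℝ) 1, ‖p s - p s'‖ ≤ Q.C * ‖y' - y‖ * |s - s'| := by
    intro s hs s' hs'
    refine (Q.a_lip hy (hnear s hs) (hnear s' hs')).trans (le_of_eq ?_)
    rw [add_sub_add_left_eq_sub, ← sub_smul, norm_smul, Real.norm_eq_abs]; ring
  have hpc : ContinuousOn p (Set.Icc 0 1) := by
    intro s hs
    have : ContinuousAt Q.a (y + s • (y' - y)) := (Q.diff (Q.mem y hy _ (hnear s hs))).continuousAt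
    exact (ContinuousAt.comp (f := fun s : ℝ => y + s • (y' - y)) this (by fun_prop)).continuousWithinAt
  have key := cover_lip (fun s => Tr.hat Q φ (p s)) (fun t => p ⁻¹' (Q.a '' triOf t)) (M * Q.C * ‖y' - y‖) Tr.T 0 1 zero_le_one
    ((Tr.hat_cont hg hφ.1).comp hpc hS)
    (fun t ht => by
      rw [Set.inter_comm]
      exact hpc.preimage_isClosed_of_isClosed isClosed_Icc ((tri_compact t).image_of_continuousOn (hg t ht).contA).isClosed)
    (fun t ht s hs s' hs' h1 h2 => by
      refine (himg t ht _ hs _ hs').trans ?_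
      calc M * ‖p s - p s'‖ ≤ M * (Q.C * ‖y' - y‖ * |s - s'|) := mul_le_mul_of_nonneg_left (hplip s h1 s' h2) hM0
        _ = _ := by ring)
    (fun s hs => by
      have := hS s hs
      rw [Tr.cover hg] at this
      simpa using this)
  simp only [hp, one_smul, zero_smul, add_zero, add_sub_cancel, Q.fix hy, Q.fix hy', sub_zero, mul_one] at key
  exact key

lemma hat_ext {φ : E3 → ℝ} (hφ : Tr.IsVh φ) : ∃ (M : ℝ≥0) (ψ : E3 → ℝ), LipschitzWith M ψ ∧
    ∀ y ∈ Srf.S, ∀ x, ‖x - y‖ ≤ Q.δ → Tr.hat Q φ x = ψ x := by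
  obtain ⟨M, hM0, hM⟩ := Tr.hat_lip_S hg hφ
  obtain ⟨B, hB⟩ := Srf.compact.exists_bound_of_continuousOn (Tr.hat_cont hg hφ.1)
  have hB0 : 0 ≤ B := (norm_nonneg _).trans (hB _ Srf.nonempty.some_mem)
  have hC := Q.C_pos
  have hδ := Q.δ_pos
  set τ : Set E3 := {x | ∃ y ∈ Srf.S, ‖x - y‖ ≤ Q.δ} with hτ
  have hN : ∀ x ∈ τ, x ∈ Q.N := fun x ⟨y, hy, hx⟩ => Q.mem y hy x (by linarith)
  have hh : ∀ x ∈ τ, Tr.hat Q φ x = Tr.hat Q φ (Q.a x) := fun x hx => by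
    simp only [hat, Q.idem (hN x hx)]
  have hL : LipschitzOnWith (M * Q.C + 2 * B * Q.C / Q.δ).toNNReal (Tr.hat Q φ) τ := by
    refine LipschitzOnWith.of_dist_le_mul fun x hx x' hx' => ?_
    rw [Real.coe_toNNReal _ (by positivity), hh x hx, hh x' hx', Real.dist_eq, dist_eq_norm]
    have s1 := Q.a_mem x (hN x hx)
    have s2 := Q.a_mem x' (hN x' hx')
    by_cases hd : Q.C * ‖x - x'‖ ≤ Q.δ
    · obtain ⟨y, hy, hxy⟩ := hx
      have hd' : ‖x - x'‖ ≤ Q.δ := by nlinarith [Q.C_one, norm_nonneg (x - x')]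
      have h1 : ‖x' - y‖ ≤ 3 * Q.δ := by
        have := norm_sub_le_norm_sub_add_norm_sub x' x y
        rw [norm_sub_rev x' x] at this; linarith
      have h2 := Q.a_lip hy (by linarith) h1 (x := x)
      calc _ ≤ M * ‖Q.a x - Q.a x'‖ := hM _ s2 _ s1 (h2.trans hd)
        _ ≤ M * (Q.C * ‖x - x'‖) := by gcongr
        _ ≤ (M * Q.C + 2 * B * Q.C / Q.δ) * ‖x - x'‖ := by
          have : 0 ≤ 2 * B * Q.C / Q.δ * ‖x - x'‖ := by positivity
          linarith
    · push Not at hd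
      have b1 := hB _ s1
      have b2 := hB _ s2
      rw [Real.norm_eq_abs] at b1 b2
      calc _ ≤ |Tr.hat Q φ (Q.a x)| + |Tr.hat Q φ (Q.a x')| := abs_sub _ _
        _ ≤ 2 * B / Q.δ * Q.δ := by rw [div_mul_cancel₀ _ hδ.ne']; linarith
        _ ≤ 2 * B / Q.δ * (Q.C * ‖x - x'‖) := by gcongr
        _ ≤ (M * Q.C + 2 * B * Q.C / Q.δ) * ‖x - x'‖ := by
          have : 0 ≤ M * Q.C * ‖x - x'‖ := by positivity
          have e : 2 * B / Q.δ * (Q.C * ‖x - x'‖) = 2 * B * Q.C / Q.δ * ‖x - x'‖ := by ring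
          linarith
  obtain ⟨ψ, h1, h2⟩ := hL.extend_real
  exact ⟨_, ψ, h1, fun y hy x hx => h2 ⟨y, hy, hx⟩⟩

theorem weak_hat {f u φ : E3 → ℝ} (hf : SmoothNear f Srf.S) (hu : IsSolution Srf f u) (hφ : Tr.IsVh φ) :
    BB Srf (fun z => u (Q.a z)) (Tr.hat Q φ) = ∫ y, f y * Tr.hat Q φ y ∂Srf.μ := by
  obtain ⟨M, ψ, hψ, he⟩ := Tr.hat_ext hg hφ
  obtain ⟨g, g1, g2, g3, g4, g5⟩ := mollify ψ M hψ
  have hfin := Tr.S_fin hg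
  have : IsFiniteMeasure Srf.μ := ⟨by simpa using hfin⟩
  have hδ := Q.δ_pos
  have hC := Q.C_pos
  have hw := Q.nc_hat hu.1
  set w : E3 → ℝ := fun z => u (Q.a z) with hwd
  have hev : ∀ y ∈ Srf.S, Tr.hat Q φ =ᶠ[nhds y] ψ := fun y hy => by
    filter_upwards [Metric.closedBall_mem_nhds y hδ] with x hx
    exact he y hy x (by simpa [dist_eq_norm] using hx)
  have hgd : ∀ k y, DifferentiableAt ℝ (g k) y := fun k y => (g1 k).differentiable (by simp) y
  have hD : ∀ k, ∀ y ∈ Srf.S, HasFDerivAt (fun z => g k (Q.a z)) ((fderiv ℝ (g k) y).comp (fderiv ℝ Q.a y)) y := by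
    intro k y hy
    have h1 := (Q.diff (Q.S_sub hy)).hasFDerivAt
    have h2 := (hgd k (Q.a y)).hasFDerivAt
    have := h2.comp y h1
    rw [Q.fix hy] at this
    exact this
  have hDb : ∀ k, ∀ y ∈ Srf.S, ‖gradient (fun z => g k (Q.a z)) y‖ ≤ M * Q.C := by
    intro k y hy
    rw [grad_norm, (hD k y hy).fderiv]
    exact (ContinuousLinearMap.opNorm_comp_le _ _).trans (mul_le_mul (g4 k y) (Q.da_le y hy y (by simp [hδ.le])) (norm_nonneg _) M.2)
  have hlim : ∀ᵐ y ∂Srf.μ, Filter.Tendsto (fun k => gradient (fun z => g k (Q.a z)) y) Filter.atTop (nhds (gradient (Tr.hat Q φ) y)) := by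
    filter_upwards [Tr.ae_O hg] with y ⟨t, ht, hy⟩
    have hyS := hy.1
    have h1 : HasStrictFDerivAt ψ (fderiv ℝ (Tr.hat Q φ) y) y :=
      ((Tr.hat_smooth hg hφ ht hy).hasStrictFDerivAt (by simp)).congr_of_eventuallyEq (hev y hyS)
    have h2 := g5 y _ h1
    have h3 : (fderiv ℝ (Tr.hat Q φ) y).comp (fderiv ℝ Q.a y) = fderiv ℝ (Tr.hat Q φ) y := by
      have d1 := (Q.diff (Q.S_sub hyS)).hasFDerivAt
      have d2 : HasFDerivAt (Tr.hat Q φ) (fderiv ℝ (Tr.hat Q φ) y) (Q.a y) := by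
        rw [Q.fix hyS]; exact ((Tr.hat_smooth hg hφ ht hy).differentiableAt (by simp)).hasFDerivAt
      have d3 := d2.comp y d1
      have d4 : Tr.hat Q φ =ᶠ[nhds y] (Tr.hat Q φ ∘ Q.a) := by
        filter_upwards [Q.nh (Q.S_sub hyS)] with z hz
        simp only [hat, Function.comp, Q.idem hz]
      exact (d3.congr_of_eventuallyEq d4).fderiv.symm
    have h4 : Filter.Tendsto (fun k => (fderiv ℝ (g k) y).comp (fderiv ℝ Q.a y)) Filter.atTop (nhds (fderiv ℝ (Tr.hat Q φ) y)) := by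
      rw [← h3]
      exact ((ContinuousLinearMap.compL ℝ E3 E3 ℝ).flip (fderiv ℝ Q.a y)).continuous.continuousAt.tendsto.comp h2
    have h5 := (InnerProductSpace.toDual ℝ E3).symm.continuous.continuousAt.tendsto.comp h4
    refine h5.congr fun k => ?_
    simp only [Function.comp, gradient, (hD k y hyS).fderiv]
  obtain ⟨B, hB⟩ := Srf.compact.exists_bound_of_continuousOn hψ.continuous.continuousOn
  have hB0 : 0 ≤ B := (norm_nonneg _).trans (hB _ Srf.nonempty.some_mem)
  have hgB : ∀ k, ∀ y ∈ Srf.S, |g k y| ≤ B + M := fun k y hy => by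
    have := hB y hy
    rw [Real.norm_eq_abs] at this
    have h2 := abs_sub_abs_le_abs_sub (g k y) (ψ y)
    linarith [g3 k y]
  have hfc : ContinuousOn f Srf.S := by
    obtain ⟨V, _, hV, hfV⟩ := hf
    exact hfV.continuousOn.mono hV
  obtain ⟨Bw, hBw⟩ := hw.reg.bdd
  obtain ⟨Bu, hBu⟩ := Srf.compact.exists_bound_of_continuousOn hw.contS
  obtain ⟨Bf, hBf⟩ := Srf.compact.exists_bound_of_continuousOn hfc
  have m1 : ∀ {F : E3 → ℝ}, ContinuousOn F Srf.S → AEStronglyMeasurable F Srf.μ := fun h => (Srf.int_cont hfin h).1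
  have hψe : ∀ y ∈ Srf.S, ψ y = Tr.hat Q φ y := fun y hy => (he y hy y (by simp [hδ.le])).symm
  have lim1 : Filter.Tendsto (fun k => ∫ y, (⟪gradient w y, gradient (fun z => g k (Q.a z)) y⟫ + w y * g k y) ∂Srf.μ) Filter.atTop
      (nhds (BB Srf w (Tr.hat Q φ))) := by
    refine tendsto_integral_of_dominated_convergence (fun _ => Bw * (M * Q.C) + Bu * (B + M)) (fun k => ?_) (integrable_const _)
      (fun k => ?_) ?_
    · exact (((Reg.gm w).inner (Reg.gm _)).aestronglyMeasurable).add ((m1 hw.contS).mul (m1 (g1 k).continuous.continuousOn))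
    · filter_upwards [Srf.ae_S, hBw] with y hy hb
      refine (norm_add_le _ _).trans (add_le_add ?_ ?_)
      · exact (norm_inner_le_norm _ _).trans (mul_le_mul hb (hDb k y hy) (norm_nonneg _) ((norm_nonneg _).trans hb))
      · rw [norm_mul]
        exact mul_le_mul (hBu y hy) (hgB k y hy) (norm_nonneg _) ((norm_nonneg _).trans (hBu y hy))
    · filter_upwards [hlim, Srf.ae_S] with y hy hyS
      refine ((tendsto_const_nhds).inner hy).add (tendsto_const_nhds.mul ?_)
      rw [← hψe y hyS]; exact g2 y
  have lim2 : Filter.Tendsto (fun k => ∫ y, f y * g k y ∂Srf.μ) Filter.atTop (nhds (∫ y, f y * Tr.hat Q φ y ∂Srf.μ)) := by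
    refine tendsto_integral_of_dominated_convergence (fun _ => Bf * (B + M)) (fun k => ?_) (integrable_const _)
      (fun k => ?_) ?_
    · exact (m1 hfc).mul (m1 (g1 k).continuous.continuousOn)
    · filter_upwards [Srf.ae_S] with y hy
      rw [norm_mul]
      exact mul_le_mul (hBf y hy) (hgB k y hy) (norm_nonneg _) ((norm_nonneg _).trans (hBf y hy))
    · filter_upwards [Srf.ae_S] with y hyS
      refine tendsto_const_nhds.mul ?_
      rw [← hψe y hyS]; exact g2 y
  refine tendsto_nhds_unique lim1 (lim2.congr fun k => ?_)
  rw [← hu.2 (g k) (g1 k), SmoothSurface.aForm]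
  refine setIntegral_congr_fun Srf.measS fun y hy => ?_
  rw [Q.grad_eq hy (hw.diff (Q.S_sub hy)), Q.grad_eq hy (hD k y hy).differentiableAt]
  simp only [hwd, Q.fix hy]

end Triangulation

lemma tri_scale (t : E3 × E3 × E3) {v : E3} (hv : v ∈ triOf t) {s : ℝ} (hs : s ∈ Set.Icc (0:ℝ) 1) {H : E3 → ℝ≥0∞}
    (hH : Measurable H) :
    ∫⁻ x in triOf t, ENNReal.ofReal ((1 - s) ^ 2) * H (x + s • (v - x)) ∂μH[2] ≤ ∫⁻ x in triOf t, H x ∂μH[2] := by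
  rcases eq_or_lt_of_le hs.2 with rfl | h1
  · simp
  have hc : 0 < 1 - s := by linarith
  set P : E3 → E3 := fun x => x + s • (v - x) with hP
  have hPm : Measurable P := by
    have : Continuous P := by fun_prop
    exact this.measurable
  have hPe : P = AffineMap.homothety v (1 - s) := by
    funext x
    simp only [hP, AffineMap.homothety_apply, vsub_eq_sub, vadd_eq_add]
    module
  have hPt : ∀ x ∈ triOf t, P x ∈ triOf t := fun x hx =>
    (tri_convex t).add_smul_sub_mem hx hv hs
  have hle : ENNReal.ofReal ((1 - s) ^ 2) • Measure.map P ((μH[2] : Measure E3).restrict (triOf t)) ≤ (μH[2] : Measure E3).restrict (triOf t) := by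
    refine Measure.le_iff.2 fun B hB => ?_
    rw [Measure.smul_apply, Measure.map_apply hPm hB, Measure.restrict_apply (hPm hB), Measure.restrict_apply hB]
    have h2 := hausdorffMeasure_homothety_image (d := 2) (by norm_num) v hc.ne' (P ⁻¹' B ∩ triOf t)
    have h3 : ENNReal.ofReal ((1 - s) ^ 2) • μH[2] (P ⁻¹' B ∩ triOf t) = ‖1 - s‖₊ ^ (2:ℝ) • μH[2] (P ⁻¹' B ∩ triOf t) := by
      rw [ENNReal.smul_def, smul_eq_mul, smul_eq_mul]
      congr 1
      rw [ENNReal.ofReal, ENNReal.coe_inj]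
      ext
      rw [Real.coe_toNNReal _ (sq_nonneg _)]
      simp [abs_of_pos hc]
    rw [h3, ← h2, ← hPe]
    refine measure_mono ?_
    rintro _ ⟨x, ⟨hx1, hx2⟩, rfl⟩
    exact ⟨hx1, hPt x hx2⟩
  calc ∫⁻ x in triOf t, ENNReal.ofReal ((1 - s) ^ 2) * H (P x) ∂μH[2]
      = ENNReal.ofReal ((1 - s) ^ 2) * ∫⁻ x in triOf t, H (P x) ∂μH[2] := lintegral_const_mul _ (hH.comp hPm)
    _ = ∫⁻ x, H x ∂(ENNReal.ofReal ((1 - s) ^ 2) • Measure.map P ((μH[2] : Measure E3).restrict (triOf t))) := by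
        rw [lintegral_smul_measure, lintegral_map hH hPm, smul_eq_mul]
    _ ≤ _ := lintegral_mono' hle le_rfl

lemma tri_avg (t : E3 × E3 × E3) {v : E3} (hv : v ∈ triOf t) {H : E3 → ℝ≥0∞} (hH : Measurable H) :
    ∫⁻ x in triOf t, ∫⁻ s in Set.Icc (0:ℝ) 1, ENNReal.ofReal ((1 - s) ^ 2) * H (x + s • (v - x)) ∂volume ∂μH[2]
      ≤ ∫⁻ x in triOf t, H x ∂μH[2] := by
  have : IsFiniteMeasure ((μH[2] : Measure E3).restrict (triOf t)) := ⟨by simpa using tri_fin t⟩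
  rw [lintegral_lintegral_swap]
  · calc _ ≤ ∫⁻ s in Set.Icc (0:ℝ) 1, (∫⁻ x in triOf t, H x ∂μH[2]) ∂volume :=
        setLIntegral_mono measurable_const fun s hs => tri_scale t hv hs hH
      _ = _ := by simp
  · refine Measurable.aemeasurable ?_
    have h1 : Measurable fun p : E3 × ℝ => p.1 + p.2 • (v - p.1) := by
      have : Continuous fun p : E3 × ℝ => p.1 + p.2 • (v - p.1) := by fun_prop
      exact this.measurable
    have h2 : Measurable fun p : E3 × ℝ => ENNReal.ofReal ((1 - p.2) ^ 2) := by fun_prop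
    exact h2.mul (hH.comp h1)

/-- Taylor remainder. -/
def Rem (w : E3 → ℝ) (v x : E3) : ℝ := w v - w x - fderiv ℝ w x (v - x)

lemma sq_int_le {f : ℝ → ℝ} (hf : ContinuousOn f (Set.Icc 0 1)) : (∫ s in (0:ℝ)..1, f s) ^ 2 ≤ ∫ s in (0:ℝ)..1, f s ^ 2 := by
  set m := ∫ s in (0:ℝ)..1, f s with hm
  have hi : IntervalIntegrable f volume 0 1 := (hf.mono (by simp)).intervalIntegrable
  have hi2 : IntervalIntegrable (fun s => f s ^ 2) volume 0 1 := ((hf.pow 2).mono (by simp)).intervalIntegrable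
  have h0 : 0 ≤ ∫ s in (0:ℝ)..1, (f s - m) ^ 2 := intervalIntegral.integral_nonneg zero_le_one fun s _ => sq_nonneg _
  have h1 : ∫ s in (0:ℝ)..1, (f s - m) ^ 2 = (∫ s in (0:ℝ)..1, f s ^ 2) - 2 * m * m + m ^ 2 := by
    have e : ∀ s, (f s - m) ^ 2 = f s ^ 2 - 2 * m * f s + m ^ 2 := fun s => by ring
    simp only [e]
    rw [intervalIntegral.integral_add (hi2.sub (hi.const_mul _)) intervalIntegrable_const,
      intervalIntegral.integral_sub hi2 (hi.const_mul _), intervalIntegral.integral_const_mul]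
    simp [← hm]
  nlinarith

lemma norm_cont {F : Type*} [NormedAddCommGroup F] {H : E3 → F} {s : Set E3} (hH : ContinuousOn H s) :
    ContinuousOn (fun x => ‖H x‖ ^ 2) s := hH.norm.pow 2

namespace GoodTri
variable {Srf : SmoothSurface} {Q : Tub Srf} {γ h : ℝ} {t : E3 × E3 × E3} (g : GoodTri Q γ h t)
include g

lemma rem_le {w : E3 → ℝ} (hw : ContDiffOn ℝ (⊤ : ℕ∞) w Q.N) {x v : E3} (hx : x ∈ triOf t) (hv : v ∈ triOf t) :
    ENNReal.ofReal (Rem w v x ^ 2) ≤ ENNReal.ofReal (h ^ 4) *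
      ∫⁻ s in Set.Icc (0:ℝ) 1, ENNReal.ofReal ((1 - s) ^ 2) * ENNReal.ofReal (‖fderiv ℝ (fderiv ℝ w) (x + s • (v - x))‖ ^ 2) := by
  have hmem : ∀ s ∈ Set.Icc (0:ℝ) 1, x + s • (v - x) ∈ Q.N := fun s hs =>
    g.mem ((tri_convex t).add_smul_sub_mem hx hv hs)
  have hd : ∀ z ∈ Q.N, HasFDerivAt w (fderiv ℝ w z) z := fun z hz =>
    ((hw.contDiffAt (Q.N_open.mem_nhds hz)).differentiableAt (by simp)).hasFDerivAt
  have hs1 : ContDiffOn ℝ (⊤ : ℕ∞) (fderiv ℝ w) Q.N := hw.fderiv_of_isOpen Q.N_open (by simp)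
  have hs2 : ContDiffOn ℝ (⊤ : ℕ∞) (fderiv ℝ (fderiv ℝ w)) Q.N := hs1.fderiv_of_isOpen Q.N_open (by simp)
  have hdd : ∀ z ∈ Q.N, HasFDerivAt (fderiv ℝ w) (fderiv ℝ (fderiv ℝ w) z) z := fun z hz =>
    ((hs1.contDiffAt (Q.N_open.mem_nhds hz)).differentiableAt (by simp)).hasFDerivAt
  set p : ℝ → E3 := fun s => x + s • (v - x) with hp
  have hpd : ∀ s, HasDerivAt p (v - x) s := fun s => by
    have := ((hasDerivAt_id s).smul_const (v - x)).const_add x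
    rw [one_smul] at this
    exact this
  set G : ℝ → ℝ := fun s => fderiv ℝ (fderiv ℝ w) (p s) (v - x) (v - x) with hG
  have hpc : Continuous p := by fun_prop
  have hGc0 : ContinuousOn (fun s => fderiv ℝ (fderiv ℝ w) (p s)) (Set.Icc 0 1) :=
    hs2.continuousOn.comp hpc.continuousOn hmem
  have hGc : ContinuousOn (fun s => (1 - s) * G s) (Set.Icc 0 1) :=
    (Continuous.continuousOn (by fun_prop)).mul ((hGc0.clm_apply continuousOn_const).clm_apply continuousOn_const)
  have hq : ∀ s ∈ Set.Icc (0:ℝ) 1, HasDerivAt (fun s => w (p s) + (1 - s) * fderiv ℝ w (p s) (v - x)) ((1 - s) * G s) s := by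
    intro s hs
    have e1 : HasDerivAt (fun s => w (p s)) (fderiv ℝ w (p s) (v - x)) s :=
      HasFDerivAt.comp_hasDerivAt (l := w) (l' := fderiv ℝ w (p s)) s (hd _ (hmem s hs)) (hpd s)
    have e2 : HasDerivAt (fun s => fderiv ℝ w (p s)) (fderiv ℝ (fderiv ℝ w) (p s) (v - x)) s :=
      HasFDerivAt.comp_hasDerivAt (l := fderiv ℝ w) (l' := fderiv ℝ (fderiv ℝ w) (p s)) s (hdd _ (hmem s hs)) (hpd s)
    have e3 : HasDerivAt (fun s => fderiv ℝ w (p s) (v - x)) (G s) s := by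
      have := e2.clm_apply (hasDerivAt_const s (v - x))
      rw [map_zero, add_zero] at this
      exact this
    have e4 : HasDerivAt (fun s : ℝ => 1 - s) (-1) s := by simpa using (hasDerivAt_id s).const_sub 1
    have := e1.add (e4.mul e3)
    refine this.congr_deriv ?_
    ring
  have hR : Rem w v x = ∫ s in (0:ℝ)..1, (1 - s) * G s := by
    rw [intervalIntegral.integral_eq_sub_of_hasDerivAt (f := fun s => w (p s) + (1 - s) * fderiv ℝ w (p s) (v - x))
      (fun s hs => hq s (by simpa using hs)) ((hGc.mono (by simp)).intervalIntegrable)]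
    simp [hp, Rem]; ring
  have h1 : Rem w v x ^ 2 ≤ ∫ s in (0:ℝ)..1, ((1 - s) * G s) ^ 2 := by rw [hR]; exact sq_int_le hGc
  have hvx : ‖v - x‖ ≤ h := g.dist_le hv hx
  have hh := g.h_pos
  have hpt : ∀ s, ((1 - s) * G s) ^ 2 ≤ h ^ 4 * ((1 - s) ^ 2 * ‖fderiv ℝ (fderiv ℝ w) (p s)‖ ^ 2) := by
    intro s
    have e1 : |G s| ≤ ‖fderiv ℝ (fderiv ℝ w) (p s)‖ * ‖v - x‖ * ‖v - x‖ := by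
      rw [← Real.norm_eq_abs]; exact ContinuousLinearMap.le_opNorm₂ _ _ _
    have e2 : |G s| ≤ ‖fderiv ℝ (fderiv ℝ w) (p s)‖ * h * h := e1.trans (by gcongr)
    have e3 : G s ^ 2 ≤ (‖fderiv ℝ (fderiv ℝ w) (p s)‖ * h * h) ^ 2 := by
      rw [← sq_abs (G s)]; gcongr
    calc ((1 - s) * G s) ^ 2 = (1 - s) ^ 2 * G s ^ 2 := by ring
      _ ≤ (1 - s) ^ 2 * (‖fderiv ℝ (fderiv ℝ w) (p s)‖ * h * h) ^ 2 := by gcongr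
      _ = _ := by ring
  have h2 : ENNReal.ofReal (Rem w v x ^ 2) ≤ ∫⁻ s in Set.Icc (0:ℝ) 1, ENNReal.ofReal (((1 - s) * G s) ^ 2) := by
    refine (ENNReal.ofReal_le_ofReal h1).trans (le_of_eq ?_)
    rw [intervalIntegral.integral_of_le zero_le_one, ← integral_Icc_eq_integral_Ioc]
    exact ofReal_integral_eq_lintegral_ofReal ((hGc.pow 2).integrableOn_Icc) (.of_forall fun s => sq_nonneg _)
  refine h2.trans ?_
  rw [← lintegral_const_mul']
  · refine lintegral_mono fun s => ?_
    rw [← ENNReal.ofReal_mul (sq_nonneg _), ← ENNReal.ofReal_mul (by positivity)]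
    exact ENNReal.ofReal_le_ofReal (hpt s)
  · exact ENNReal.ofReal_ne_top

lemma rem_cont {w : E3 → ℝ} (hw : ContDiffOn ℝ (⊤ : ℕ∞) w Q.N) (v : E3) : ContinuousOn (Rem w v) (triOf t) := by
  have hs1 : ContDiffOn ℝ (⊤ : ℕ∞) (fderiv ℝ w) Q.N := hw.fderiv_of_isOpen Q.N_open (by simp)
  have hsub : triOf t ⊆ Q.N := fun x hx => g.mem hx
  exact (continuousOn_const.sub (hw.continuousOn.mono hsub)).sub
    ((hs1.continuousOn.mono hsub).clm_apply (continuousOn_const.sub continuousOn_id))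

omit g in
lemma cont_int {F : E3 → ℝ} (hF : ContinuousOn F (triOf t)) : IntegrableOn F (triOf t) μH[2] := by
  have : IsFiniteMeasure ((μH[2] : Measure E3).restrict (triOf t)) := ⟨by simpa using tri_fin t⟩
  obtain ⟨M, hM⟩ := (tri_compact t).exists_bound_of_continuousOn hF
  exact Integrable.of_bound (hF.aestronglyMeasurable (tri_measurable t)) M
    ((ae_restrict_mem (tri_measurable t)).mono fun x hx => hM x hx)

lemma rem_int {w : E3 → ℝ} (hw : ContDiffOn ℝ (⊤ : ℕ∞) w Q.N) {v : E3} (hv : v ∈ triOf t) :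
    ∫ x in triOf t, Rem w v x ^ 2 ∂μH[2] ≤ h ^ 4 * ∫ x in triOf t, ‖fderiv ℝ (fderiv ℝ w) x‖ ^ 2 ∂μH[2] := by
  have hs1 : ContDiffOn ℝ (⊤ : ℕ∞) (fderiv ℝ w) Q.N := hw.fderiv_of_isOpen Q.N_open (by simp)
  have hs2 : ContDiffOn ℝ (⊤ : ℕ∞) (fderiv ℝ (fderiv ℝ w)) Q.N := hs1.fderiv_of_isOpen Q.N_open (by simp)
  have hsub : triOf t ⊆ Q.N := fun x hx => g.mem hx
  have i1 : IntegrableOn (fun x => Rem w v x ^ 2) (triOf t) μH[2] := cont_int ((g.rem_cont hw v).pow 2)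
  have i2 : IntegrableOn (fun x => ‖fderiv ℝ (fderiv ℝ w) x‖ ^ 2) (triOf t) μH[2] :=
    cont_int (norm_cont (hs2.continuousOn.mono hsub))
  have hh := g.h_pos
  have hI : 0 ≤ ∫ x in triOf t, ‖fderiv ℝ (fderiv ℝ w) x‖ ^ 2 ∂μH[2] := integral_nonneg fun x => by positivity
  rw [← ENNReal.ofReal_le_ofReal_iff (by positivity), ENNReal.ofReal_mul (by positivity),
    ofReal_integral_eq_lintegral_ofReal i1 (.of_forall fun s => sq_nonneg _),
    ofReal_integral_eq_lintegral_ofReal i2 (.of_forall fun s => sq_nonneg _)]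
  have hm : Measurable fun x => ENNReal.ofReal (‖fderiv ℝ (fderiv ℝ w) x‖ ^ 2) :=
    ((measurable_fderiv ℝ (fderiv ℝ w)).norm.pow_const 2).ennreal_ofReal
  calc _ ≤ ∫⁻ x in triOf t, ENNReal.ofReal (h ^ 4) *
      ∫⁻ s in Set.Icc (0:ℝ) 1, ENNReal.ofReal ((1 - s) ^ 2) * ENNReal.ofReal (‖fderiv ℝ (fderiv ℝ w) (x + s • (v - x))‖ ^ 2) ∂volume ∂μH[2] :=
        setLIntegral_mono' (tri_measurable t) fun x hx => g.rem_le hw hx hv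
    _ = ENNReal.ofReal (h ^ 4) * ∫⁻ x in triOf t, 
      ∫⁻ s in Set.Icc (0:ℝ) 1, ENNReal.ofReal ((1 - s) ^ 2) * ENNReal.ofReal (‖fderiv ℝ (fderiv ℝ w) (x + s • (v - x))‖ ^ 2) ∂volume ∂μH[2] :=
        lintegral_const_mul' _ _ ENNReal.ofReal_ne_top
    _ ≤ _ := mul_le_mul_right (tri_avg t hv hm) _

end GoodTri

lemma exists_affine {t : E3 × E3 × E3} (hi : AffineIndependent ℝ ![t.1, t.2.1, t.2.2]) (w : E3 → ℝ) :
    ∃ (L : E3 →ₗ[ℝ] ℝ) (c : ℝ), ∀ v ∈ vertsOf t, w v = L v + c := by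
  rw [affineIndependent_iff_linearIndependent_vsub ℝ _ 0] at hi
  obtain ⟨L, hL⟩ := ((Module.Basis.span hi).constr ℝ fun i => w (![t.1, t.2.1, t.2.2] i) - w t.1).exists_extend
  have h : ∀ i : {i : Fin 3 // i ≠ 0}, L (![t.1, t.2.1, t.2.2] i -ᵥ ![t.1, t.2.1, t.2.2] 0) = w (![t.1, t.2.1, t.2.2] i) - w t.1 := by
    intro i
    have := (Module.Basis.span hi).constr_basis ℝ (fun i => w (![t.1, t.2.1, t.2.2] i) - w t.1) i
    rw [← hL] at this
    simpa only [LinearMap.comp_apply, Submodule.subtype_apply, Module.Basis.span_apply] using this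
  have h1 := h ⟨1, by decide⟩
  have h2 := h ⟨2, by decide⟩
  simp at h1 h2
  refine ⟨L, w t.1 - L t.1, fun v hv => ?_⟩
  simp only [vertsOf, Set.mem_insert_iff, Set.mem_singleton_iff] at hv
  rcases hv with rfl | rfl | rfl
  · ring
  · linarith
  · linarith

lemma seg_eq {L L' : E3 →ₗ[ℝ] ℝ} {c c' : ℝ} {v w x : E3} (hv : L v + c = L' v + c') (hw : L w + c = L' w + c')
    (hx : x ∈ segment ℝ v w) : L x + c = L' x + c' := by
  obtain ⟨a, b, ha, hb, hab, rfl⟩ := hx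
  simp only [map_add, map_smul, smul_eq_mul]
  have e : c = (a + b) * c := by rw [hab, one_mul]
  have e' : c' = (a + b) * c' := by rw [hab, one_mul]
  rw [e, e']
  linear_combination a * hv + b * hw

namespace Triangulation
variable {Srf : SmoothSurface} {γ h : ℝ} (Tr : Triangulation Srf γ h)

lemma exists_interp (w : E3 → ℝ) : ∃ I : E3 → ℝ, Tr.IsVh I ∧ ∀ t ∈ Tr.T, ∃ (L : E3 →ₗ[ℝ] ℝ) (c : ℝ),
    (∀ x ∈ triOf t, I x = L x + c) ∧ ∀ v ∈ vertsOf t, w v = L v + c := by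
  classical
  choose! L c hL using fun t (ht : t ∈ Tr.T) => exists_affine (Tr.indep t ht) w
  have hco : ∀ t ∈ Tr.T, ∀ t' ∈ Tr.T, ∀ x ∈ triOf t, x ∈ triOf t' → L t x + c t = L t' x + c t' := by
    intro t ht t' ht' x hx hx'
    by_cases e : t = t'
    · rw [e]
    have hv : ∀ v ∈ vertsOf t ∩ vertsOf t', L t v + c t = L t' v + c t' := fun v hv => by
      rw [← hL t ht v hv.1, hL t' ht' v hv.2]
    rcases Tr.meet t ht t' ht' e with h0 | ⟨v, h1, h2⟩ | ⟨v, z, -, h1, h2, h3⟩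
    · have : x ∈ triOf t ∩ triOf t' := ⟨hx, hx'⟩
      rw [h0] at this; exact this.elim
    · have : x ∈ triOf t ∩ triOf t' := ⟨hx, hx'⟩
      rw [h2] at this
      rw [Set.mem_singleton_iff.1 this]
      exact hv v h1
    · have : x ∈ triOf t ∩ triOf t' := ⟨hx, hx'⟩
      rw [h3] at this
      exact seg_eq (hv v h1) (hv z h2) this
  set I : E3 → ℝ := fun x => if hx : ∃ t ∈ Tr.T, x ∈ triOf t then L hx.choose x + c hx.choose else 0 with hI
  have hIe : ∀ t ∈ Tr.T, ∀ x ∈ triOf t, I x = L t x + c t := by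
    intro t ht x hx
    have hex : ∃ t ∈ Tr.T, x ∈ triOf t := ⟨t, ht, hx⟩
    simp only [hI, dif_pos hex]
    exact hco _ hex.choose_spec.1 t ht x hex.choose_spec.2 hx
  have hcont : ∀ F : Finset (E3 × E3 × E3), F ⊆ Tr.T → ContinuousOn I (⋃ t ∈ F, triOf t) := by
    intro F
    induction F using Finset.induction_on with
    | empty => intro _; simp
    | insert t F hn ih =>
      intro hF
      rw [Finset.set_biUnion_insert]
      have ht := hF (Finset.mem_insert_self t F)
      refine ContinuousOn.union_of_isClosed ?_ (ih fun x hx => hF (Finset.mem_insert_of_mem hx)) (tri_compact t).isClosed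
        (F.isCompact_biUnion fun t _ => tri_compact t).isClosed
      have : ContinuousOn (fun x => L t x + c t) (triOf t) :=
        ((LinearMap.toContinuousLinearMap (L t)).continuous.add continuous_const).continuousOn
      exact this.congr (hIe t ht)
  exact ⟨I, ⟨hcont Tr.T subset_rfl, fun t ht => ⟨L t, c t, hIe t ht⟩⟩, fun t ht => ⟨L t, c t, hIe t ht, hL t ht⟩⟩

end Triangulation

namespace GoodTri
variable {Srf : SmoothSurface} {Q : Tub Srf} {γ h : ℝ} {t : E3 × E3 × E3} (g : GoodTri Q γ h t)
include g

/-- Pointwise interpolation error. -/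
lemma interp_pt {w W : E3 → ℝ} (hw : Q.NC w) {L : E3 →ₗ[ℝ] ℝ} {c : ℝ} (hL : ∀ v ∈ vertsOf t, w v = L v + c)
    {x : E3} (hx : x ∈ triOf t) (hWx : W (Q.a x) = L x + c)
    (hW : ∀ᶠ z in nhds (Q.a x), ∃ x' ∈ triOf t, Q.a x' = Q.a z ∧ W z = L x' + c) :
    (w (Q.a x) - W (Q.a x)) ^ 2 + ‖gradient (fun z => w z - W z) (Q.a x)‖ ^ 2 ≤
      (1 + 64 / (γ * h) ^ 2) * (Rem w t.1 x ^ 2 + Rem w t.2.1 x ^ 2 + Rem w t.2.2 x ^ 2) := by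
  have hγ := g.γ_pos
  have hh := g.h_pos
  obtain ⟨h1, h2, h3⟩ := g.lift_deriv hx hW
  have hxN := g.mem hx
  have hyN := Q.memN hxN
  have hyS := Q.a_mem x hxN
  set y := Q.a x with hy
  set ρ := Real.sqrt (Rem w t.1 x ^ 2 + Rem w t.2.1 x ^ 2 + Rem w t.2.2 x ^ 2) with hρ
  have hρ2 : ρ ^ 2 = Rem w t.1 x ^ 2 + Rem w t.2.1 x ^ 2 + Rem w t.2.2 x ^ 2 := Real.sq_sqrt (by positivity)
  have hρ0 : 0 ≤ ρ := Real.sqrt_nonneg _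
  have hRv : ∀ v ∈ vertsOf t, |Rem w v x| ≤ ρ := by
    intro v hv
    refine abs_le_of_sq_le_sq ?_ hρ0
    rw [hρ2]
    simp only [vertsOf, Set.mem_insert_iff, Set.mem_singleton_iff] at hv
    have := sq_nonneg (Rem w t.1 x); have := sq_nonneg (Rem w t.2.1 x); have := sq_nonneg (Rem w t.2.2 x)
    rcases hv with rfl | rfl | rfl <;> linarith
  set L' : E3 →ₗ[ℝ] ℝ := L - (fderiv ℝ w x : E3 →ₗ[ℝ] ℝ) with hL'
  set c' : ℝ := c - w x + fderiv ℝ w x x with hc'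
  have hM : ∀ v ∈ vertsOf t, |L' v + c'| ≤ ρ := by
    intro v hv
    have : L' v + c' = Rem w v x := by
      simp only [hL', hc', Rem, LinearMap.sub_apply, ContinuousLinearMap.coe_coe, map_sub, hL v hv]; ring
    rw [this]; exact hRv v hv
  have e1 := g.aff_le hM hx
  have e2 : L' x + c' = W y - w y := by
    rw [hWx, hy, hw.inv x hxN]
    simp only [hL', hc', LinearMap.sub_apply, ContinuousLinearMap.coe_coe]; ring
  rw [e2] at e1
  set G := gradient (fun z => w z - W z) y with hG
  have hWd := h1.differentiableAt (by simp : ((⊤ : ℕ∞) : WithTop ℕ∞) ≠ 0)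
  have hGi : ∀ v, ⟪G, v⟫ = fderiv ℝ w y v - fderiv ℝ W y v := fun v => by
    rw [hG, gradient, InnerProductSpace.toDual_symm_apply, fderiv_fun_sub (hw.diff hyN) hWd]; rfl
  have hGn : ⟪Srf.n y, G⟫ = 0 := by
    rw [real_inner_comm, hGi, h2, hw.chain hyN, ContinuousLinearMap.comp_apply, Q.deriv_n hyS]; simp
  have hGt : ∀ τ ∈ dirOf t, ⟪G, fderiv ℝ Q.a x τ⟫ = - L' τ := by
    intro τ hτ
    rw [hGi, h3 τ hτ, hL', hw.chain hxN]
    simp only [LinearMap.sub_apply, ContinuousLinearMap.coe_coe, ContinuousLinearMap.comp_apply]; ring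
  set ℓ : E3 →L[ℝ] ℝ := (innerSL ℝ G).comp (fderiv ℝ Q.a x) with hℓ
  set g' : E3 := (Submodule.orthogonalProjectionOnto (dirOf t) ((InnerProductSpace.toDual ℝ E3).symm ℓ) : E3) with hg'
  have hgm : g' ∈ dirOf t := Submodule.coe_mem _
  have hgi : ∀ τ ∈ dirOf t, ⟪g', τ⟫ = ⟪G, fderiv ℝ Q.a x τ⟫ := by
    intro τ hτ
    have := Submodule.inner_orthogonalProjectionOnto_eq_of_mem_right (K := dirOf t) ⟨τ, hτ⟩
      ((InnerProductSpace.toDual ℝ E3).symm ℓ)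
    rw [Submodule.coe_inner] at this
    rw [real_inner_comm] at this
    rw [real_inner_comm]
    exact this.trans InnerProductSpace.toDual_symm_apply
  have e3 := g.G6 hx hGn hgm hgi
  have hK := g.Kh_le
  have e4 : ‖G‖ ≤ 4 * ‖g'‖ := by
    have a1 : 3 * Q.K γ * h * ‖G‖ ≤ 3 / 4 * ‖G‖ := by gcongr; linarith
    have a2 := norm_le_norm_add_norm_sub g' G
    linarith
  have e5 : ‖g'‖ ≤ 2 * ρ / (γ * h) := by
    have a1 : ‖g'‖ * ‖g'‖ = - L' g' := by rw [← hGt g' hgm, ← hgi g' hgm, real_inner_self_eq_norm_mul_norm]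
    have a2 := g.aff_dir hM hgm
    have a3 := neg_abs_le (L' g')
    rcases (norm_nonneg g').eq_or_lt with h0 | h0
    · rw [← h0]; positivity
    · refine le_of_mul_le_mul_right ?_ h0
      linarith
  have e6 : ‖G‖ ^ 2 ≤ 64 / (γ * h) ^ 2 * ρ ^ 2 := by
    calc ‖G‖ ^ 2 ≤ (4 * (2 * ρ / (γ * h))) ^ 2 := by gcongr; linarith
      _ = _ := by field_simp; ring
  have e7 : (w y - W y) ^ 2 ≤ ρ ^ 2 := by
    rw [← neg_sub, neg_sq, ← sq_abs]; gcongr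
  rw [← hρ2]
  linarith

lemma hess_le {w : E3 → ℝ} (hw : Q.NC w) {x : E3} (hx : x ∈ triOf t) :
    ‖fderiv ℝ (fderiv ℝ w) x‖ ^ 2 ≤ 2 * Q.C ^ 4 * (w (Q.a x) ^ 2 + ‖fderiv ℝ w (Q.a x)‖ ^ 2 + ‖fderiv ℝ (fderiv ℝ w) (Q.a x)‖ ^ 2) := by
  have hC := Q.C_pos
  have hC1 := Q.C_one
  have d1 := Q.da_le _ g.v1S x (g.d3 hx)
  have d2 := Q.dda_le _ g.v1S x (g.d3 hx)
  set A := ‖fderiv ℝ (fderiv ℝ w) (Q.a x)‖ with hA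
  set B := ‖fderiv ℝ w (Q.a x)‖ with hB
  have hA0 : 0 ≤ A := ContinuousLinearMap.opNorm_nonneg _
  have hB0 : 0 ≤ B := norm_nonneg _
  have h1 : ‖fderiv ℝ (fderiv ℝ w) x‖ ≤ Q.C ^ 2 * A + Q.C * B := by
    refine ContinuousLinearMap.opNorm_le_bound₂ _ (by positivity) fun v v' => ?_
    rw [hw.chain2 (g.mem hx)]
    refine (norm_add_le _ _).trans ?_
    have a1 : ‖fderiv ℝ Q.a x v‖ ≤ Q.C * ‖v‖ := ContinuousLinearMap.le_of_opNorm_le _ d1 v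
    have a2 : ‖fderiv ℝ Q.a x v'‖ ≤ Q.C * ‖v'‖ := ContinuousLinearMap.le_of_opNorm_le _ d1 v'
    have a3 : ‖fderiv ℝ (fderiv ℝ Q.a) x v v'‖ ≤ Q.C * ‖v‖ * ‖v'‖ :=
      (ContinuousLinearMap.le_opNorm₂ _ _ _).trans (by gcongr)
    have b1 : ‖fderiv ℝ (fderiv ℝ w) (Q.a x) (fderiv ℝ Q.a x v) (fderiv ℝ Q.a x v')‖ ≤ A * (Q.C * ‖v‖) * (Q.C * ‖v'‖) :=
      (ContinuousLinearMap.le_opNorm₂ _ _ _).trans (by gcongr)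
    have b2 : ‖fderiv ℝ w (Q.a x) (fderiv ℝ (fderiv ℝ Q.a) x v v')‖ ≤ B * (Q.C * ‖v‖ * ‖v'‖) :=
      (ContinuousLinearMap.le_opNorm _ _).trans (by gcongr)
    calc _ ≤ A * (Q.C * ‖v‖) * (Q.C * ‖v'‖) + B * (Q.C * ‖v‖ * ‖v'‖) := add_le_add b1 b2
      _ = _ := by ring
  have h2 : Q.C * B ≤ Q.C ^ 2 * B := by gcongr; nlinarith
  calc ‖fderiv ℝ (fderiv ℝ w) x‖ ^ 2 ≤ (Q.C ^ 2 * A + Q.C ^ 2 * B) ^ 2 := by gcongr; linarith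
    _ = Q.C ^ 4 * (A + B) ^ 2 := by ring
    _ ≤ Q.C ^ 4 * (2 * (w (Q.a x) ^ 2 + B ^ 2 + A ^ 2)) := by
      gcongr; nlinarith [sq_nonneg (A - B), sq_nonneg (w (Q.a x))]
    _ = _ := by ring

end GoodTri

namespace Triangulation
variable {Srf : SmoothSurface} {γ h : ℝ} (Tr : Triangulation Srf γ h)
variable {Q : Tub Srf} (hg : ∀ t ∈ Tr.T, GoodTri Q γ h t)
include hg

set_option maxHeartbeats 2000000 in
theorem interp_err {w : E3 → ℝ} (hw : Q.NC w) : ∃ I : E3 → ℝ, Tr.IsVh I ∧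
    NN Srf (fun z => w z - Tr.hat Q I z) ≤ 40 * Q.C ^ 4 * (1 + 64 / γ ^ 2) * h ^ 2 *
      ∫ y, (w y ^ 2 + ‖fderiv ℝ w y‖ ^ 2 + ‖fderiv ℝ (fderiv ℝ w) y‖ ^ 2) ∂Srf.μ := by
  obtain ⟨I, hI, hIL⟩ := Tr.exists_interp w
  refine ⟨I, hI, ?_⟩
  have hfin := Tr.S_fin hg
  obtain ⟨t0, ht0⟩ := Tr.T_nonempty
  have hγ := (hg t0 ht0).γ_pos
  have hh := (hg t0 ht0).h_pos
  have hh1 : h ≤ 1 := (hg t0 ht0).h_le.trans Q.δ_le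
  have hκ := (Tr.κ_le hg).2
  have hC := Q.C_pos
  set ρ : E3 → ℝ := fun z => w z - Tr.hat Q I z with hρ
  have hreg : Reg Srf ρ := hw.reg.sub (Tr.reg hg hI)
  set F : E3 → ℝ := fun y => ρ y ^ 2 + ‖gradient ρ y‖ ^ 2 with hF
  set G : E3 → ℝ := fun y => w y ^ 2 + ‖fderiv ℝ w y‖ ^ 2 + ‖fderiv ℝ (fderiv ℝ w) y‖ ^ 2 with hG
  have hFi : Integrable F Srf.μ := hreg.int_N hfin
  have hs2 : ContDiffOn ℝ (⊤ : ℕ∞) (fderiv ℝ (fderiv ℝ w)) Q.N := hw.dsmooth.fderiv_of_isOpen Q.N_open (by simp)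
  have hGi : Integrable G Srf.μ := Srf.int_cont hfin
    (((hw.contS.pow 2).add (norm_cont (hw.dsmooth.continuousOn.mono Q.S_sub))).add (norm_cont (hs2.continuousOn.mono Q.S_sub)))
  have hF0 : ∀ y, 0 ≤ F y := fun y => by positivity
  have hG0 : ∀ y, 0 ≤ G y := fun y => by positivity
  have s1 : NN Srf ρ ≤ 9 / 4 * ∫ y, F y ∂Tr.ν Q := by
    have := cmp_pos (Tr.μ_le_ν hg) hF0 (int_cmp (Tr.ν_le_μ hg) hFi)
    refine this.trans (mul_le_mul_of_nonneg_right hκ (integral_nonneg hF0))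
  have s2 : ∫ y, G y ∂Tr.ν Q ≤ 9 / 4 * ∫ y, G y ∂Srf.μ := by
    have := cmp_pos (Tr.ν_le_μ hg) hG0 hGi
    refine this.trans (mul_le_mul_of_nonneg_right hκ (integral_nonneg hG0))
  set A : ℝ := (1 + 64 / (γ * h) ^ 2) * (3 * h ^ 4 * (2 * Q.C ^ 4)) with hA
  have hA0 : 0 ≤ A := by positivity
  have s3 : ∫ y, F y ∂Tr.ν Q ≤ A * ∫ y, G y ∂Tr.ν Q := by
    rw [Tr.int_ν hg hFi, Tr.int_ν hg hGi, Finset.mul_sum]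
    refine Finset.sum_le_sum fun t ht => ?_
    have g := hg t ht
    obtain ⟨L, c, hL, hLv⟩ := hIL t ht
    have vm : ∀ v ∈ vertsOf t, v ∈ triOf t := fun v hv => vert_mem t hv
    have m1 : t.1 ∈ triOf t := vm _ (by simp [vertsOf])
    have m2 : t.2.1 ∈ triOf t := vm _ (by simp [vertsOf])
    have m3 : t.2.2 ∈ triOf t := vm _ (by simp [vertsOf])
    have i : ∀ v, IntegrableOn (fun x => Rem w v x ^ 2) (triOf t) μH[2] := fun v =>
      GoodTri.cont_int ((g.rem_cont hw.smooth v).pow 2)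
    have q1 : ∫ x in triOf t, F (Q.a x) ∂μH[2] ≤
        ∫ x in triOf t, (1 + 64 / (γ * h) ^ 2) * (Rem w t.1 x ^ 2 + Rem w t.2.1 x ^ 2 + Rem w t.2.2 x ^ 2) ∂μH[2] := by
      refine integral_mono_ae (Tr.int_tri hg hFi ht) ((((i _).add (i _)).add (i _)).const_mul _) ?_
      filter_upwards [Tr.ae_tri hg ht, ae_restrict_mem (tri_measurable t)] with x hxO hx
      exact g.interp_pt hw hLv hx (by rw [Tr.hat_a hg (Tr.mem_Sh.2 ⟨t, ht, hx⟩), hL x hx]) (Tr.hat_ev hg hL hxO)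
    have q2 : ∫ x in triOf t, (1 + 64 / (γ * h) ^ 2) * (Rem w t.1 x ^ 2 + Rem w t.2.1 x ^ 2 + Rem w t.2.2 x ^ 2) ∂μH[2] =
        (1 + 64 / (γ * h) ^ 2) * (∫ x in triOf t, Rem w t.1 x ^ 2 ∂μH[2] + ∫ x in triOf t, Rem w t.2.1 x ^ 2 ∂μH[2] +
          ∫ x in triOf t, Rem w t.2.2 x ^ 2 ∂μH[2]) := by
      rw [integral_const_mul]
      have p1 := integral_add ((i t.1).add (i t.2.1)) (i t.2.2)
      have p2 := integral_add (i t.1) (i t.2.1)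
      simp only [Pi.add_apply] at p1
      rw [p1, p2]
    have r1 := g.rem_int hw.smooth m1
    have r2 := g.rem_int hw.smooth m2
    have r3 := g.rem_int hw.smooth m3
    have iH : IntegrableOn (fun x => ‖fderiv ℝ (fderiv ℝ w) x‖ ^ 2) (triOf t) μH[2] :=
      GoodTri.cont_int (norm_cont (hs2.continuousOn.mono fun x hx => g.mem hx))
    have q3 : ∫ x in triOf t, ‖fderiv ℝ (fderiv ℝ w) x‖ ^ 2 ∂μH[2] ≤ 2 * Q.C ^ 4 * ∫ x in triOf t, G (Q.a x) ∂μH[2] := by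
      rw [← integral_const_mul]
      exact setIntegral_mono_on iH ((Tr.int_tri hg hGi ht).const_mul _) (tri_measurable t) fun x hx => g.hess_le hw hx
    have hp : 0 ≤ 1 + 64 / (γ * h) ^ 2 := by positivity
    calc _ ≤ _ := q1
      _ = _ := q2
      _ ≤ (1 + 64 / (γ * h) ^ 2) * (3 * (h ^ 4 * (2 * Q.C ^ 4 * ∫ x in triOf t, G (Q.a x) ∂μH[2]))) := by
        refine mul_le_mul_of_nonneg_left ?_ hp
        have := mul_le_mul_of_nonneg_left q3 (by positivity : 0 ≤ h ^ 4)
        linarith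
      _ = _ := by rw [hA]; ring
  have hJ : 0 ≤ ∫ y, G y ∂Srf.μ := integral_nonneg hG0
  have hA2 : A ≤ 6 * Q.C ^ 4 * (1 + 64 / γ ^ 2) * h ^ 2 := by
    have e : A = 6 * Q.C ^ 4 * ((h ^ 2 + 64 / γ ^ 2) * h ^ 2) := by
      rw [hA]; field_simp; ring
    rw [e]
    have : h ^ 2 ≤ 1 := by nlinarith
    have : (h ^ 2 + 64 / γ ^ 2) * h ^ 2 ≤ (1 + 64 / γ ^ 2) * h ^ 2 := by gcongr
    calc _ ≤ 6 * Q.C ^ 4 * ((1 + 64 / γ ^ 2) * h ^ 2) := by gcongr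
      _ = _ := by ring
  calc NN Srf ρ ≤ 9 / 4 * (A * (9 / 4 * ∫ y, G y ∂Srf.μ)) := by
        refine s1.trans ?_
        have := mul_le_mul_of_nonneg_left s2 hA0
        linarith
    _ ≤ 9 / 4 * ((6 * Q.C ^ 4 * (1 + 64 / γ ^ 2) * h ^ 2) * (9 / 4 * ∫ y, G y ∂Srf.μ)) := by gcongr
    _ = 243 / 8 * (Q.C ^ 4 * (1 + 64 / γ ^ 2) * h ^ 2 * ∫ y, G y ∂Srf.μ) := by ring
    _ ≤ 40 * (Q.C ^ 4 * (1 + 64 / γ ^ 2) * h ^ 2 * ∫ y, G y ∂Srf.μ) := by gcongr; norm_num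
    _ = _ := by ring

end Triangulation

lemma Reg.BB_le {Srf : SmoothSurface} (hfin : μH[2] Srf.S < ⊤) {v w : E3 → ℝ} (hv : Reg Srf v) (hw : Reg Srf w) :
    BB Srf v w ≤ ∫ y, (‖gradient v y‖ * ‖gradient w y‖ + |v y| * |w y|) ∂Srf.μ := by
  refine integral_mono (hv.int_B hfin hw) (hv.int_A hfin hw) fun y => ?_
  have h1 := real_inner_le_norm (gradient v y) (gradient w y)
  have h2 := le_abs_self (v y * w y)
  rw [abs_mul] at h2
  exact add_le_add h1 h2

lemma final_arith {r E U d w F k a1 a2 a3 : ℝ} (hr : 0 ≤ r) (hE : 0 ≤ E) (hw : 0 ≤ w)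
    (hk0 : 0 ≤ k) (hk : 208 * k ≤ 1)
    (e : E = a1 + a2 + a3) (h1 : a1 ≤ 2 * r + E / 8) (h2 : a2 ≤ 2 * (26 * k) ^ 2 * U + E / 8)
    (h3 : a3 ≤ 50 * k ^ 2 * F + E / 8) (hU : U ≤ 2 * w + 2 * d) (hd : d ≤ 2 * r + 2 * E) :
    d ≤ 14 * r + 10816 * k ^ 2 * w + 200 * k ^ 2 * F := by
  have hk2 : (208 * k) ^ 2 ≤ 1 := by nlinarith
  have q1 : k ^ 2 * U ≤ k ^ 2 * (2 * w + 4 * r + 4 * E) := by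
    apply mul_le_mul_of_nonneg_left _ (sq_nonneg k); linarith
  have q2 : k ^ 2 * r * 43264 ≤ r := by nlinarith
  have q3 : k ^ 2 * E * 43264 ≤ E := by nlinarith
  nlinarith

namespace Triangulation
variable {Srf : SmoothSurface} {γ h : ℝ} (Tr : Triangulation Srf γ h)

lemma IsVh.sub {φ ψ : E3 → ℝ} (hφ : Tr.IsVh φ) (hψ : Tr.IsVh ψ) : Tr.IsVh (fun x => φ x - ψ x) := by
  refine ⟨hφ.1.sub hψ.1, fun t ht => ?_⟩
  obtain ⟨L, c, h1⟩ := hφ.2 t ht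
  obtain ⟨L', c', h2⟩ := hψ.2 t ht
  refine ⟨L - L', c - c', fun x hx => ?_⟩
  simp only
  rw [h1 x hx, h2 x hx, LinearMap.sub_apply]; ring

variable {Q : Tub Srf} (hg : ∀ t ∈ Tr.T, GoodTri Q γ h t)
include hg

lemma main_err {K₂ : ℝ} (hK₂ : ∀ f u, SmoothNear f Srf.S → IsSolution Srf f u →
      ∫ y, (u (Q.a y)^2 + ‖fderiv ℝ (fun z => u (Q.a z)) y‖^2 + ‖fderiv ℝ (fderiv ℝ (fun z => u (Q.a z))) y‖^2) ∂Srf.μ ≤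
        K₂ * ∫ y, f y^2 ∂Srf.μ)
    (hk : 208 * (Q.K γ * h) ≤ 1) {f u uh : E3 → ℝ} (hf : SmoothNear f Srf.S) (hu : IsSolution Srf f u)
    (huh : Tr.IsDiscreteSolution f uh) :
    NN Srf (fun z => u (Q.a z) - Tr.hat Q uh z) ≤
      (14 * (40 * Q.C ^ 4 * (1 + 64 / γ ^ 2)) * K₂ + 10816 * Q.K γ ^ 2 * K₂ + 200 * Q.K γ ^ 2) * h ^ 2 * ∫ y, f y ^ 2 ∂Srf.μ := by
  have hfin := Tr.S_fin hg
  obtain ⟨t0, ht0⟩ := Tr.T_nonempty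
  have hk0 : 0 ≤ Q.K γ * h := (hg t0 ht0).Kh0.le
  have hwN := Q.nc_hat hu.1
  have hfc : ContinuousOn f Srf.S := by
    obtain ⟨V, _, hSV, hc⟩ := hf
    exact hc.continuousOn.mono hSV
  have hreg := hK₂ f u hf hu
  obtain ⟨I, hI, hIe⟩ := Tr.interp_err hg hwN
  have hφ := IsVh.sub Tr huh.1 hI
  have rW : Reg Srf (fun z => u (Q.a z)) := hwN.reg
  have rU := Tr.reg hg huh.1
  have rI := Tr.reg hg hI
  have rE := Tr.reg hg hφ
  have rρ := rW.sub rI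
  have hEq : Tr.hat Q (fun x => uh x - I x) = fun z => Tr.hat Q uh z - Tr.hat Q I z := rfl
  have c1 := Tr.form_close hg huh.1 hφ
  have c2 := Tr.rhs_close hg hfc hφ
  have c3 := Tr.weak_hat hg hf hu hφ
  have c4 := huh.2 _ hφ
  have b1 := rU.BB_sub hfin rI rE
  have b2 := rW.BB_sub hfin rI rE
  have b3 := rE.NN_eq hfin
  have y1 := (rρ.BB_le hfin rE).trans (by simpa using rρ.young hfin rE 1)
  have y2 := rU.young hfin rE (26 * (Q.K γ * h))
  have y3 : 5 * (Q.K γ * h) * ∫ y, |f y| * |Tr.hat Q (fun x => uh x - I x) y| ∂Srf.μ ≤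
      50 * (Q.K γ * h) ^ 2 * ∫ y, f y ^ 2 ∂Srf.μ + NN Srf (Tr.hat Q (fun x => uh x - I x)) / 8 := by
    have i1 : Integrable (fun y => f y ^ 2) Srf.μ := Srf.int_cont hfin (hfc.pow 2)
    have e : 50 * (Q.K γ * h) ^ 2 * ∫ y, f y ^ 2 ∂Srf.μ + NN Srf (Tr.hat Q (fun x => uh x - I x)) / 8 =
        ∫ y, (50 * (Q.K γ * h) ^ 2 * f y ^ 2 + (1 / 8) * (Tr.hat Q (fun x => uh x - I x) y ^ 2 +
          ‖gradient (Tr.hat Q (fun x => uh x - I x)) y‖ ^ 2)) ∂Srf.μ := by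
      rw [integral_add (i1.const_mul _) ((rE.int_N hfin).const_mul _), integral_const_mul, integral_const_mul]
      unfold NN; ring
    rw [e, ← integral_const_mul]
    refine integral_mono ((Srf.int_cont hfin (hfc.abs.mul rE.cont.abs)).const_mul _)
      ((i1.const_mul _).add ((rE.int_N hfin).const_mul _)) fun y => ?_
    have p1 := sq_abs (f y)
    have p2 := sq_abs (Tr.hat Q (fun x => uh x - I x) y)
    have p3 := sq_nonneg (‖gradient (Tr.hat Q (fun x => uh x - I x)) y‖)
    simp only
    rw [← p1, ← p2]
    nlinarith [sq_nonneg (20 * (Q.K γ * h) * |f y| - |Tr.hat Q (fun x => uh x - I x) y|)]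
  have n1 := rρ.NN_sub hfin rE
  have e1 : (fun y => (u (Q.a y) - Tr.hat Q I y) - Tr.hat Q (fun x => uh x - I x) y) =
      fun z => u (Q.a z) - Tr.hat Q uh z := by funext z; rw [hEq]; ring
  rw [e1] at n1
  have n2 := rW.NN_sub hfin (rW.sub rU)
  have e2 : (fun y => u (Q.a y) - (u (Q.a y) - Tr.hat Q uh y)) = Tr.hat Q uh := by funext z; ring
  rw [e2] at n2
  have hF0 : 0 ≤ ∫ y, f y ^ 2 ∂Srf.μ := integral_nonneg fun y => sq_nonneg _
  have n3 : NN Srf (fun z => u (Q.a z)) ≤ K₂ * ∫ y, f y ^ 2 ∂Srf.μ := by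
    refine le_trans ?_ hreg
    have hs2 : ContDiffOn ℝ (⊤ : ℕ∞) (fderiv ℝ (fderiv ℝ (fun z => u (Q.a z)))) Q.N :=
      hwN.dsmooth.fderiv_of_isOpen Q.N_open (by simp)
    have hGi := Srf.int_cont hfin
      (((hwN.contS.pow 2).add (norm_cont (hwN.dsmooth.continuousOn.mono Q.S_sub))).add (norm_cont (hs2.continuousOn.mono Q.S_sub)))
    refine integral_mono (rW.int_N hfin) hGi fun y => ?_
    simp only [grad_norm]
    exact le_add_of_nonneg_right (sq_nonneg _)
  have c4' : Tr.ahForm uh (fun x => uh x - I x) = ∫ x in Tr.Sh, f (Tr.a x) * (uh x - I x) ∂μH[2] := c4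
  have main := final_arith (r := NN Srf (fun z => u (Q.a z) - Tr.hat Q I z))
    (E := NN Srf (Tr.hat Q (fun x => uh x - I x))) (U := NN Srf (Tr.hat Q uh))
    (d := NN Srf (fun z => u (Q.a z) - Tr.hat Q uh z)) (w := NN Srf (fun z => u (Q.a z)))
    (F := ∫ y, f y ^ 2 ∂Srf.μ) (k := Q.K γ * h)
    (a1 := BB Srf (fun z => u (Q.a z) - Tr.hat Q I z) (Tr.hat Q (fun x => uh x - I x)))
    (a2 := BB Srf (Tr.hat Q uh) (Tr.hat Q (fun x => uh x - I x)) - Tr.ahForm uh (fun x => uh x - I x))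
    (a3 := ∫ x in Tr.Sh, f (Tr.a x) * (uh x - I x) ∂μH[2] - ∫ y, f y * Tr.hat Q (fun x => uh x - I x) y ∂Srf.μ)
    (Reg.NN_nonneg _) (Reg.NN_nonneg _) (Reg.NN_nonneg _) hk0 hk
    (by
      have b1' : BB Srf (Tr.hat Q (fun x => uh x - I x)) (Tr.hat Q (fun x => uh x - I x)) = _ := b1
      rw [b3, b1', b2, c3, c4']; ring)
    y1 ((neg_sub (Tr.ahForm uh (fun x => uh x - I x)) _ ▸ neg_le_abs _).trans (c1.trans y2))
    ((le_abs_self _).trans (c2.trans y3)) n2 n1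
  refine main.trans ?_
  have hC := Q.C_pos
  have z1 : 0 ≤ 40 * Q.C ^ 4 * (1 + 64 / γ ^ 2) * h ^ 2 := by positivity
  have z2 := hIe.trans (mul_le_mul_of_nonneg_left hreg z1)
  have z3 := mul_le_mul_of_nonneg_left n3 (by positivity : 0 ≤ 10816 * (Q.K γ * h) ^ 2)
  calc _ ≤ 14 * (40 * Q.C ^ 4 * (1 + 64 / γ ^ 2) * h ^ 2 * (K₂ * ∫ y, f y ^ 2 ∂Srf.μ)) +
        10816 * (Q.K γ * h) ^ 2 * (K₂ * ∫ y, f y ^ 2 ∂Srf.μ) + 200 * (Q.K γ * h) ^ 2 * ∫ y, f y ^ 2 ∂Srf.μ := by linarith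
    _ = _ := by ring

lemma lhs_eq {u uh : E3 → ℝ} (hu : SmoothNear u Srf.S) (huh : Tr.IsVh uh) :
    ∫ x in Srf.S, ((u x - Tr.liftS uh x) ^ 2 + ‖Srf.grad (fun y => u y - Tr.liftS uh y) x‖ ^ 2) ∂μH[2] =
      NN Srf (fun z => u (Q.a z) - Tr.hat Q uh z) := by
  have r := (Q.nc_hat hu).reg.sub (Tr.reg hg huh)
  refine integral_congr_ae ?_
  filter_upwards [r.diff, Srf.ae_S] with y h1 hy
  rw [Q.grad_eq (φ := fun y => u y - Tr.liftS uh y) hy h1, hat, Q.fix hy]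
  rfl

end Triangulation

/-- **H¹-error estimate.** `‖u − U_h‖_{H¹(S)} ≤ c h ‖f‖_{L²(S)}`. -/
theorem h1_error_estimate (Srf : SmoothSurface) (γ₀ : ℝ) (hγ₀ : 0 < γ₀) :
    ∃ c > 0, ∃ h₀ > 0,
      ∀ h : ℝ, 0 < h → h ≤ h₀ →
        ∀ Tr : Triangulation Srf γ₀ h, ∀ f u uh : E3 → ℝ,
          SmoothNear f Srf.S →
          IsSolution Srf f u →
          Tr.IsDiscreteSolution f uh →
          Real.sqrt (∫ x in Srf.S,
              ((u x - Tr.liftS uh x) ^ 2 +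
                ‖Srf.grad (fun y => u y - Tr.liftS uh y) x‖ ^ 2) ∂μH[2]) ≤
            c * h * Real.sqrt (∫ x in Srf.S, f x ^ 2 ∂μH[2]) := by
  by_cases hex : ∃ h' : ℝ, Nonempty (Triangulation Srf γ₀ h')
  swap
  · exact ⟨1, one_pos, 1, one_pos, fun h _ _ Tr => absurd ⟨h, ⟨Tr⟩⟩ hex⟩
  obtain ⟨h', ⟨Tr₀⟩⟩ := hex
  obtain ⟨Q, -⟩ := Tr₀.toPJ.exists_tub
  have hδ := Q.δ_pos
  have hKp : 0 < 208 * (|Q.K γ₀| + 1) := by positivity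
  have hgood : ∀ h : ℝ, 0 < h → h ≤ min Q.δ (1 / (208 * (|Q.K γ₀| + 1))) →
      208 * (Q.K γ₀ * h) ≤ 1 ∧ ∀ Tr : Triangulation Srf γ₀ h, ∀ t ∈ Tr.T, GoodTri Q γ₀ h t := by
    intro h hh hle
    have h1 : h * (208 * (|Q.K γ₀| + 1)) ≤ 1 := (le_div_iff₀ hKp).1 (hle.trans (min_le_right _ _))
    have h2 : h * Q.K γ₀ ≤ h * (|Q.K γ₀| + 1) :=
      mul_le_mul_of_nonneg_left (by linarith [le_abs_self (Q.K γ₀)]) hh.le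
    exact ⟨by linarith, fun Tr => Tr.good Q hγ₀ hh (hle.trans (min_le_left _ _)) (by linarith)⟩
  by_cases hfin : μH[2] Srf.S < ⊤
  swap
  · exact ⟨1, one_pos, _, lt_min hδ (one_div_pos.2 hKp), fun h hh hle Tr =>
      absurd (Tr.S_fin ((hgood h hh hle).2 Tr)) hfin⟩
  obtain ⟨K₂, hK1, hK₂⟩ := Q.h2_reg hfin
  have hC := Q.C_pos
  set M : ℝ := 14 * (40 * Q.C ^ 4 * (1 + 64 / γ₀ ^ 2)) * K₂ + 10816 * Q.K γ₀ ^ 2 * K₂ + 200 * Q.K γ₀ ^ 2 with hM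
  have hM0 : 0 < M := by positivity
  refine ⟨Real.sqrt M, Real.sqrt_pos.2 hM0, _, lt_min hδ (one_div_pos.2 hKp), fun h hh hle Tr f u uh hf hu huh => ?_⟩
  obtain ⟨hk, hg⟩ := hgood h hh hle
  have hg := hg Tr
  rw [Tr.lhs_eq hg hu.1 huh.1]
  calc _ ≤ Real.sqrt (M * h ^ 2 * ∫ x in Srf.S, f x ^ 2 ∂μH[2]) :=
        Real.sqrt_le_sqrt (Tr.main_err hg hK₂ hk hf hu huh)
    _ = _ := by
      rw [Real.sqrt_mul (by positivity), Real.sqrt_mul hM0.le, Real.sqrt_sq hh.le]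

end
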